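/- There is ε₀ > 0 such that for every ε ∈ (0, ε₀] there is C₀ > 0 such that for every sufficiently small μ > 0 there is C > 0 such that for every c > 0 there is n₀ ∈ ℕ with the following property: for all n ≥ n₀, every d with C·log n ≤ d ≤ n−1 and dn even, and every integer m with ε·d·n ≤ m ≤ (n−1−d)n/2, if F ~ F(n,d,m), then with probability at least 1 − c·n^{−2} the following holds: for every pair of edges e, f ∈ E(F), |{K ∈ 𝒦_d(F) : e ∈ E(K)}| ≤ (1 + C₀·max{μ/log n, (n·log n/m)^{1/8}})·|{K ∈ 𝒦_d(F) : f ∈ E(K)}|. (Theorem 2.3.) -/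

import Mathlib

open scoped Classical ENNReal

noncomputable section

namespace Sandwich

variable {n : ℕ}

/-- The degree of the vertex `v` in the graph `G`. -/
def deg (G : SimpleGraph (Fin n)) (v : Fin n) : ℕ := Nat.card (G.neighborSet v)

/-- `G` is a `d`-regular graph. -/
def IsRegularGraph (G : SimpleGraph (Fin n)) (d : ℕ) : Prop := ∀ v, deg G v = d

/-- The number of edges of `G`. -/
def edgeCount (G : SimpleGraph (Fin n)) : ℕ := G.edgeSet.ncard

/-- The probability of the event `P` under the probability mass function `μ`. -/
def prEvent {α : Type*} (μ : PMF α) (P : α → Prop) : ℝ≥0∞ := ∑' a, if P a then μ a else 0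

/-- `μ` is the uniform distribution on the set `S`. -/
def IsUniformOn {α : Type*} (μ : PMF α) (S : Set α) : Prop :=
  ∀ a, μ a = if a ∈ S then (S.ncard : ℝ≥0∞)⁻¹ else 0

/-- `P` lists the `k+1` vertices of a `(G₁,G₂)`-alternating path of length `k`: the vertices
are distinct and consecutive vertices are joined by an edge of `G₁` (for steps of even index)
or of `G₂` (for steps of odd index). -/
def IsAltSeq (G₁ G₂ : SimpleGraph (Fin n)) (k : ℕ) (P : Fin (k + 1) → Fin n) : Prop :=
  Function.Injective P ∧
    ∀ i : Fin k, if (i : ℕ) % 2 = 0 then G₁.Adj (P i.castSucc) (P i.succ)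
      else G₂.Adj (P i.castSucc) (P i.succ)

/-- The number of `(G₁,G₂)`-alternating `x,y`-paths of length `k` with no internal vertex
in `Z`. -/
def altPathCount (G₁ G₂ : SimpleGraph (Fin n)) (k : ℕ) (x y : Fin n) (Z : Set (Fin n)) : ℕ :=
  Nat.card {P : Fin (k + 1) → Fin n // IsAltSeq G₁ G₂ k P ∧ P 0 = x ∧ P (Fin.last k) = y ∧
    ∀ i : Fin (k + 1), i ≠ 0 → i ≠ Fin.last k → P i ∉ Z}

/-- The number of `(G₁,G₂)`-alternating paths of length `k` starting at `x`. -/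
def altStartCount (G₁ G₂ : SimpleGraph (Fin n)) (k : ℕ) (x : Fin n) : ℕ :=
  Nat.card {P : Fin (k + 1) → Fin n // IsAltSeq G₁ G₂ k P ∧ P 0 = x}

/-- The external neighbourhood `N_G(U)` of a set of vertices `U`. -/
def nbhd (G : SimpleGraph (Fin n)) (U : Set (Fin n)) : Set (Fin n) :=
  {v | v ∉ U ∧ ∃ u ∈ U, G.Adj u v}

/-- `e_G(U)`, the number of edges of `G` with both endpoints in `U`. -/
def edgesWithin (G : SimpleGraph (Fin n)) (U : Set (Fin n)) : ℕ :=
  {e ∈ G.edgeSet | ∀ v ∈ e, v ∈ U}.ncard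

/-- `e_G(U,V) = |{(u,v) : u ∈ U, v ∈ V, uv ∈ E(G)}|`. -/
def edgesBetween (G : SimpleGraph (Fin n)) (U V : Set (Fin n)) : ℕ :=
  {p : Fin n × Fin n | p.1 ∈ U ∧ p.2 ∈ V ∧ G.Adj p.1 p.2}.ncard

/-- `|E_{≥2,G}(U)|`, the number of edges `xy ∈ E(G)` with `x ∈ U`, `y ∉ U` such that some
`x' ∈ U ∖ {x}` also satisfies `x'y ∈ E(G)`. -/
def E2count (G : SimpleGraph (Fin n)) (U : Set (Fin n)) : ℕ :=
  {e : Sym2 (Fin n) | e ∈ G.edgeSet ∧ ∃ x y, e = s(x, y) ∧ x ∈ U ∧ y ∉ U ∧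
    ∃ x' ∈ U, x' ≠ x ∧ G.Adj x' y}.ncard

/-- `Σ_{u ∈ N_{F∖K}(v)} Σ_{u' ∈ N_K(u)} d_{F∖K}(u')`. -/
def doubleDegSum (F K : SimpleGraph (Fin n)) (v : Fin n) : ℝ :=
  ∑ u : Fin n, if (F \ K).Adj v u then
    ∑ u' : Fin n, if K.Adj u u' then (deg (F \ K) u' : ℝ) else 0
  else 0

/-- `μ` is the law of the binomial random graph `G(n,p)`. -/
def IsGnp (μ : PMF (SimpleGraph (Fin n))) (p : ℝ) : Prop :=
  ∀ G, μ G = ENNReal.ofReal (p ^ edgeCount G * (1 - p) ^ (n.choose 2 - edgeCount G))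

/-- `μ` is the law of `G(n,p)`, where `p` is truncated to `[0,1]` (so that `G(n,p)` is the
empty graph for `p ≤ 0` and the complete graph for `p ≥ 1`). -/
def IsGnpLaw (μ : PMF (SimpleGraph (Fin n))) (p : ℝ) : Prop :=
  IsGnp μ (max 0 (min p 1))

/-- `μ` is the law of `K + E`, where `E` includes each pair not in `E(K)` independently with
probability `p`. -/
def IsAddGnp (μ : PMF (SimpleGraph (Fin n))) (K : SimpleGraph (Fin n)) (p : ℝ) : Prop :=
  ∀ F, μ F = if K ≤ F then
      ENNReal.ofReal (p ^ (edgeCount F - edgeCount K) * (1 - p) ^ (n.choose 2 - edgeCount F))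
    else 0

/-- `ν` is the joint law of `(K, F)` where `K ~ G_d(n)` is a uniformly random `d`-regular graph
and `F = K + E`, `E` including each pair not in `E(K)` independently with probability `p`. -/
def IsRegAddGnp (ν : PMF (SimpleGraph (Fin n) × SimpleGraph (Fin n))) (d : ℕ) (p : ℝ) : Prop :=
  ∀ w, ν w = if IsRegularGraph w.1 d ∧ w.1 ≤ w.2 then
      ({G : SimpleGraph (Fin n) | IsRegularGraph G d}.ncard : ℝ≥0∞)⁻¹ *
        ENNReal.ofReal (p ^ (edgeCount w.2 - edgeCount w.1) *
          (1 - p) ^ (n.choose 2 - edgeCount w.2))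
    else 0

/-- `ν` is the joint law of an independent pair `(K, F)` with `K ~ G_d(n)` and `F ~ G(n,q)`. -/
def IsRegIndepGnp (ν : PMF (SimpleGraph (Fin n) × SimpleGraph (Fin n))) (d : ℕ) (q : ℝ) :
    Prop :=
  ∀ w, ν w = (if IsRegularGraph w.1 d then
      ({G : SimpleGraph (Fin n) | IsRegularGraph G d}.ncard : ℝ≥0∞)⁻¹ else 0) *
      ENNReal.ofReal (q ^ edgeCount w.2 * (1 - q) ^ (n.choose 2 - edgeCount w.2))

section LinearAlgebra

variable {V : Type*} [Fintype V]

/-- The Euclidean norm of a real vector. -/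
def l2 (g : V → ℝ) : ℝ := √(∑ i, g i ^ 2)

lemma l2_eq_norm (g : V → ℝ) : l2 g = ‖(WithLp.toLp 2 g : EuclideanSpace ℝ V)‖ := by
  simp [l2, EuclideanSpace.norm_eq]

lemma l2_nonneg (g : V → ℝ) : 0 ≤ l2 g := Real.sqrt_nonneg _

lemma l2_sq (g : V → ℝ) : l2 g ^ 2 = ∑ i, g i ^ 2 :=
  Real.sq_sqrt (Finset.sum_nonneg fun _ _ => sq_nonneg _)

lemma l2_add_le (g h : V → ℝ) : l2 (g + h) ≤ l2 g + l2 h := by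
  simp only [l2_eq_norm, WithLp.toLp_add]
  exact norm_add_le _ _

lemma l2_smul (c : ℝ) (g : V → ℝ) : l2 (c • g) = |c| * l2 g := by
  simp only [l2_eq_norm, WithLp.toLp_smul, norm_smul, Real.norm_eq_abs]

lemma l2_le_of_sq_le {g : V → ℝ} {c : ℝ} (hc : 0 ≤ c) (h : ∑ i, g i ^ 2 ≤ c ^ 2) :
    l2 g ≤ c := Real.sqrt_le_iff.2 ⟨hc, h⟩

lemma abs_dotProduct_le (g h : V → ℝ) : |g ⬝ᵥ h| ≤ l2 g * l2 h := by
  have := Finset.sum_mul_sq_le_sq_mul_sq Finset.univ g h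
  rw [← l2_sq, ← l2_sq, ← mul_pow] at this
  exact abs_le_of_sq_le_sq this (mul_nonneg (l2_nonneg _) (l2_nonneg _))

lemma l2_le_of_abs_le {g : V → ℝ} {c : ℝ} (hc : 0 ≤ c) (h : ∀ i, |g i| ≤ c) :
    l2 g ≤ c * √(Fintype.card V) := by
  apply l2_le_of_sq_le (by positivity)
  rw [mul_pow, Real.sq_sqrt (by positivity)]
  calc ∑ i, g i ^ 2 ≤ ∑ _i : V, c ^ 2 := Finset.sum_le_sum fun i _ => by
        rw [← sq_abs (g i)]; exact pow_le_pow_left₀ (abs_nonneg _) (h i) 2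
    _ = _ := by simp [mul_comm]

lemma l2_le_sum {g : V → ℝ} (h : ∀ i, 0 ≤ g i) : l2 g ≤ ∑ i, g i :=
  l2_le_of_sq_le (Finset.sum_nonneg fun i _ => h i)
    (Finset.sum_sq_le_sq_sum_of_nonneg fun i _ => h i)

/-- The mean of a real vector. -/
def mean (g : V → ℝ) : ℝ := (∑ i, g i) / Fintype.card V

/-- The deviation of a vector from its mean. -/
def centred (g : V → ℝ) : V → ℝ := g - fun _ => mean g

lemma sum_centred [Nonempty V] (g : V → ℝ) : ∑ i, centred g i = 0 := by
  simp only [centred, Pi.sub_apply, Finset.sum_sub_distrib, Finset.sum_const, Finset.card_univ,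
    nsmul_eq_mul, mean]
  field_simp
  simp

/-- Among all constants, the mean minimises the distance to a vector. -/
lemma l2_centred_le [Nonempty V] (g : V → ℝ) (c : ℝ) : l2 (centred g) ≤ l2 (g - fun _ => c) := by
  apply l2_le_of_sq_le (l2_nonneg _)
  rw [l2_sq]
  have h0 := sum_centred g
  have : ∀ i, (g - fun _ : V => c) i ^ 2 =
      centred g i ^ 2 + 2 * (mean g - c) * centred g i + (mean g - c) ^ 2 := fun i => by
    simp only [centred, Pi.sub_apply]; ring
  simp only [this, Finset.sum_add_distrib, ← Finset.mul_sum, h0]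
  have : 0 ≤ ∑ _i : V, (mean g - c) ^ 2 := Finset.sum_nonneg fun _ _ => sq_nonneg _
  linarith

lemma dotProduct_eq_mean [Nonempty V] (g h : V → ℝ) :
    g ⬝ᵥ h = Fintype.card V * mean g * mean h + centred g ⬝ᵥ centred h := by
  have h1 : centred g ⬝ᵥ centred h = ∑ i, (g i * h i - mean h * g i - mean g * h i
      + mean g * mean h) := by
    simp only [dotProduct, centred, Pi.sub_apply]
    refine Finset.sum_congr rfl fun i _ => by ring
  have hg : ∑ i, g i = Fintype.card V * mean g := by simp [mean]; field_simp
  have hh : ∑ i, h i = Fintype.card V * mean h := by simp [mean]; field_simp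
  rw [h1]
  simp only [Finset.sum_add_distrib, Finset.sum_sub_distrib, ← Finset.mul_sum, hg, hh]
  simp [dotProduct]
  ring

lemma mulVec_mono {A : Matrix V V ℝ} (hA : ∀ x y, 0 ≤ A x y) {g h : V → ℝ}
    (hgh : ∀ x, g x ≤ h x) (x : V) : (A.mulVec g) x ≤ (A.mulVec h) x :=
  Finset.sum_le_sum fun y _ => mul_le_mul_of_nonneg_left (hgh y) (hA x y)

/-- A symmetric substochastic matrix is a contraction. -/
lemma l2_mulVec_le_of_stochastic {B : Matrix V V ℝ} (hB : ∀ x y, 0 ≤ B x y)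
    (hrow : ∀ x, ∑ y, B x y ≤ 1) (hcol : ∀ y, ∑ x, B x y ≤ 1) (g : V → ℝ) :
    l2 (B.mulVec g) ≤ l2 g := by
  apply l2_le_of_sq_le (l2_nonneg _)
  rw [l2_sq]
  have h1 : ∀ x, (B.mulVec g) x ^ 2 ≤ ∑ y, B x y * g y ^ 2 := fun x => by
    have := Finset.sum_sq_le_sum_mul_sum_of_sq_le_mul Finset.univ (r := fun y => B x y * g y)
      (f := fun y => B x y) (g := fun y => B x y * g y ^ 2) (fun y _ => hB x y)
      (fun y _ => mul_nonneg (hB x y) (sq_nonneg _)) (fun y _ => le_of_eq (by ring))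
    refine this.trans ?_
    exact mul_le_of_le_one_left
      (Finset.sum_nonneg fun y _ => mul_nonneg (hB x y) (sq_nonneg _)) (hrow x)
  calc ∑ x, (B.mulVec g) x ^ 2 ≤ ∑ x, ∑ y, B x y * g y ^ 2 := Finset.sum_le_sum fun x _ => h1 x
    _ = ∑ y, (∑ x, B x y) * g y ^ 2 := by
        rw [Finset.sum_comm]; simp only [Finset.sum_mul]
    _ ≤ ∑ y, g y ^ 2 := Finset.sum_le_sum fun y _ =>
        mul_le_of_le_one_left (sq_nonneg _) (hcol y)

end LinearAlgebra

section Words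

variable {V : Type*} [Fintype V] [DecidableEq V]

/-- The product of `k` consecutive matrices of a sequence, starting at index `i`. -/
def word (S : ℕ → Matrix V V ℝ) (i : ℕ) : ℕ → Matrix V V ℝ
  | 0 => 1
  | k + 1 => word S i k * S (i + k)

lemma word_add (S : ℕ → Matrix V V ℝ) (i k l : ℕ) :
    word S i (k + l) = word S i k * word S (i + k) l := by
  induction l with
  | zero => simp [word]
  | succ l ih => rw [← add_assoc, word, ih, word, Matrix.mul_assoc, add_assoc]

lemma word_one (S : ℕ → Matrix V V ℝ) (i : ℕ) : word S i 1 = S i := by simp [word]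

lemma word_succ_left (S : ℕ → Matrix V V ℝ) (i k : ℕ) :
    word S i (k + 1) = S i * word S (i + 1) k := by
  rw [add_comm k 1, word_add, word_one]

lemma word_nonneg {S : ℕ → Matrix V V ℝ} (hS : ∀ i x y, 0 ≤ S i x y) (i k : ℕ) (x y : V) :
    0 ≤ word S i k x y := by
  induction k generalizing y with
  | zero => simp only [word, Matrix.one_apply]; split_ifs <;> norm_num
  | succ k ih => exact Finset.sum_nonneg fun z _ => mul_nonneg (ih z) (hS _ _ _)

/-- The sequence `A, B, A, B, …`. -/
def alternating (A B : Matrix V V ℝ) (i : ℕ) : Matrix V V ℝ := if i % 2 = 0 then A else B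

lemma alternating_add_two (A B : Matrix V V ℝ) (i : ℕ) :
    alternating A B (i + 2) = alternating A B i := by simp [alternating]

lemma word_alternating_add_two (A B : Matrix V V ℝ) (i k : ℕ) :
    word (alternating A B) (i + 2) k = word (alternating A B) i k := by
  induction k with
  | zero => rfl
  | succ k ih => rw [word, word, ih, add_right_comm, alternating_add_two]

lemma word_alternating_transpose {A B : Matrix V V ℝ} (hA : A.transpose = A)
    (hB : B.transpose = B) (i k : ℕ) :
    (word (alternating A B) i k).transpose = word (alternating A B) (i + k + 1) k := by
  induction k with
  | zero => simp [word]
  | succ k ih =>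
    have h : (alternating A B (i + k)).transpose = alternating A B (i + k) := by
      unfold alternating; split_ifs <;> assumption
    rw [word, Matrix.transpose_mul, ih, h, word_succ_left,
      show i + (k + 1) + 1 = (i + k) + 2 by ring, alternating_add_two,
      show i + k + 2 + 1 = (i + k + 1) + 2 by ring, word_alternating_add_two]

/-- A pair of normalised symmetric nonnegative matrices whose alternating products mix. -/
structure MixingPair (A B : Matrix V V ℝ) (γ σ κ θ : ℝ) : Prop where
  nonneg_left : ∀ x y, 0 ≤ A x y
  nonneg_right : ∀ x y, 0 ≤ B x y
  symm_left : A.transpose = A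
  symm_right : B.transpose = B
  row_right : B.mulVec 1 = 1
  row_left : ∀ x, |A.mulVec 1 x - 1| ≤ σ
  entry_le : ∀ x y, (A * B) x y ≤ θ
  harmonic : ∀ x, |(A * B).mulVec (A.mulVec 1) x - A.mulVec 1 x| ≤ κ * A.mulVec 1 x
  contract : ∀ g : V → ℝ, ∑ x, g x = 0 → l2 ((A * B).mulVec g) ≤ (1 - γ) * l2 g

namespace MixingPair

variable {A B : Matrix V V ℝ} {γ σ κ θ : ℝ}

lemma alternating_nonneg (h : MixingPair A B γ σ κ θ) (i : ℕ) (x y : V) :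
    0 ≤ alternating A B i x y := by
  unfold alternating; split_ifs
  exacts [h.nonneg_left x y, h.nonneg_right x y]

lemma word_nonneg (h : MixingPair A B γ σ κ θ) (i k : ℕ) (x y : V) :
    0 ≤ word (alternating A B) i k x y := Sandwich.word_nonneg h.alternating_nonneg i k x y

/-- The approximately harmonic potential associated with the alternating products. -/
def potential (A B : Matrix V V ℝ) (i : ℕ) : V → ℝ :=
  if i % 2 = 0 then A.mulVec 1 else B.mulVec (A.mulVec 1)

lemma mulVec_le_const (h : MixingPair A B γ σ κ θ) {g : V → ℝ} {c : ℝ} (hg : ∀ x, g x ≤ c)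
    (x : V) : B.mulVec g x ≤ c := by
  have h1 := mulVec_mono h.nonneg_right (h := fun _ => c) hg x
  have : (fun _ : V => c) = c • (1 : V → ℝ) := by ext; simp
  rw [this, Matrix.mulVec_smul, h.row_right] at h1
  simpa using h1

lemma const_le_mulVec (h : MixingPair A B γ σ κ θ) {g : V → ℝ} {c : ℝ} (hg : ∀ x, c ≤ g x)
    (x : V) : c ≤ B.mulVec g x := by
  have h1 := mulVec_mono h.nonneg_right (g := fun _ => c) hg x
  have : (fun _ : V => c) = c • (1 : V → ℝ) := by ext; simp
  rw [this, Matrix.mulVec_smul, h.row_right] at h1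
  simpa using h1

lemma potential_le (h : MixingPair A B γ σ κ θ) (i : ℕ) (x : V) :
    potential A B i x ≤ 1 + σ := by
  have h1 : ∀ y, A.mulVec 1 y ≤ 1 + σ := fun y => by have := abs_le.1 (h.row_left y); linarith
  unfold potential; split_ifs
  exacts [h1 x, h.mulVec_le_const h1 x]

lemma le_potential (h : MixingPair A B γ σ κ θ) (i : ℕ) (x : V) :
    1 - σ ≤ potential A B i x := by
  have h1 : ∀ y, 1 - σ ≤ A.mulVec 1 y := fun y => by have := abs_le.1 (h.row_left y); linarith
  unfold potential; split_ifs
  exacts [h1 x, h.const_le_mulVec h1 x]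

lemma step_potential_le (h : MixingPair A B γ σ κ θ) (hκ : 0 ≤ κ) (hσ : σ ≤ 1) (i : ℕ) (x : V) :
    (alternating A B i).mulVec (potential A B (i + 1)) x ≤ (1 + κ) * potential A B i x := by
  have hp := h.le_potential i x
  rcases Nat.mod_two_eq_zero_or_one i with hi | hi
  · have h1 : (i + 1) % 2 ≠ 0 := by omega
    have := abs_le.1 (h.harmonic x)
    rw [← Matrix.mulVec_mulVec] at this
    simp only [alternating, potential, hi, h1, if_true, if_false]
    linarith
  · have h1 : (i + 1) % 2 = 0 := by omega
    have h2 : i % 2 ≠ 0 := by omega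
    simp only [alternating, potential, h1, h2, if_true, if_false] at hp ⊢
    nlinarith

lemma le_step_potential (h : MixingPair A B γ σ κ θ) (hκ : 0 ≤ κ) (hσ : σ ≤ 1) (i : ℕ) (x : V) :
    (1 - κ) * potential A B i x ≤ (alternating A B i).mulVec (potential A B (i + 1)) x := by
  have hp := h.le_potential i x
  rcases Nat.mod_two_eq_zero_or_one i with hi | hi
  · have h1 : (i + 1) % 2 ≠ 0 := by omega
    have := abs_le.1 (h.harmonic x)
    rw [← Matrix.mulVec_mulVec] at this
    simp only [alternating, potential, hi, h1, if_true, if_false]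
    linarith
  · have h1 : (i + 1) % 2 = 0 := by omega
    have h2 : i % 2 ≠ 0 := by omega
    simp only [alternating, potential, h1, h2, if_true, if_false] at hp ⊢
    nlinarith

lemma word_potential_le (h : MixingPair A B γ σ κ θ) (hκ : 0 ≤ κ) (hσ : σ ≤ 1) (i k : ℕ)
    (x : V) : (word (alternating A B) i k).mulVec (potential A B (i + k)) x ≤
      (1 + κ) ^ k * potential A B i x := by
  induction k generalizing i x with
  | zero => simp [word]
  | succ k ih =>
    rw [word_succ_left, ← Matrix.mulVec_mulVec, show i + (k + 1) = i + 1 + k by ring]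
    refine (mulVec_mono (h.alternating_nonneg i) (ih (i + 1)) x).trans ?_
    have : (fun y => (1 + κ) ^ k * potential A B (i + 1) y) =
      (1 + κ) ^ k • potential A B (i + 1) := rfl
    rw [this, Matrix.mulVec_smul, Pi.smul_apply, smul_eq_mul, pow_succ, mul_assoc]
    exact mul_le_mul_of_nonneg_left (h.step_potential_le hκ hσ i x) (by positivity)

lemma le_word_potential (h : MixingPair A B γ σ κ θ) (hκ : 0 ≤ κ) (hκ1 : κ ≤ 1) (hσ : σ ≤ 1)
    (i k : ℕ) (x : V) : (1 - κ) ^ k * potential A B i x ≤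
      (word (alternating A B) i k).mulVec (potential A B (i + k)) x := by
  induction k generalizing i x with
  | zero => simp [word]
  | succ k ih =>
    rw [word_succ_left, ← Matrix.mulVec_mulVec, show i + (k + 1) = i + 1 + k by ring]
    refine le_trans ?_ (mulVec_mono (h.alternating_nonneg i) (ih (i + 1)) x)
    have : (fun y => (1 - κ) ^ k * potential A B (i + 1) y) =
      (1 - κ) ^ k • potential A B (i + 1) := rfl
    rw [this, Matrix.mulVec_smul, Pi.smul_apply, smul_eq_mul, pow_succ, mul_assoc]
    exact mul_le_mul_of_nonneg_left (h.le_step_potential hκ hσ i x)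
      (pow_nonneg (by linarith) _)

/-- Row sums of alternating products, from above. -/
lemma row_word_le (h : MixingPair A B γ σ κ θ) (hκ : 0 ≤ κ) (hσ : σ < 1) (i k : ℕ) (x : V) :
    ∑ y, word (alternating A B) i k x y ≤ (1 + κ) ^ k * ((1 + σ) / (1 - σ)) := by
  have h1 := h.word_potential_le hκ hσ.le i k x
  have h2 := mulVec_mono (h.word_nonneg i k) (g := fun _ => 1 - σ) (h.le_potential (i + k)) x
  have h3 : (word (alternating A B) i k).mulVec (fun _ => 1 - σ) x =
      (∑ y, word (alternating A B) i k x y) * (1 - σ) := by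
    simp [Matrix.mulVec, dotProduct, Finset.sum_mul]
  have h4 := mul_le_mul_of_nonneg_left (h.potential_le i x) (by positivity : 0 ≤ (1 + κ) ^ k)
  rw [← mul_div_assoc, le_div_iff₀ (by linarith)]
  linarith

/-- Row sums of alternating products, from below. -/
lemma le_row_word (h : MixingPair A B γ σ κ θ) (hκ : 0 ≤ κ) (hκ1 : κ ≤ 1) (hσ0 : 0 ≤ σ)
    (hσ : σ < 1) (i k : ℕ) (x : V) :
    (1 - κ) ^ k * ((1 - σ) / (1 + σ)) ≤ ∑ y, word (alternating A B) i k x y := by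
  have h1 := h.le_word_potential hκ hκ1 hσ.le i k x
  have h2 := mulVec_mono (h.word_nonneg i k) (h := fun _ => 1 + σ) (h.potential_le (i + k)) x
  have h3 : (word (alternating A B) i k).mulVec (fun _ => 1 + σ) x =
      (∑ y, word (alternating A B) i k x y) * (1 + σ) := by
    simp [Matrix.mulVec, dotProduct, Finset.sum_mul]
  have h4 := mul_le_mul_of_nonneg_left (h.le_potential i x)
    (pow_nonneg (by linarith) _ : 0 ≤ (1 - κ) ^ k)
  rw [← mul_div_assoc, div_le_iff₀ (by linarith)]
  linarith

lemma col_word_eq (h : MixingPair A B γ σ κ θ) (i k : ℕ) (y : V) :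
    ∑ x, word (alternating A B) i k x y = ∑ x, word (alternating A B) (i + k + 1) k y x := by
  rw [← word_alternating_transpose h.symm_left h.symm_right]; rfl

/-- The relative deviation of a nonnegative vector from a constant vector is at most `r`. -/
def Spread (r : ℝ) (c : V → ℝ) : Prop :=
  (∀ x, 0 ≤ c x) ∧ l2 (centred c) ≤ r * mean c * √(Fintype.card V)

lemma Spread.mono {r s : ℝ} {c : V → ℝ} (hc : Spread r c) (hrs : r ≤ s) : Spread s c := by
  refine ⟨hc.1, hc.2.trans ?_⟩
  have : 0 ≤ mean c := div_nonneg (Finset.sum_nonneg fun x _ => hc.1 x) (by positivity)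
  gcongr

lemma spread_sqrt_card [Nonempty V] {c : V → ℝ} (hc : ∀ x, 0 ≤ c x) :
    Spread (√(Fintype.card V)) c := by
  refine ⟨hc, ?_⟩
  have h1 := (l2_centred_le c 0).trans_eq (by congr 1; ext; simp : _ = l2 c)
  have h2 := l2_le_sum hc
  have : √(Fintype.card V) * mean c * √(Fintype.card V) = ∑ i, c i := by
    rw [mul_right_comm, Real.mul_self_sqrt (by positivity), mean]
    field_simp
  linarith

lemma mulVec_centred_add (M : Matrix V V ℝ) (c : V → ℝ) :
    M.mulVec c = mean c • M.mulVec 1 + M.mulVec (centred c) := by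
  rw [← Matrix.mulVec_smul, ← Matrix.mulVec_add]
  congr 1; ext; simp [centred]

lemma sum_mulVec_eq {M : Matrix V V ℝ} (hM : M.transpose = M) (c : V → ℝ) :
    ∑ x, M.mulVec c x = M.mulVec 1 ⬝ᵥ c := by
  have h1 : ∑ x, M.mulVec c x = 1 ⬝ᵥ M.mulVec c := by simp [dotProduct]
  rw [h1, Matrix.dotProduct_mulVec, ← Matrix.mulVec_transpose, hM]

lemma mean_right (h : MixingPair A B γ σ κ θ) (c : V → ℝ) : mean (B.mulVec c) = mean c := by
  unfold mean
  rw [sum_mulVec_eq h.symm_right, h.row_right]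
  simp [dotProduct]

lemma spread_right [Nonempty V] (h : MixingPair A B γ σ κ θ) {r : ℝ} {c : V → ℝ}
    (hc : Spread r c) : Spread r (B.mulVec c) := by
  refine ⟨fun x => Finset.sum_nonneg fun y _ => mul_nonneg (h.nonneg_right x y) (hc.1 y), ?_⟩
  rw [h.mean_right]
  refine le_trans ?_ hc.2
  have hrow : ∀ x, ∑ y, B x y = 1 := fun x => by
    have := congrFun h.row_right x
    simpa [Matrix.mulVec, dotProduct] using this
  have hcol : ∀ y, ∑ x, B x y = 1 := fun y => by
    rw [← hrow y]
    exact Finset.sum_congr rfl fun x _ => congrFun (congrFun h.symm_right y) x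
  have : centred (B.mulVec c) = B.mulVec (centred c) := by
    unfold centred
    rw [h.mean_right, Matrix.mulVec_sub]
    congr 1
    have : (fun _ : V => mean c) = mean c • (1 : V → ℝ) := by ext; simp
    rw [this, Matrix.mulVec_smul, h.row_right]
  rw [this]
  exact l2_mulVec_le_of_stochastic h.nonneg_right (fun x => (hrow x).le) (fun y => (hcol y).le) _

lemma spread_mul [Nonempty V] (h : MixingPair A B γ σ κ θ) (hσ0 : 0 ≤ σ) (hσ : σ < 1)
    (hγ : γ ≤ 1) {r : ℝ} {c : V → ℝ} (hc : Spread r c) :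
    Spread ((σ + (1 - γ) * r) / (1 - σ)) ((A * B).mulVec c) := by
  have hc' := hc
  obtain ⟨hc0, hc1⟩ := hc
  have hm : 0 ≤ mean c := div_nonneg (Finset.sum_nonneg fun x _ => hc0 x) (by positivity)
  have hB : ∀ x, 0 ≤ B.mulVec c x := (h.spread_right hc').1
  refine ⟨fun x => ?_, ?_⟩
  · rw [← Matrix.mulVec_mulVec]
    exact Finset.sum_nonneg fun y _ => mul_nonneg (h.nonneg_left x y) (hB y)
  have hmean : (1 - σ) * mean c ≤ mean ((A * B).mulVec c) := by
    rw [← h.mean_right c, ← Matrix.mulVec_mulVec]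
    unfold mean
    rw [← mul_div_assoc]
    apply div_le_div_of_nonneg_right _ (by positivity)
    rw [sum_mulVec_eq h.symm_left, Finset.mul_sum]
    exact Finset.sum_le_sum fun x _ => mul_le_mul_of_nonneg_right
      (by have := abs_le.1 (h.row_left x); linarith) (hB x)
  have h1 : (A * B).mulVec c - (fun _ => mean c) =
      mean c • (A.mulVec 1 - 1) + (A * B).mulVec (centred c) := by
    rw [mulVec_centred_add (A * B) c, ← Matrix.mulVec_mulVec (1 : V → ℝ) A B, h.row_right]
    ext x; simp; ring
  have h2 : l2 (A.mulVec 1 - 1) ≤ σ * √(Fintype.card V) :=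
    l2_le_of_abs_le hσ0 h.row_left
  have h3 := h.contract (centred c) (sum_centred c)
  calc l2 (centred ((A * B).mulVec c)) ≤ l2 ((A * B).mulVec c - fun _ => mean c) :=
        l2_centred_le _ _
    _ ≤ mean c * (σ * √(Fintype.card V)) +
        (1 - γ) * (r * mean c * √(Fintype.card V)) := by
        rw [h1]
        refine (l2_add_le _ _).trans ?_
        rw [l2_smul, abs_of_nonneg hm]
        refine add_le_add (mul_le_mul_of_nonneg_left h2 hm) (h3.trans ?_)
        exact mul_le_mul_of_nonneg_left hc1 (by linarith)
    _ = (σ + (1 - γ) * r) * mean c * √(Fintype.card V) := by ring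
    _ ≤ _ := by
        have hr : 0 ≤ (σ + (1 - γ) * r) * mean c := by
          rcases hm.eq_or_lt with hm | hm
          · rw [← hm]; simp
          have : 0 ≤ r := by
            have := (l2_nonneg _).trans hc1
            have hn : 0 < √(Fintype.card V : ℝ) := Real.sqrt_pos.2 (by positivity)
            by_contra! hr
            have : r * mean c * √(Fintype.card V : ℝ) < 0 :=
              mul_neg_of_neg_of_pos (mul_neg_of_neg_of_pos hr hm) hn
            linarith
          have : 0 ≤ (1 - γ) * r := mul_nonneg (by linarith) this
          positivity
        refine mul_le_mul_of_nonneg_right ?_ (Real.sqrt_nonneg _)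
        have : (σ + (1 - γ) * r) * mean c =
          (σ + (1 - γ) * r) / (1 - σ) * ((1 - σ) * mean c) := by
            field_simp [show (1 - σ) ≠ 0 by linarith]
        by_cases hs : 0 ≤ σ + (1 - γ) * r
        · rw [this]
          exact mul_le_mul_of_nonneg_left hmean (div_nonneg hs (by linarith))
        · have hm0 : mean c = 0 := by
            by_contra hne
            have : 0 < mean c := lt_of_le_of_ne hm (Ne.symm hne)
            exact absurd hr (not_le.2 (mul_neg_of_neg_of_pos (not_le.1 hs) this))
          have hc0' : ∀ x, c x = 0 := by
            have hs : ∑ x, c x = 0 := by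
              unfold mean at hm0
              rcases div_eq_zero_iff.1 hm0 with h | h
              · exact h
              · exact absurd h (by positivity)
            intro x
            exact (Finset.sum_eq_zero_iff_of_nonneg fun x _ => hc0 x).1 hs x (Finset.mem_univ _)
          have : c = 0 := funext hc0'
          simp [this, mean]

lemma spread_pow [Nonempty V] (h : MixingPair A B γ σ κ θ) (hσ0 : 0 ≤ σ) (hγ0 : 0 < γ)
    (hγ : γ ≤ 1) (hσ : σ ≤ γ / 4) {c : V → ℝ} (hc : ∀ x, 0 ≤ c x) (b : ℕ) :
    Spread ((1 - γ / 2) ^ b * √(Fintype.card V) + 4 * σ / γ) (((A * B) ^ b).mulVec c) := by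
  induction b with
  | zero =>
    simp only [pow_zero, one_mul, Matrix.one_mulVec]
    exact (spread_sqrt_card hc).mono (by have : 0 ≤ 4 * σ / γ := by positivity
                                         linarith)
  | succ b ih =>
    rw [pow_succ' (A * B), ← Matrix.mulVec_mulVec]
    refine (h.spread_mul hσ0 (by linarith) hγ ih).mono ?_
    rw [div_le_iff₀ (by linarith)]
    set q := (1 - γ / 2) ^ b * √(Fintype.card V) with hq
    have hq0 : 0 ≤ q := mul_nonneg (pow_nonneg (by linarith) _) (Real.sqrt_nonneg _)
    have : (1 - γ / 2) ^ (b + 1) * √(Fintype.card V) = (1 - γ / 2) * q := by rw [pow_succ]; ring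
    rw [this]
    set s := 4 * σ / γ with hs
    have hs1 : σ = γ * s / 4 := by rw [hs]; field_simp
    have hs0 : 0 ≤ s := by positivity
    have hs2 : s ≤ 1 := by rw [hs, div_le_one hγ0]; linarith
    rw [hs1]
    nlinarith [mul_nonneg hγ0.le hs0, mul_nonneg (mul_nonneg hγ0.le hs0) hq0,
      mul_nonneg hγ0.le hq0, mul_nonneg (mul_nonneg hγ0.le hγ0.le) (mul_nonneg hs0 hq0),
      mul_nonneg (mul_nonneg hγ0.le hs0) (sub_nonneg.2 hs2),
      mul_nonneg (mul_nonneg hγ0.le hq0) (sub_nonneg.2 hs2)]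

lemma word_even (A B : Matrix V V ℝ) {i : ℕ} (hi : i % 2 = 0) (b k : ℕ) :
    word (alternating A B) i (2 * b + k) = (A * B) ^ b * word (alternating A B) i k := by
  induction b with
  | zero => simp
  | succ b ih =>
    have h1 : (i + 1) % 2 ≠ 0 := by omega
    rw [show 2 * (b + 1) + k = 2 * b + k + 1 + 1 by ring, word_succ_left, word_succ_left,
      show i + 1 + 1 = i + 2 by ring, word_alternating_add_two, ih, pow_succ']
    simp only [alternating, hi, h1, if_true, if_false]
    simp only [Matrix.mul_assoc]

lemma spread_word [Nonempty V] (h : MixingPair A B γ σ κ θ) (hσ0 : 0 ≤ σ) (hγ0 : 0 < γ)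
    (hγ : γ ≤ 1) (hσ : σ ≤ γ / 4) (i : ℕ) {b k : ℕ} (hk : 2 * b + 1 ≤ k) (y : V) :
    Spread ((1 - γ / 2) ^ b * √(Fintype.card V) + 4 * σ / γ)
      (fun x => word (alternating A B) i k x y) := by
  have hev : ∀ j k, j % 2 = 0 → 2 * b ≤ k →
      Spread ((1 - γ / 2) ^ b * √(Fintype.card V) + 4 * σ / γ)
        (fun x => word (alternating A B) j k x y) := fun j k hj hk => by
    have := h.spread_pow hσ0 hγ0 hγ hσ (fun x => h.word_nonneg j (k - 2 * b) x y) b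
    obtain ⟨l, rfl⟩ := Nat.exists_eq_add_of_le hk
    rw [word_even A B hj]
    rw [Nat.add_sub_cancel_left] at this
    exact this
  rcases Nat.mod_two_eq_zero_or_one i with hi | hi
  · exact hev i k hi (by omega)
  · obtain ⟨l, rfl⟩ : ∃ l, k = l + 1 := ⟨k - 1, by omega⟩
    have h1 := h.spread_right (hev (i + 1) l (by omega) (by omega))
    have h2 : i % 2 ≠ 0 := by omega
    rw [word_succ_left]
    simp only [alternating, h2, if_false]
    exact h1

/-- Long alternating products have nearly constant entries. -/
lemma word_entry [Nonempty V] (h : MixingPair A B γ σ κ θ) (hσ0 : 0 ≤ σ) (hγ0 : 0 < γ)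
    (hγ : γ ≤ 1) (hσ : σ ≤ γ / 4) {b k : ℕ} {r : ℝ}
    (hr : (1 - γ / 2) ^ b * √(Fintype.card V) + 4 * σ / γ ≤ r) {lo hi : ℝ} (hlo : 0 ≤ lo)
    (hr1 : r ≤ 1) (hk : 4 * b + 2 ≤ k)
    (hrow : ∀ i x l, l ≤ k → lo ≤ ∑ y, word (alternating A B) i l x y ∧
      ∑ y, word (alternating A B) i l x y ≤ hi) (i : ℕ) (x y : V) :
    lo ^ 2 * (1 - r ^ 2) / Fintype.card V ≤ word (alternating A B) i k x y ∧
      word (alternating A B) i k x y ≤ hi ^ 2 * (1 + r ^ 2) / Fintype.card V := by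
  obtain ⟨l, rfl⟩ : ∃ l, k = (2 * b + 1) + l := ⟨k - (2 * b + 1), by omega⟩
  set k1 := 2 * b + 1 with hk1
  set u : V → ℝ := fun z => word (alternating A B) (i + k1 + 1) k1 z x with hu
  set c : V → ℝ := fun z => word (alternating A B) (i + k1) l z y with hc
  have hus : Spread r u := (h.spread_word hσ0 hγ0 hγ hσ _ le_rfl x).mono hr
  have hcs : Spread r c := (h.spread_word hσ0 hγ0 hγ hσ _ (by omega) y).mono hr
  have hent : word (alternating A B) i (k1 + l) x y = u ⬝ᵥ c := by
    rw [word_add, Matrix.mul_apply]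
    refine Finset.sum_congr rfl fun z _ => ?_
    simp only [hu, hc]
    rw [← word_alternating_transpose h.symm_left h.symm_right]; rfl
  have hN : (0 : ℝ) < Fintype.card V := by positivity
  set N : ℝ := (Fintype.card V : ℝ) with hN'
  have hU : N * mean u = ∑ z, word (alternating A B) i k1 x z := by
    simp only [mean, hu]
    rw [h.col_word_eq, mul_div_cancel₀ _ hN.ne',
      show i + k1 + 1 + k1 + 1 = (i + 2 * b + 2) + 2 + 2 * b by omega]
    congr 1; ext z
    have : ∀ t j, word (alternating A B) (j + 2 * t) k1 x z = word (alternating A B) j k1 x z := by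
      intro t; induction t with
      | zero => simp
      | succ t ih => intro j; rw [mul_add, ← add_assoc, mul_one, word_alternating_add_two, ih]
    rw [show (i + 2 * b + 2) + 2 + 2 * b = i + 2 * (2 * b + 2) by omega, this]
  have hC : N * mean c = ∑ z, word (alternating A B) (i + k1 + l + 1) l y z := by
    simp only [mean, hc]
    rw [h.col_word_eq, mul_div_cancel₀ _ hN.ne']
  obtain ⟨hU1, hU2⟩ := hrow i x k1 (by omega)
  obtain ⟨hC1, hC2⟩ := hrow (i + k1 + l + 1) y l (by omega)
  rw [← hU] at hU1 hU2
  rw [← hC] at hC1 hC2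
  have hr0 : 0 ≤ r := le_trans (add_nonneg (mul_nonneg (pow_nonneg (by linarith) _)
    (Real.sqrt_nonneg _)) (by positivity)) hr
  have hmu : 0 ≤ mean u := div_nonneg (Finset.sum_nonneg fun z _ => hus.1 z) (by positivity)
  have hmc : 0 ≤ mean c := div_nonneg (Finset.sum_nonneg fun z _ => hcs.1 z) (by positivity)
  have herr : |centred u ⬝ᵥ centred c| ≤ r ^ 2 * (N * mean u * mean c) := by
    refine (abs_dotProduct_le _ _).trans ?_
    calc l2 (centred u) * l2 (centred c)
        ≤ (r * mean u * √N) * (r * mean c * √N) :=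
          mul_le_mul hus.2 hcs.2 (l2_nonneg _) (by positivity)
      _ = r ^ 2 * (mean u * mean c) * (√N * √N) := by ring
      _ = _ := by rw [Real.mul_self_sqrt hN.le]; ring
  have hprod1 : lo ^ 2 ≤ (N * mean u) * (N * mean c) := by
    rw [sq]; exact mul_le_mul hU1 hC1 hlo (by positivity)
  have hprod2 : (N * mean u) * (N * mean c) ≤ hi ^ 2 := by
    rw [sq]; exact mul_le_mul hU2 hC2 (by positivity) (by linarith)
  have heq : N * mean u * mean c = (N * mean u) * (N * mean c) / N := by field_simp
  rw [hent, dotProduct_eq_mean, ← hN']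
  have hr2 : r ^ 2 ≤ 1 := pow_le_one₀ hr0 hr1
  rw [heq] at herr ⊢
  set P := (N * mean u) * (N * mean c) with hP
  have hab := abs_le.1 herr
  have e1 : lo ^ 2 * (1 - r ^ 2) / N ≤ P * (1 - r ^ 2) / N :=
    div_le_div_of_nonneg_right (mul_le_mul_of_nonneg_right hprod1 (by linarith)) hN.le
  have e2 : P * (1 + r ^ 2) / N ≤ hi ^ 2 * (1 + r ^ 2) / N :=
    div_le_div_of_nonneg_right (mul_le_mul_of_nonneg_right hprod2 (by positivity)) hN.le
  have e3 : P * (1 - r ^ 2) / N = P / N - r ^ 2 * (P / N) := by ring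
  have e4 : P * (1 + r ^ 2) / N = P / N + r ^ 2 * (P / N) := by ring
  constructor <;> linarith

end MixingPair
end Words

section PathSums

variable {V : Type*} [Fintype V] [DecidableEq V]

/-- The weight of a walk with respect to a sequence of matrices. -/
def walkWeight (S : ℕ → Matrix V V ℝ) (N : ℕ) (p : Fin (N + 1) → V) : ℝ :=
  ∏ t : Fin N, S t (p t.castSucc) (p t.succ)

lemma walkWeight_nonneg {S : ℕ → Matrix V V ℝ} (hS : ∀ i x y, 0 ≤ S i x y) (N : ℕ)
    (p : Fin (N + 1) → V) : 0 ≤ walkWeight S N p := Finset.prod_nonneg fun _ _ => hS _ _ _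

lemma walkWeight_snoc (S : ℕ → Matrix V V ℝ) (N : ℕ) (p : Fin (N + 1) → V) (z : V) :
    walkWeight S (N + 1) (Fin.snoc p z : Fin (N + 2) → V) =
      walkWeight S N p * S N (p (Fin.last N)) z := by
  unfold walkWeight
  rw [Fin.prod_univ_castSucc]
  congr 1
  · refine Finset.prod_congr rfl fun t _ => ?_
    rw [Fin.succ_castSucc]
    simp only [Fin.snoc_castSucc, Fin.val_castSucc]
  · rw [Fin.succ_last]
    simp only [Fin.snoc_castSucc, Fin.snoc_last, Fin.val_last]

lemma sum_walkWeight_mul_prod (S : ℕ → Matrix V V ℝ) (φ : ℕ → V → ℝ) (N : ℕ) (y z : V) :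
    ∑ p : Fin (N + 1) → V, (if p 0 = y ∧ p (Fin.last N) = z then
      (∏ t : Fin (N + 1), φ t (p t)) * walkWeight S N p else 0) =
      word (fun t => Matrix.diagonal (φ t) * S t) 0 N y z * φ N z := by
  induction N generalizing z with
  | zero =>
    rw [← (Equiv.funUnique (Fin 1) V).symm.sum_comp]
    simp only [word, walkWeight, Matrix.one_apply, Finset.univ_eq_empty, Finset.prod_empty]
    rw [Finset.sum_eq_single z]
    · by_cases h : y = z
      · simp [h, Equiv.funUnique]
      · simp [h, Ne.symm h, Equiv.funUnique]
    · intro b _ hb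
      simp [Equiv.funUnique, hb]
    · simp
  | succ N ih =>
    rw [← (Fin.snocEquiv fun _ : Fin (N + 2) => V).sum_comp, Fintype.sum_prod_type]
    rw [Finset.sum_eq_single z]
    · rw [word, Matrix.mul_apply, Finset.sum_mul]
      have hterm : ∀ w, word (fun t => Matrix.diagonal (φ t) * S t) 0 N y w *
          (Matrix.diagonal (φ (0 + N)) * S (0 + N)) w z * φ (N + 1) z =
          ∑ p : Fin (N + 1) → V, (if p 0 = y ∧ p (Fin.last N) = w then
            (∏ t : Fin (N + 1), φ t (p t)) * walkWeight S N p else 0) *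
            (S N w z * φ (N + 1) z) := fun w => by
        rw [← Finset.sum_mul, ih, Matrix.diagonal_mul, zero_add]; ring
      simp only [hterm]
      rw [Finset.sum_comm]
      refine Finset.sum_congr rfl fun p _ => ?_
      rw [Finset.sum_eq_single (p (Fin.last N))]
      · have h0 : (Fin.snoc p z : Fin (N + 2) → V) 0 = p 0 := by
          rw [← Fin.castSucc_zero, Fin.snoc_castSucc]
        simp only [Fin.snocEquiv, Equiv.coe_fn_mk, h0, Fin.snoc_last, and_true]
        split_ifs
        · rw [Fin.prod_univ_castSucc (n := N + 1), walkWeight_snoc]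
          simp only [Fin.snoc_castSucc, Fin.snoc_last, Fin.val_castSucc, Fin.val_last]
          ring
        · simp
      · intro w _ hw
        simp [Ne.symm hw]
      · simp
    · intro w _ hw
      simp [Fin.snocEquiv, hw]
    · simp

lemma word_diagonal_mul {S : ℕ → Matrix V V ℝ} {φ : ℕ → V → ℝ} {i k : ℕ} (hk : 1 ≤ k)
    (h : ∀ t, i < t → t < i + k → φ t = 1) :
    word (fun t => Matrix.diagonal (φ t) * S t) i k = Matrix.diagonal (φ i) * word S i k := by
  induction k, hk using Nat.le_induction with
  | base => simp [word_one]
  | succ k hk ih =>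
    rw [word, ih (fun t h1 h2 => h t h1 (by omega)), h (i + k) (by omega) (by omega), word]
    simp [Matrix.mul_assoc]

lemma word_diagonal_one_mul {S : ℕ → Matrix V V ℝ} {φ : ℕ → V → ℝ} {i k : ℕ}
    (h : ∀ t, i ≤ t → t < i + k → φ t = 1) :
    word (fun t => Matrix.diagonal (φ t) * S t) i k = word S i k := by
  rcases Nat.eq_zero_or_pos k with rfl | hk
  · rfl
  · rw [word_diagonal_mul hk fun t h1 h2 => h t h1.le h2, h i le_rfl (by omega)]
    simp

lemma sum_walkWeight (S : ℕ → Matrix V V ℝ) (N : ℕ) (y z : V) :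
    ∑ p : Fin (N + 1) → V, (if p 0 = y ∧ p (Fin.last N) = z then walkWeight S N p else 0) =
      word S 0 N y z := by
  have := sum_walkWeight_mul_prod S (fun _ => 1) N y z
  rw [word_diagonal_one_mul fun _ _ _ => rfl] at this
  simpa using this

lemma sum_walkWeight_point (S : ℕ → Matrix V V ℝ) {N i : ℕ} (hi : i ≤ N) (y z x : V) :
    ∑ p : Fin (N + 1) → V, (if (p 0 = y ∧ p (Fin.last N) = z) ∧ p ⟨i, by omega⟩ = x then
      walkWeight S N p else 0) = word S 0 i y x * word S i (N - i) x z := by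
  set φ : ℕ → V → ℝ := fun t => if t = i then fun v => if v = x then 1 else 0 else 1 with hφ
  have h1 : ∀ t, t ≠ i → φ t = 1 := fun t ht => by simp [hφ, ht]
  have key := sum_walkWeight_mul_prod S φ N y z
  have hp : ∀ p : Fin (N + 1) → V, ∏ t : Fin (N + 1), φ t (p t) =
      if p ⟨i, by omega⟩ = x then 1 else 0 := fun p => by
    rw [Finset.prod_eq_single ⟨i, by omega⟩]
    · simp [hφ]
    · intro t _ ht
      rw [h1 t (fun h => ht (Fin.ext h))]; rfl
    · simp
  simp only [hp, ite_mul, one_mul, zero_mul, ← ite_and] at key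
  rw [key]
  have hw : word (fun t => Matrix.diagonal (φ t) * S t) 0 N =
      word S 0 i * word (fun t => Matrix.diagonal (φ t) * S t) i (N - i) := by
    conv_lhs => rw [show N = i + (N - i) by omega]
    rw [word_add, word_diagonal_one_mul fun t _ ht => h1 t (by omega), zero_add]
  have hlast : ∀ v, word (fun t => Matrix.diagonal (φ t) * S t) i (N - i) v z * φ N z =
      if v = x then word S i (N - i) x z else 0 := fun v => by
    rcases hi.eq_or_lt with rfl | hi
    · by_cases hv : v = x
      · by_cases hz : z = x
        · simp [word, hφ, hv, hz]
        · simp [word, hφ, hv, hz, Ne.symm hz]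
      · by_cases hz : v = z
        · simp [word, hφ, ← hz, hv]
        · simp [word, hφ, hv, hz]
    · rw [word_diagonal_mul (by omega) fun t ht _ => h1 t (by omega), h1 N (by omega),
        Matrix.diagonal_mul]
      by_cases hv : v = x <;> simp [hφ, hv]
  rw [hw, Matrix.mul_apply, Finset.sum_mul]
  simp only [mul_assoc, hlast]
  simp

lemma sum_walkWeight_pair (S : ℕ → Matrix V V ℝ) {N i j : ℕ} (hij : i < j) (hj : j ≤ N)
    (y z w : V) :
    ∑ p : Fin (N + 1) → V, (if (p 0 = y ∧ p (Fin.last N) = z) ∧ p ⟨i, by omega⟩ = w ∧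
      p ⟨j, by omega⟩ = w then walkWeight S N p else 0) =
      word S 0 i y w * word S i (j - i) w w * word S j (N - j) w z := by
  set φ : ℕ → V → ℝ := fun t => if t = i ∨ t = j then fun v => if v = w then 1 else 0 else 1
    with hφ
  have h1 : ∀ t, t ≠ i → t ≠ j → φ t = 1 := fun t ht ht' => by simp [hφ, ht, ht']
  have key := sum_walkWeight_mul_prod S φ N y z
  have hp : ∀ p : Fin (N + 1) → V, ∏ t : Fin (N + 1), φ t (p t) =
      if p ⟨i, by omega⟩ = w ∧ p ⟨j, by omega⟩ = w then 1 else 0 := fun p => by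
    rw [Finset.prod_eq_mul (⟨i, by omega⟩ : Fin (N + 1)) ⟨j, by omega⟩
      (fun h => hij.ne (congrArg Fin.val h))]
    · by_cases hpi : p ⟨i, by omega⟩ = w <;> simp [hφ, hpi]
    · intro t _ ht
      rw [h1 t (fun h => ht.1 (Fin.ext h)) (fun h => ht.2 (Fin.ext h))]; rfl
    · simp
    · simp
  simp only [hp, ite_mul, one_mul, zero_mul, ← ite_and] at key
  rw [key]
  have hw : word (fun t => Matrix.diagonal (φ t) * S t) 0 N =
      word S 0 i * (Matrix.diagonal (φ i) * word S i (j - i)) *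
        word (fun t => Matrix.diagonal (φ t) * S t) j (N - j) := by
    conv_lhs => rw [show N = i + (j - i) + (N - j) by omega]
    rw [word_add, word_add, word_diagonal_one_mul fun t _ ht => h1 t (by omega) (by omega),
      zero_add, word_diagonal_mul (by omega) fun t ht ht' => h1 t (by omega) (by omega),
      show 0 + (i + (j - i)) = j by omega]
  have hlast : ∀ v, word (fun t => Matrix.diagonal (φ t) * S t) j (N - j) v z * φ N z =
      if v = w then word S j (N - j) w z else 0 := fun v => by
    rcases hj.eq_or_lt with rfl | hj
    · by_cases hv : v = w
      · by_cases hz : z = w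
        · simp [word, hφ, hv, hz]
        · simp [word, hφ, hv, hz, Ne.symm hz]
      · by_cases hz : v = z
        · simp [word, hφ, ← hz, hv]
        · simp [word, hφ, hv, hz]
    · rw [word_diagonal_mul (by omega) fun t ht _ => h1 t (by omega) (by omega),
        h1 N (by omega) (by omega), Matrix.diagonal_mul]
      by_cases hv : v = w <;> simp [hφ, hv]
  rw [hw, Matrix.mul_apply, Finset.sum_mul]
  simp only [mul_assoc, hlast]
  simp only [mul_ite, mul_zero, Finset.sum_ite_eq', Finset.mem_univ, if_true]
  rw [Matrix.mul_apply]
  simp only [Matrix.diagonal_mul]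
  rw [Finset.sum_eq_single w]
  · simp [hφ, mul_assoc]
  · intro v _ hv; simp [hφ, hv]
  · simp

/-- Most alternating walks are paths avoiding a given vertex. -/
lemma sum_injective_walkWeight_ge {S : ℕ → Matrix V V ℝ} {N k₀ : ℕ} {θ α β : ℝ} {x y z : V}
    (hS : ∀ i x y, 0 ≤ S i x y) (hdiag : ∀ i x, S i x x = 0) (hα : ∀ i x y, S i x y ≤ α)
    (hrow : ∀ i k x, k ≤ N → ∑ y, word S i k x y ≤ 2)
    (hcol : ∀ i k y, k ≤ N → ∑ x, word S i k x y ≤ 2)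
    (hent : ∀ i k x y, 2 ≤ k → k ≤ N → word S i k x y ≤ θ)
    (hlong : ∀ i k x y, k₀ ≤ k → k ≤ N → word S i k x y ≤ β)
    (hk₀ : 2 ≤ k₀) (hN : N = 3 * k₀) (hyz : y ≠ z) (hxy : x ≠ y) (hxz : x ≠ z)
    (hfirst : S 0 y x = 0) (hlast : S (N - 1) x z = 0) :
    word S 0 N y z - β * (3 * (N + 1) ^ 2 * θ + 8 * α) ≤
      ∑ p : Fin (N + 1) → V, (if (p 0 = y ∧ p (Fin.last N) = z) ∧ Function.Injective p ∧
        ∀ t, p t ≠ x then walkWeight S N p else 0) := by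
  have hw0 : ∀ i k x y, 0 ≤ word S i k x y := fun i k x y => word_nonneg hS i k x y
  have hθ : 0 ≤ θ := (hw0 0 2 x x).trans (hent 0 2 x x le_rfl (by omega))
  have hβ : 0 ≤ β := (hw0 0 k₀ x x).trans (hlong 0 k₀ x x le_rfl (by omega))
  have hα0 : 0 ≤ α := (hS 0 x x).trans (hα 0 x x)
  have hW := walkWeight_nonneg hS N
  set E : Fin (N + 1) → Fin (N + 1) → ℝ := fun i j => if i < j then
    ∑ w, word S 0 i y w * word S i (j - i) w w * word S j (N - j) w z else 0 with hE
  set H : Fin (N + 1) → ℝ := fun t => word S 0 t y x * word S t (N - t) x z with hH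
  have hunion : word S 0 N y z ≤ (∑ p : Fin (N + 1) → V,
      (if (p 0 = y ∧ p (Fin.last N) = z) ∧ Function.Injective p ∧
        ∀ t, p t ≠ x then walkWeight S N p else 0)) + ∑ i, ∑ j, E i j + ∑ t, H t := by
    have hE' : ∀ i j, E i j = ∑ p : Fin (N + 1) → V, if (p 0 = y ∧ p (Fin.last N) = z) ∧
        i < j ∧ p i = p j then walkWeight S N p else 0 := fun i j => by
      by_cases hij : i < j
      · simp only [hE, hij, if_true]
        simp_rw [← sum_walkWeight_pair S (N := N) (i := i) (j := j) hij (by omega) y z]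
        rw [Finset.sum_comm]
        refine Finset.sum_congr rfl fun p _ => ?_
        rw [Finset.sum_eq_single (p i)]
        · simp [eq_comm (a := p i)]
        · intro w _ hw; simp [Ne.symm hw]
        · simp
      · simp [hE, hij]
    have hH' : ∀ t, H t = ∑ p : Fin (N + 1) → V, if (p 0 = y ∧ p (Fin.last N) = z) ∧
        p t = x then walkWeight S N p else 0 := fun t =>
      (sum_walkWeight_point S (N := N) (i := t) (by omega) y z x).symm
    simp_rw [hE', hH', ← sum_walkWeight S N y z]
    have hc1 : (∑ i, ∑ j, ∑ p : Fin (N + 1) → V, if (p 0 = y ∧ p (Fin.last N) = z) ∧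
        i < j ∧ p i = p j then walkWeight S N p else 0) = ∑ p : Fin (N + 1) → V, ∑ i, ∑ j,
        if (p 0 = y ∧ p (Fin.last N) = z) ∧ i < j ∧ p i = p j then walkWeight S N p else 0 := by
      rw [Finset.sum_comm (s := (Finset.univ : Finset (Fin (N + 1) → V)))]
      exact Finset.sum_congr rfl fun _ _ => Finset.sum_comm
    rw [hc1, Finset.sum_comm (s := (Finset.univ : Finset (Fin (N + 1)))),
      ← Finset.sum_add_distrib, ← Finset.sum_add_distrib]
    refine Finset.sum_le_sum fun p _ => ?_
    by_cases hp : p 0 = y ∧ p (Fin.last N) = z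
    swap
    · simp [hp]
    simp only [hp, true_and, and_self, if_true]
    have n1 : 0 ≤ ∑ i, ∑ j, if i < j ∧ p i = p j then walkWeight S N p else 0 :=
      Finset.sum_nonneg fun i _ => Finset.sum_nonneg fun j _ => by split_ifs <;> simp [hW]
    have n2 : 0 ≤ ∑ t, if p t = x then walkWeight S N p else 0 :=
      Finset.sum_nonneg fun i _ => by split_ifs <;> simp [hW]
    by_cases hinj : Function.Injective p
    · by_cases hx : ∀ t, p t ≠ x
      · rw [if_pos ⟨hinj, hx⟩]
        linarith
      · have hneg : ¬ (Function.Injective p ∧ ∀ t, p t ≠ x) := fun h => hx h.2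
        rw [if_neg hneg]
        push Not at hx
        obtain ⟨t, ht⟩ := hx
        have : walkWeight S N p ≤ ∑ t, if p t = x then walkWeight S N p else 0 := by
          refine le_trans ?_ (Finset.single_le_sum (f := fun t => if p t = x then
            walkWeight S N p else 0) (fun i _ => by split_ifs <;> simp [hW])
            (Finset.mem_univ t))
          simp [ht]
        linarith
    · have hneg : ¬ (Function.Injective p ∧ ∀ t, p t ≠ x) := fun h => hinj h.1
      rw [if_neg hneg]
      have : ∃ i j, i < j ∧ p i = p j := by
        unfold Function.Injective at hinj
        push Not at hinj
        obtain ⟨i, j, h1, h2⟩ := hinj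
        rcases lt_or_gt_of_ne h2 with h | h
        exacts [⟨i, j, h, h1⟩, ⟨j, i, h, h1.symm⟩]
      obtain ⟨i, j, hij, hpij⟩ := this
      have : walkWeight S N p ≤ ∑ i, ∑ j, if i < j ∧ p i = p j then walkWeight S N p else 0 := by
        refine le_trans ?_ (Finset.single_le_sum (f := fun i => ∑ j, if i < j ∧ p i = p j then
          walkWeight S N p else 0) (fun i _ => Finset.sum_nonneg fun j _ => by
            split_ifs <;> simp [hW]) (Finset.mem_univ i))
        refine le_trans ?_ (Finset.single_le_sum (f := fun j => if i < j ∧ p i = p j then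
          walkWeight S N p else 0) (fun j _ => by split_ifs <;> simp [hW])
          (Finset.mem_univ j))
        simp [hij, hpij]
      linarith
  have hEb : ∀ i j, E i j ≤ 2 * β * θ +
      (if (i : ℕ) ≤ 1 then 1 else 0) * (if N - 1 ≤ (j : ℕ) then 1 else 0) * (2 * β * α) := by
    intro i j
    have hpos : 0 ≤ (if (i : ℕ) ≤ 1 then (1 : ℝ) else 0) *
        (if N - 1 ≤ (j : ℕ) then 1 else 0) * (2 * β * α) := by
      refine mul_nonneg (mul_nonneg ?_ ?_) (by positivity) <;> split_ifs <;> norm_num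
    have hj : (j : ℕ) ≤ N := by omega
    by_cases hij : i < j
    swap
    · simp only [hE, hij, if_false]; positivity
    simp only [hE, hij, if_true]
    have hij' : (i : ℕ) < j := hij
    by_cases h1 : (j : ℕ) = i + 1
    · have : ∑ w, word S 0 i y w * word S i (j - i) w w * word S j (N - j) w z = 0 := by
        refine Finset.sum_eq_zero fun w _ => ?_
        rw [h1, Nat.add_sub_cancel_left, word_one, hdiag]; simp
      rw [this]; positivity
    have hfl : ∀ (F : V → ℝ), (∀ w, 0 ≤ F w) → ∑ w, F w ≤ 2 → ∀ G : V → ℝ, (∀ w, 0 ≤ G w) →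
        ∀ b, 0 ≤ b → (∀ w, G w ≤ b) → ∑ w, G w * F w ≤ b * 2 := fun F hF hF2 G hG b hb hGb => by
      calc ∑ w, G w * F w ≤ ∑ w, b * F w :=
            Finset.sum_le_sum fun w _ => mul_le_mul_of_nonneg_right (hGb w) (hF w)
        _ = b * ∑ w, F w := by rw [Finset.mul_sum]
        _ ≤ b * 2 := mul_le_mul_of_nonneg_left hF2 hb
    by_cases hi : k₀ ≤ (i : ℕ)
    · have := hfl (fun w => word S j (N - j) w z) (fun w => hw0 _ _ _ _) (hcol _ _ _ (by omega))
        (fun w => word S 0 i y w * word S i (j - i) w w)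
        (fun w => mul_nonneg (hw0 _ _ _ _) (hw0 _ _ _ _)) (β * θ) (by positivity)
        (fun w => mul_le_mul (hlong _ _ _ _ hi (by omega)) (hent _ _ _ _ (by omega) (by omega))
          (hw0 _ _ _ _) hβ)
      linarith
    by_cases hj' : k₀ ≤ N - (j : ℕ)
    · have := hfl (fun w => word S 0 i y w) (fun w => hw0 _ _ _ _) (hrow _ _ _ (by omega))
        (fun w => word S i (j - i) w w * word S j (N - j) w z)
        (fun w => mul_nonneg (hw0 _ _ _ _) (hw0 _ _ _ _)) (θ * β) (by positivity)
        (fun w => mul_le_mul (hent _ _ _ _ (by omega) (by omega)) (hlong _ _ _ _ hj' (by omega))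
          (hw0 _ _ _ _) hθ)
      have e : ∑ w, word S 0 i y w * word S i (j - i) w w * word S j (N - j) w z =
        ∑ w, word S i (j - i) w w * word S j (N - j) w z * word S 0 i y w :=
        Finset.sum_congr rfl fun w _ => by ring
      rw [e]; linarith
    have hmid : ∑ w, word S 0 i y w * word S i (j - i) w w * word S j (N - j) w z ≤
        β * ∑ w, word S 0 i y w * word S j (N - j) w z := by
      rw [Finset.mul_sum]
      refine Finset.sum_le_sum fun w _ => ?_
      have := hlong i (j - i) w w (by omega) (by omega)
      have h2 := mul_nonneg (hw0 0 i y w) (hw0 j (N - j) w z)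
      nlinarith
    refine hmid.trans ?_
    by_cases hi2 : 2 ≤ (i : ℕ)
    · have := hfl (fun w => word S j (N - j) w z) (fun w => hw0 _ _ _ _) (hcol _ _ _ (by omega))
        (fun w => word S 0 i y w) (fun w => hw0 _ _ _ _) θ hθ
        (fun w => hent _ _ _ _ hi2 (by omega))
      nlinarith
    by_cases hj2 : 2 ≤ N - (j : ℕ)
    · have := hfl (fun w => word S 0 i y w) (fun w => hw0 _ _ _ _) (hrow _ _ _ (by omega))
        (fun w => word S j (N - j) w z) (fun w => hw0 _ _ _ _) θ hθ
        (fun w => hent _ _ _ _ hj2 (by omega))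
      simp_rw [mul_comm (word S 0 _ _ _)]
      nlinarith
    have hi3 : (i : ℕ) ≤ 1 := by omega
    have hj3 : N - 1 ≤ (j : ℕ) := by omega
    rw [if_pos hi3, if_pos hj3]
    have : ∑ w, word S 0 i y w * word S j (N - j) w z ≤ 2 * α := by
      obtain hi4 | hi4 : (i : ℕ) = 0 ∨ (i : ℕ) = 1 := by omega
      · have e : ∑ w, word S 0 i y w * word S j (N - j) w z = word S j (N - j) y z := by
          rw [hi4]; simp [word, Matrix.one_apply]
        rw [e]
        obtain hj4 | hj4 : N - (j : ℕ) = 0 ∨ N - (j : ℕ) = 1 := by omega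
        · rw [hj4]; simp [word, hyz, hα0]
        · rw [hj4, word_one]; linarith [hα j y z]
      · obtain hj4 | hj4 : N - (j : ℕ) = 0 ∨ N - (j : ℕ) = 1 := by omega
        · rw [hj4, hi4]; simp [word, Matrix.one_apply]; linarith [hα 0 y z]
        · have hjp : ∀ w, word S j (N - j) w z ≤ α := fun w => by
            rw [hj4, word_one]; exact hα _ _ _
          have := hfl (fun w => word S 0 i y w) (fun w => hw0 _ _ _ _) (hrow _ _ _ (by omega))
            (fun w => word S j (N - j) w z) (fun w => hw0 _ _ _ _) α hα0 hjp
          simp_rw [mul_comm (word S 0 _ _ _)]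
          linarith
    nlinarith [mul_nonneg hβ hθ]
  have hHb : ∀ t, H t ≤ β * θ := by
    intro t
    have htN : (t : ℕ) ≤ N := by omega
    have hpos : 0 ≤ β * θ := by positivity
    simp only [hH]
    by_cases h0 : (t : ℕ) = 0
    · rw [h0]; simpa [word, Matrix.one_apply, Ne.symm hxy] using hpos
    by_cases h1 : (t : ℕ) = 1
    · rw [h1, word_one, hfirst]; simpa using hpos
    by_cases h2 : (t : ℕ) = N
    · rw [h2]; simpa [word, Matrix.one_apply, hxz] using hpos
    by_cases h3 : (t : ℕ) = N - 1
    · rw [h3, show N - (N - 1) = 1 by omega, word_one, hlast]; simpa using hpos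
    by_cases h4 : k₀ ≤ (t : ℕ)
    · exact mul_le_mul (hlong _ _ _ _ h4 (by omega)) (hent _ _ _ _ (by omega) (by omega))
        (hw0 _ _ _ _) hβ
    · rw [mul_comm β]
      exact mul_le_mul (hent _ _ _ _ (by omega) (by omega)) (hlong _ _ _ _ (by omega) (by omega))
        (hw0 _ _ _ _) hθ
  have hlow : ∑ i : Fin (N + 1), (if (i : ℕ) ≤ 1 then (1 : ℝ) else 0) ≤ 2 := by
    rw [Finset.sum_boole]
    have : (Finset.univ.filter fun i : Fin (N + 1) => (i : ℕ) ≤ 1) ⊆ {0, 1} := by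
      intro i hi
      simp only [Finset.mem_filter, Finset.mem_univ, true_and] at hi
      simp only [Finset.mem_insert, Finset.mem_singleton, Fin.ext_iff]
      have : ((1 : Fin (N + 1)) : ℕ) = 1 := by
        rw [Fin.val_one']; exact Nat.mod_eq_of_lt (by omega)
      rw [this, Fin.val_zero]; omega
    exact_mod_cast (Finset.card_le_card this).trans Finset.card_le_two
  have hhigh : ∑ j : Fin (N + 1), (if N - 1 ≤ (j : ℕ) then (1 : ℝ) else 0) ≤ 2 := by
    rw [Finset.sum_boole]
    have : (Finset.univ.filter fun j : Fin (N + 1) => N - 1 ≤ (j : ℕ)) ⊆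
        {⟨N - 1, by omega⟩, Fin.last N} := by
      intro i hi
      simp only [Finset.mem_filter, Finset.mem_univ, true_and] at hi
      simp only [Finset.mem_insert, Finset.mem_singleton, Fin.ext_iff, Fin.val_last]
      omega
    exact_mod_cast (Finset.card_le_card this).trans Finset.card_le_two
  have hEs : ∑ i, ∑ j, E i j ≤ (N + 1) ^ 2 * (2 * β * θ) + 8 * β * α := by
    calc ∑ i, ∑ j, E i j ≤ ∑ i : Fin (N + 1), ∑ j : Fin (N + 1), (2 * β * θ +
          (if (i : ℕ) ≤ 1 then 1 else 0) * (if N - 1 ≤ (j : ℕ) then 1 else 0) * (2 * β * α)) :=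
          Finset.sum_le_sum fun i _ => Finset.sum_le_sum fun j _ => hEb i j
      _ = (N + 1) ^ 2 * (2 * β * θ) + (∑ i : Fin (N + 1), (if (i : ℕ) ≤ 1 then (1 : ℝ) else 0)) *
          (∑ j : Fin (N + 1), (if N - 1 ≤ (j : ℕ) then (1 : ℝ) else 0)) * (2 * β * α) := by
          simp only [Finset.sum_add_distrib, ← Finset.sum_mul, ← Finset.mul_sum]
          simp [sq]; ring
      _ ≤ (N + 1) ^ 2 * (2 * β * θ) + 2 * 2 * (2 * β * α) := by
          gcongr
      _ = _ := by ring
  have hHs : ∑ t, H t ≤ (N + 1) * (β * θ) := by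
    refine (Finset.sum_le_sum fun t _ => hHb t).trans_eq (by simp)
  have hN1 : (0 : ℝ) ≤ N := by positivity
  nlinarith [mul_nonneg hβ hθ, mul_nonneg hN1 (mul_nonneg hβ hθ),
    mul_nonneg (mul_nonneg hN1 hN1) (mul_nonneg hβ hθ)]

end PathSums

section AlternatingPaths

variable {V : Type*} [Fintype V] [DecidableEq V]

lemma MixingPair.row_bounds {A B : Matrix V V ℝ} {γ σ κ θ η : ℝ} {N : ℕ}
    (h : MixingPair A B γ σ κ θ) (hκ : 0 ≤ κ) (hκ1 : κ ≤ 1) (hσ0 : 0 ≤ σ) (hσ : σ < 1)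
    (hup : (1 + κ) ^ N * ((1 + σ) / (1 - σ)) ≤ 1 + η)
    (hdown : 1 - η ≤ (1 - κ) ^ N * ((1 - σ) / (1 + σ))) (i k : ℕ) (x : V) (hk : k ≤ N) :
    1 - η ≤ ∑ y, word (alternating A B) i k x y ∧
      ∑ y, word (alternating A B) i k x y ≤ 1 + η := by
  constructor
  · refine (hdown.trans ?_).trans (h.le_row_word hκ hκ1 hσ0 hσ i k x)
    refine mul_le_mul_of_nonneg_right ?_ (div_nonneg (by linarith) (by linarith))
    exact pow_le_pow_of_le_one (by linarith) (by linarith) hk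
  · refine (h.row_word_le hκ hσ i k x).trans (le_trans ?_ hup)
    refine mul_le_mul_of_nonneg_right ?_ (div_nonneg (by linarith) (by linarith))
    exact pow_le_pow_right₀ (by linarith) hk

lemma MixingPair.word_two_le {A B : Matrix V V ℝ} {γ σ κ θ : ℝ}
    (h : MixingPair A B γ σ κ θ) (i : ℕ) (x y : V) : word (alternating A B) i 2 x y ≤ θ := by
  have e : word (alternating A B) i 2 = alternating A B i * alternating A B (i + 1) := by
    rw [word_succ_left, word_one]
  rw [e]
  rcases Nat.mod_two_eq_zero_or_one i with hi | hi
  · have h1 : (i + 1) % 2 ≠ 0 := by omega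
    simp only [alternating, hi, h1, if_true, if_false]
    exact h.entry_le x y
  · have h1 : (i + 1) % 2 = 0 := by omega
    have h2 : i % 2 ≠ 0 := by omega
    simp only [alternating, h1, h2, if_true, if_false]
    have : B * A = (A * B).transpose := by
      rw [Matrix.transpose_mul, h.symm_left, h.symm_right]
    rw [this]
    exact h.entry_le y x

/-- The number of alternating paths between two vertices is nearly the same for all pairs. -/
lemma MixingPair.path_weight {A B : Matrix V V ℝ} {γ σ κ θ η α : ℝ} {b N : ℕ} [Nonempty V]
    (h : MixingPair A B γ σ κ θ) (hκ : 0 ≤ κ) (hκ1 : κ ≤ 1) (hσ0 : 0 ≤ σ) (hγ0 : 0 < γ)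
    (hγ : γ ≤ 1) (hσ : σ ≤ γ / 4) (hη : η ≤ 1 / 10)
    (hup : (1 + κ) ^ N * ((1 + σ) / (1 - σ)) ≤ 1 + η)
    (hdown : 1 - η ≤ (1 - κ) ^ N * ((1 - σ) / (1 + σ)))
    (hr : (1 - γ / 2) ^ b * √(Fintype.card V) + 4 * σ / γ ≤ η)
    (hN : N = 3 * (4 * b + 2)) (hA : ∀ x, A x x = 0) (hB : ∀ x, B x x = 0)
    (hAα : ∀ x y, A x y ≤ α) (hBα : ∀ x y, B x y ≤ α)
    (herr : 2 * (3 * (N + 1) ^ 2 * (2 * θ) + 8 * α) ≤ η) (y z : V) (hyz : y ≠ z) :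
    (∑ p : Fin (N + 1) → V, (if p 0 = y ∧ p (Fin.last N) = z then
      walkWeight (alternating A B) N p else 0) ≤ (1 + 4 * η) / Fintype.card V) ∧
    ∀ x, x ≠ y → x ≠ z → A y x = 0 → B x z = 0 → (1 - 4 * η) / Fintype.card V ≤
      ∑ p : Fin (N + 1) → V, (if (p 0 = y ∧ p (Fin.last N) = z) ∧ Function.Injective p ∧
        ∀ t, p t ≠ x then walkWeight (alternating A B) N p else 0) := by
  have hη0 : 0 ≤ η := le_trans (add_nonneg (mul_nonneg (pow_nonneg (by linarith) _)
    (Real.sqrt_nonneg _)) (by positivity)) hr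
  have hrow := h.row_bounds hκ hκ1 hσ0 (by linarith) hup hdown
  have hent := fun k (hk : 4 * b + 2 ≤ k) (hkN : k ≤ N) =>
    h.word_entry hσ0 hγ0 hγ hσ hr (lo := 1 - η) (hi := 1 + η) (by linarith) (by linarith) hk
      (fun i x l hl => hrow i l x (hl.trans hkN))
  have hV : (0 : ℝ) < Fintype.card V := by positivity
  have hup' : (1 + η) ^ 2 * (1 + η ^ 2) ≤ 1 + 4 * η := by nlinarith [pow_nonneg hη0 3]
  have hdown' : 1 - 3 * η ≤ (1 - η) ^ 2 * (1 - η ^ 2) := by nlinarith [pow_nonneg hη0 3]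
  rw [sum_walkWeight]
  refine ⟨?_, fun x hxy hxz h1 h2 => ?_⟩
  · refine (hent N (by omega) le_rfl 0 y z).2.trans ?_
    gcongr
  have hrow2 : ∀ i k x, k ≤ N → ∑ y, word (alternating A B) i k x y ≤ 2 := fun i k x hk =>
    (hrow i k x hk).2.trans (by linarith)
  have hcol2 : ∀ i k y, k ≤ N → ∑ x, word (alternating A B) i k x y ≤ 2 := fun i k y hk => by
    rw [h.col_word_eq]; exact hrow2 _ _ _ hk
  have hθ : 0 ≤ θ := (h.word_nonneg 0 2 y y).trans (h.word_two_le 0 y y)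
  have key := sum_injective_walkWeight_ge (S := alternating A B) (N := N) (k₀ := 4 * b + 2)
    (θ := 2 * θ) (α := α) (β := 2 / Fintype.card V) (x := x) (y := y) (z := z)
    h.alternating_nonneg
    (fun i x => by unfold alternating; split_ifs; exacts [hA x, hB x])
    (fun i x y => by unfold alternating; split_ifs; exacts [hAα x y, hBα x y])
    hrow2 hcol2
    (fun i k x y hk hkN => by
      obtain ⟨l, rfl⟩ := Nat.exists_eq_add_of_le hk
      rw [word_add, Matrix.mul_apply]
      calc ∑ w, word (alternating A B) i 2 x w * word (alternating A B) (i + 2) l w y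
          ≤ ∑ w, θ * word (alternating A B) (i + 2) l w y :=
            Finset.sum_le_sum fun w _ => mul_le_mul_of_nonneg_right (h.word_two_le _ _ _)
              (h.word_nonneg _ _ _ _)
        _ ≤ θ * 2 := by
            rw [← Finset.mul_sum]
            exact mul_le_mul_of_nonneg_left (hcol2 _ _ _ (by omega)) hθ
        _ = 2 * θ := mul_comm _ _)
    (fun i k x y hk hkN => by
      refine (hent k hk hkN i x y).2.trans ?_
      gcongr
      linarith)
    (by omega) hN hyz hxy hxz (by simpa [alternating] using h1)
    (by
      have : (N - 1) % 2 ≠ 0 := by omega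
      simpa [alternating, this] using h2)
  refine le_trans ?_ key
  have h3 := (hent N (by omega) le_rfl 0 y z).1
  have h4 : (1 - 3 * η) / Fintype.card V ≤ (1 - η) ^ 2 * (1 - η ^ 2) / Fintype.card V := by
    gcongr
  have h5 : 2 / (Fintype.card V : ℝ) * (3 * (N + 1) ^ 2 * (2 * θ) + 8 * α) ≤
      η / Fintype.card V := by
    rw [div_mul_eq_mul_div]; gcongr
  have h6 : (1 - 4 * η) / (Fintype.card V : ℝ) = (1 - 3 * η) / Fintype.card V -
    η / Fintype.card V := by ring
  linarith

/-- The steps of `p` alternate between edges of `E` and edges of `K`. -/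
def IsAlternating (E K : SimpleGraph V) (N : ℕ) (p : Fin (N + 1) → V) : Prop :=
  ∀ t : Fin N, if (t : ℕ) % 2 = 0 then E.Adj (p t.castSucc) (p t.succ)
    else K.Adj (p t.castSucc) (p t.succ)

lemma prod_alternating (a b : ℝ) (l : ℕ) :
    ∏ t : Fin (2 * l), (if (t : ℕ) % 2 = 0 then a else b) = (a * b) ^ l := by
  rw [Finset.prod_range (f := fun t => if t % 2 = 0 then a else b) |>.symm]
  induction l with
  | zero => simp
  | succ l ih =>
    rw [mul_add, mul_one, Finset.prod_range_succ, Finset.prod_range_succ, ih, pow_succ]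
    have h1 : 2 * l % 2 = 0 := by omega
    have h2 : ¬ (2 * l + 1) % 2 = 0 := by omega
    rw [if_pos h1, if_neg h2]; ring

/-- The adjacency matrix of a graph, scaled. -/
def scaledAdj (c : ℝ) (G : SimpleGraph V) : Matrix V V ℝ :=
  fun x y => if G.Adj x y then c⁻¹ else 0

lemma scaledAdj_apply (c : ℝ) (G : SimpleGraph V) (x y : V) :
    scaledAdj c G x y = if G.Adj x y then c⁻¹ else 0 := rfl

lemma alternating_scaledAdj (E K : SimpleGraph V) (D d : ℝ) (t : ℕ) (x y : V) :
    alternating (scaledAdj D E) (scaledAdj d K) t x y =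
      if t % 2 = 0 then (if E.Adj x y then D⁻¹ else 0) else if K.Adj x y then d⁻¹ else 0 := by
  unfold alternating; split_ifs <;> simp_all [scaledAdj_apply]

lemma walkWeight_scaledAdj (E K : SimpleGraph V) (D d : ℝ) (l : ℕ) (p : Fin (2 * l + 1) → V) :
    walkWeight (alternating (scaledAdj D E) (scaledAdj d K)) (2 * l) p =
      if IsAlternating E K (2 * l) p then ((D * d) ^ l)⁻¹ else 0 := by
  unfold walkWeight IsAlternating
  split_ifs with h
  · rw [← inv_pow, mul_inv, ← prod_alternating]
    refine Finset.prod_congr rfl fun t _ => ?_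
    have := h t
    rw [alternating_scaledAdj]
    split_ifs at this ⊢ <;> simp_all
  · push Not at h
    obtain ⟨t, ht⟩ := h
    refine Finset.prod_eq_zero (Finset.mem_univ t) ?_
    rw [alternating_scaledAdj]
    split_ifs at ht ⊢ <;> simp_all

/-- The alternating paths from `y` to `z` that avoid `x`. -/
def altPaths (E K : SimpleGraph V) (N : ℕ) (x y z : V) : Finset (Fin (N + 1) → V) :=
  Finset.univ.filter fun p => (p 0 = y ∧ p (Fin.last N) = z) ∧
    (Function.Injective p ∧ ∀ t, p t ≠ x) ∧ IsAlternating E K N p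

lemma card_altPaths (E K : SimpleGraph V) {D d : ℝ} (hD : 0 < D) (hd : 0 < d) (l : ℕ)
    (x y z : V) : ((altPaths E K (2 * l) x y z).card : ℝ) = (D * d) ^ l *
      ∑ p : Fin (2 * l + 1) → V, (if (p 0 = y ∧ p (Fin.last (2 * l)) = z) ∧
        Function.Injective p ∧ ∀ t, p t ≠ x then
          walkWeight (alternating (scaledAdj D E) (scaledAdj d K)) (2 * l) p else 0) := by
  simp only [walkWeight_scaledAdj, ← ite_and]
  rw [← Finset.sum_filter, Finset.sum_const, nsmul_eq_mul, altPaths]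
  have : (D * d) ^ l ≠ 0 := by positivity
  field_simp
  norm_cast
  congr 1
  ext p
  simp only [Finset.mem_filter]
  tauto

/-- Crude bound on the number of alternating paths. -/
lemma card_altPaths_le (E K : SimpleGraph V) {a d : ℕ} (l : ℕ) (x y z : V)
    (hE : ∀ v, (Finset.univ.filter fun u => E.Adj v u).card ≤ a)
    (hK : ∀ v, (Finset.univ.filter fun u => K.Adj v u).card ≤ d) :
    (altPaths E K (2 * l) x y z).card ≤ (a * d) ^ l := by
  have main : ∀ N, (Finset.univ.filter fun p : Fin (N + 1) → V => p 0 = y ∧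
      IsAlternating E K N p).card ≤ ∏ t : Fin N, (if (t : ℕ) % 2 = 0 then a else d) := by
    intro N
    induction N with
    | zero =>
      simp only [Finset.univ_eq_empty, Finset.prod_empty]
      refine Finset.card_le_one.2 fun p hp q hq => ?_
      simp only [Finset.mem_filter, Finset.mem_univ, true_and] at hp hq
      ext t
      rw [show t = 0 from Fin.ext (by omega), hp.1, hq.1]
    | succ N ih =>
      rw [Fin.prod_univ_castSucc]
      simp only [Fin.val_castSucc, Fin.val_last]
      refine le_trans ?_ (Nat.mul_le_mul_right _ ih)
      rw [mul_comm]
      refine Finset.card_le_mul_card_image_of_maps_to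
        (f := fun p : Fin (N + 2) → V => (Fin.init p : Fin (N + 1) → V)) ?_ _ ?_
      · intro p hp
        simp only [Finset.mem_filter, Finset.mem_univ, true_and, Finset.coe_filter,
          Set.mem_ofPred_eq] at hp ⊢
        refine ⟨hp.1, fun t => ?_⟩
        have := hp.2 t.castSucc
        rw [Fin.succ_castSucc] at this
        simpa [Fin.init] using this
      · intro q _
        have hcard : (Finset.univ.filter fun u => if N % 2 = 0 then E.Adj (q (Fin.last N)) u
            else K.Adj (q (Fin.last N)) u).card ≤ if N % 2 = 0 then a else d := by
          split_ifs
          exacts [hE _, hK _]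
        refine le_trans (Finset.card_le_card_of_injOn (fun p => p (Fin.last (N + 1))) ?_ ?_) hcard
        · intro p hp
          simp only [Finset.mem_filter, Finset.mem_univ, true_and, Finset.coe_filter,
            Set.mem_ofPred_eq] at hp ⊢
          have := hp.1.2 (Fin.last N)
          rw [Fin.succ_last] at this
          rw [← hp.2]
          simpa [Fin.init] using this
        · intro p hp p' hp' hpp
          simp only [Finset.mem_filter, Finset.mem_univ, true_and, Finset.coe_filter,
            Set.mem_ofPred_eq] at hp hp' hpp
          rw [← Fin.snoc_init_self p, ← Fin.snoc_init_self p', hp.2, hp'.2, hpp]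
  have e : ∏ t : Fin (2 * l), (if (t : ℕ) % 2 = 0 then a else d) = (a * d) ^ l := by
    have := prod_alternating (a : ℝ) d l
    exact_mod_cast this
  rw [← e]
  refine (Finset.card_le_card ?_).trans (main (2 * l))
  intro p hp
  simp only [altPaths, Finset.mem_filter, Finset.mem_univ, true_and] at hp ⊢
  exact ⟨hp.1.1, hp.2.2⟩

end AlternatingPaths

section Switching

lemma deg_eq_card (G : SimpleGraph (Fin n)) (v : Fin n) :
    deg G v = (Finset.univ.filter fun u => G.Adj v u).card := by
  unfold deg
  rw [Nat.card_eq_fintype_card, ← Set.toFinset_card]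
  congr 1; ext u; simp

variable {V : Type*} [Fintype V] [DecidableEq V]

/-- The graph obtained from `K` by flipping the pairs in `Z`. -/
def flip (K : SimpleGraph V) (Z : Set (Sym2 V)) : SimpleGraph V where
  Adj u v := u ≠ v ∧ Xor (K.Adj u v) (s(u, v) ∈ Z)
  symm := ⟨fun u v h => by rw [Sym2.eq_swap, K.adj_comm]; exact ⟨h.1.symm, h.2⟩⟩
  loopless := ⟨fun _ h => h.1 rfl⟩

lemma flip_adj {K : SimpleGraph V} {Z : Set (Sym2 V)} {u v : V} :
    (flip K Z).Adj u v ↔ u ≠ v ∧ Xor (K.Adj u v) (s(u, v) ∈ Z) := Iff.rfl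

lemma flip_flip (K : SimpleGraph V) (Z : Set (Sym2 V)) : flip (flip K Z) Z = K := by
  ext u v
  by_cases huv : u = v
  · simp [huv]
  · by_cases h1 : K.Adj u v <;> by_cases h2 : s(u, v) ∈ Z <;> simp [flip_adj, Xor, huv, h1, h2]

/-- A set of pairs is balanced with respect to `K` if each vertex lies in equally many edges and
non-edges of the set. -/
def IsBalanced (K : SimpleGraph V) (Z : Set (Sym2 V)) : Prop :=
  ∀ v, (Finset.univ.filter fun u => s(v, u) ∈ Z ∧ K.Adj v u).card =
    (Finset.univ.filter fun u => s(v, u) ∈ Z ∧ u ≠ v ∧ ¬ K.Adj v u).card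

lemma IsBalanced.card_flip {K : SimpleGraph V} {Z : Set (Sym2 V)} (h : IsBalanced K Z) (v : V) :
    (Finset.univ.filter fun u => (flip K Z).Adj v u).card =
      (Finset.univ.filter fun u => K.Adj v u).card := by
  have h1 := Finset.card_filter_add_card_filter_not (s := Finset.univ.filter fun u =>
    (flip K Z).Adj v u) (fun u => s(v, u) ∈ Z)
  have h2 := Finset.card_filter_add_card_filter_not (s := Finset.univ.filter fun u =>
    K.Adj v u) (fun u => s(v, u) ∈ Z)
  rw [Finset.filter_filter, Finset.filter_filter] at h1 h2
  have h3 : (Finset.univ.filter fun u => (flip K Z).Adj v u ∧ s(v, u) ∈ Z) =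
      Finset.univ.filter fun u => s(v, u) ∈ Z ∧ u ≠ v ∧ ¬ K.Adj v u := by
    ext u; simp only [Finset.mem_filter, Finset.mem_univ, true_and, flip_adj, Xor]
    constructor
    · rintro ⟨⟨a, b⟩, c⟩; exact ⟨c, a.symm, by tauto⟩
    · rintro ⟨a, b, c⟩; exact ⟨⟨b.symm, by tauto⟩, a⟩
  have h4 : (Finset.univ.filter fun u => (flip K Z).Adj v u ∧ ¬ s(v, u) ∈ Z) =
      Finset.univ.filter fun u => K.Adj v u ∧ ¬ s(v, u) ∈ Z := by
    ext u; simp only [Finset.mem_filter, Finset.mem_univ, true_and, flip_adj, Xor]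
    constructor
    · rintro ⟨⟨a, b⟩, c⟩; tauto
    · rintro ⟨a, b⟩; exact ⟨⟨a.ne, by tauto⟩, b⟩
  have h5 : (Finset.univ.filter fun u => K.Adj v u ∧ s(v, u) ∈ Z) =
      Finset.univ.filter fun u => s(v, u) ∈ Z ∧ K.Adj v u := by
    ext u; simp [and_comm]
  rw [h3, h4, ← h v] at h1
  rw [h5] at h2
  omega

/-- The pairs joining each vertex of a family to its partners under two involutions. -/
def partnerPairs {ι : Type*} (q : ι → V) (α β : ι → ι) : Set (Sym2 V) :=
  {e | ∃ i, e = s(q i, q (α i)) ∨ e = s(q i, q (β i))}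

lemma isBalanced_partnerPairs {ι : Type*} {K : SimpleGraph V} {q : ι → V} {α β : ι → ι}
    (hq : Function.Injective q) (hα : ∀ i, α (α i) = i) (hβ : ∀ i, β (β i) = i)
    (hβ' : ∀ i, β i ≠ i) (hK : ∀ i, K.Adj (q i) (q (α i))) (hK' : ∀ i, ¬ K.Adj (q i) (q (β i))) :
    IsBalanced K (partnerPairs q α β) := by
  intro v
  have hmem : ∀ u, s(v, u) ∈ partnerPairs q α β → ∃ i, v = q i ∧ (u = q (α i) ∨ u = q (β i)) := by
    rintro u ⟨i, h | h⟩
    · rcases Sym2.eq_iff.1 h with ⟨h1, h2⟩ | ⟨h1, h2⟩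
      · exact ⟨i, h1, Or.inl h2⟩
      · exact ⟨α i, h1, Or.inl (by rw [hα, h2])⟩
    · rcases Sym2.eq_iff.1 h with ⟨h1, h2⟩ | ⟨h1, h2⟩
      · exact ⟨i, h1, Or.inr h2⟩
      · exact ⟨β i, h1, Or.inr (by rw [hβ, h2])⟩
  by_cases hv : ∃ i, v = q i
  · obtain ⟨i, rfl⟩ := hv
    have h1 : (Finset.univ.filter fun u => s(q i, u) ∈ partnerPairs q α β ∧ K.Adj (q i) u) =
        {q (α i)} := by
      ext u
      simp only [Finset.mem_filter, Finset.mem_univ, true_and, Finset.mem_singleton]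
      constructor
      · rintro ⟨h1, h2⟩
        obtain ⟨j, hj, h | h⟩ := hmem u h1
        · rw [h, hq hj]
        · rw [h, hq hj] at h2; exact absurd h2 (hK' j)
      · rintro rfl; exact ⟨⟨i, Or.inl rfl⟩, hK i⟩
    have h2 : (Finset.univ.filter fun u => s(q i, u) ∈ partnerPairs q α β ∧ u ≠ q i ∧
        ¬ K.Adj (q i) u) = {q (β i)} := by
      ext u
      simp only [Finset.mem_filter, Finset.mem_univ, true_and, Finset.mem_singleton]
      constructor
      · rintro ⟨h1, _, h2⟩
        obtain ⟨j, hj, h | h⟩ := hmem u h1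
        · rw [h, hq hj] at h2; exact absurd (hK j) h2
        · rw [h, hq hj]
      · rintro rfl; exact ⟨⟨i, Or.inr rfl⟩, fun h => hβ' i (hq h), hK' i⟩
    rw [h1, h2]; simp
  · rw [Finset.filter_false_of_mem, Finset.filter_false_of_mem]
    · rintro u _ ⟨h, _⟩; obtain ⟨i, hi, _⟩ := hmem u h; exact hv ⟨i, hi⟩
    · rintro u _ ⟨h, _⟩; obtain ⟨i, hi, _⟩ := hmem u h; exact hv ⟨i, hi⟩

/-- The partner of `i` on a cycle of even length along edges of one parity class. -/
def evenPartner {M : ℕ} (hM : Even M) (i : Fin M) : Fin M :=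
  if h : (i : ℕ) % 2 = 0 then ⟨i + 1, by have := i.isLt; obtain ⟨r, hr⟩ := hM; omega⟩
  else ⟨i - 1, by have := i.isLt; omega⟩

/-- The partner of `i` on a cycle of even length along edges of the other parity class. -/
def oddPartner {M : ℕ} (i : Fin M) : Fin M :=
  if (i : ℕ) % 2 = 0 then
    if (i : ℕ) = 0 then ⟨M - 1, by have := i.isLt; omega⟩ else ⟨i - 1, by have := i.isLt; omega⟩
  else if h : (i : ℕ) + 1 = M then ⟨0, by have := i.isLt; omega⟩
    else ⟨i + 1, by have := i.isLt; omega⟩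

lemma evenPartner_evenPartner {M : ℕ} (hM : Even M) (i : Fin M) :
    evenPartner hM (evenPartner hM i) = i := by
  obtain ⟨r, hr⟩ := hM
  have hi := i.isLt
  apply Fin.ext
  unfold evenPartner
  split_ifs with h1 h2 h2 <;> simp only at h2 ⊢ <;> omega

lemma val_evenPartner {M : ℕ} (hM : Even M) (i : Fin M) :
    (evenPartner hM i : ℕ) = if (i : ℕ) % 2 = 0 then (i : ℕ) + 1 else i - 1 := by
  unfold evenPartner; split_ifs <;> rfl

lemma val_oddPartner {M : ℕ} (i : Fin M) :
    (oddPartner i : ℕ) = if (i : ℕ) % 2 = 0 then (if (i : ℕ) = 0 then M - 1 else i - 1)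
      else if (i : ℕ) + 1 = M then 0 else i + 1 := by
  unfold oddPartner; split_ifs <;> rfl

lemma oddPartner_oddPartner {M : ℕ} (hM : Even M) (i : Fin M) :
    oddPartner (oddPartner i) = i := by
  obtain ⟨r, hr⟩ := hM
  have hi := i.isLt
  have h1 := val_oddPartner i
  have h2 := val_oddPartner (oddPartner i)
  apply Fin.ext
  generalize (oddPartner i : ℕ) = j at *
  rw [h2]
  split_ifs at h1 ⊢ <;> omega

lemma oddPartner_ne {M : ℕ} (hM : Even M) (i : Fin M) : oddPartner i ≠ i := by
  obtain ⟨r, hr⟩ := hM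
  have hi := i.isLt
  rw [Ne, Fin.ext_iff]
  unfold oddPartner
  split_ifs <;> simp_all <;> omega

/-- The pairs of the cycle formed by `x` and the path `p`. -/
def cyclePairs {N : ℕ} (hN : Even (N + 2)) (x : V) (p : Fin (N + 1) → V) : Set (Sym2 V) :=
  partnerPairs (Fin.cons x p : Fin (N + 2) → V) (evenPartner hN) oddPartner


/-- The data of an edge `xy` of `K`, a non-edge `xz`, and an alternating path from `y` to `z`. -/
structure SwitchData (F K : SimpleGraph V) (N : ℕ) (x y z : V) (p : Fin (N + 1) → V) : Prop where
  le : K ≤ F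
  edge : K.Adj x y
  adj : F.Adj x z
  nonedge : ¬ K.Adj x z
  path : p ∈ altPaths (F \ K) K N x y z

variable {F K : SimpleGraph V} {N : ℕ} {x y z : V} {p : Fin (N + 1) → V}

namespace SwitchData

lemma start_eq (h : SwitchData F K N x y z p) : p 0 = y := (Finset.mem_filter.1 h.path).2.1.1

lemma last_eq (h : SwitchData F K N x y z p) : p (Fin.last N) = z :=
  (Finset.mem_filter.1 h.path).2.1.2

lemma injective (h : SwitchData F K N x y z p) : Function.Injective p :=
  (Finset.mem_filter.1 h.path).2.2.1.1

lemma avoid (h : SwitchData F K N x y z p) (t : Fin (N + 1)) : p t ≠ x :=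
  (Finset.mem_filter.1 h.path).2.2.1.2 t

lemma step (h : SwitchData F K N x y z p) (t : ℕ) (ht : t < N) :
    if t % 2 = 0 then (F \ K).Adj (p ⟨t, by omega⟩) (p ⟨t + 1, by omega⟩)
      else K.Adj (p ⟨t, by omega⟩) (p ⟨t + 1, by omega⟩) :=
  (Finset.mem_filter.1 h.path).2.2.2 ⟨t, ht⟩

lemma cons_injective (h : SwitchData F K N x y z p) :
    Function.Injective (Fin.cons x p : Fin (N + 2) → V) := by
  rw [Fin.cons_injective_iff]
  exact ⟨fun ⟨t, ht⟩ => h.avoid t ht, h.injective⟩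

lemma cons_step (h : SwitchData F K N x y z p) (i : ℕ) (hi : i + 1 < N + 2) :
    if i % 2 = 0 then K.Adj ((Fin.cons x p : Fin (N + 2) → V) ⟨i, by omega⟩)
        ((Fin.cons x p : Fin (N + 2) → V) ⟨i + 1, hi⟩)
      else (F \ K).Adj ((Fin.cons x p : Fin (N + 2) → V) ⟨i, by omega⟩)
        ((Fin.cons x p : Fin (N + 2) → V) ⟨i + 1, hi⟩) := by
  rcases i with _ | i
  · have : K.Adj x (p 0) := by rw [h.start_eq]; exact h.edge
    simpa using this
  · have hs := h.step i (by omega)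
    have e1 : (Fin.cons x p : Fin (N + 2) → V) ⟨i + 1, by omega⟩ = p ⟨i, by omega⟩ := rfl
    have e2 : (Fin.cons x p : Fin (N + 2) → V) ⟨i + 1 + 1, hi⟩ = p ⟨i + 1, by omega⟩ := rfl
    rw [e1, e2]
    rcases Nat.mod_two_eq_zero_or_one i with h0 | h0
    · have h1 : (i + 1) % 2 ≠ 0 := by omega
      simpa [h0, h1] using hs
    · have h1 : (i + 1) % 2 = 0 := by omega
      have h2 : i % 2 ≠ 0 := by omega
      rw [if_neg h2] at hs
      rw [if_pos h1]
      exact hs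

lemma cons_last (h : SwitchData F K N x y z p) :
    (Fin.cons x p : Fin (N + 2) → V) ⟨N + 1, by omega⟩ = z := h.last_eq

lemma adj_evenPartner (h : SwitchData F K N x y z p) (hN : Even (N + 2)) (i : Fin (N + 2)) :
    K.Adj ((Fin.cons x p : Fin (N + 2) → V) i)
      ((Fin.cons x p : Fin (N + 2) → V) (evenPartner hN i)) := by
  have hN' := hN
  obtain ⟨r, hr⟩ := hN'
  rcases Nat.mod_two_eq_zero_or_one i with h0 | h0
  · have := h.cons_step i (by omega)
    rw [if_pos h0] at this
    have e : evenPartner hN i = ⟨i + 1, by omega⟩ := by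
      apply Fin.ext; rw [val_evenPartner, if_pos h0]
    rw [e]; exact this
  · have hi := i.isLt
    have := h.cons_step (i - 1) (by omega)
    rw [if_pos (by omega)] at this
    have e : evenPartner hN i = ⟨i - 1, by omega⟩ := by
      apply Fin.ext; rw [val_evenPartner, if_neg (by omega)]
    rw [e]
    have e2 : i = ⟨i - 1 + 1, by omega⟩ := Fin.ext (by simp only; omega)
    conv => arg 2; rw [e2]
    exact this.symm

lemma adj_oddPartner (h : SwitchData F K N x y z p) (hN : Even (N + 2)) (i : Fin (N + 2)) :
    (F \ K).Adj ((Fin.cons x p : Fin (N + 2) → V) i)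
      ((Fin.cons x p : Fin (N + 2) → V) (oddPartner i)) := by
  obtain ⟨r, hr⟩ := hN
  have hi := i.isLt
  have hxz : (F \ K).Adj x z := ⟨h.adj, h.nonedge⟩
  rcases Nat.mod_two_eq_zero_or_one i with h0 | h0
  · by_cases hi0 : (i : ℕ) = 0
    · have e : oddPartner i = ⟨N + 1, by omega⟩ := by
        apply Fin.ext; rw [val_oddPartner, if_pos h0, if_pos hi0]; simp
      have e2 : i = 0 := Fin.ext hi0
      rw [e, h.cons_last, e2]
      exact hxz
    · have := h.cons_step (i - 1) (by omega)
      rw [if_neg (by omega)] at this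
      have e : oddPartner i = ⟨i - 1, by omega⟩ := by
        apply Fin.ext; rw [val_oddPartner, if_pos h0, if_neg hi0]
      rw [e]
      have e2 : i = ⟨i - 1 + 1, by omega⟩ := Fin.ext (by simp only; omega)
      conv => arg 2; rw [e2]
      exact this.symm
  · by_cases hi0 : (i : ℕ) + 1 = N + 2
    · have e : oddPartner i = 0 := by
        apply Fin.ext; rw [val_oddPartner, if_neg (by omega), if_pos hi0]; rfl
      have e2 : i = ⟨N + 1, by omega⟩ := Fin.ext (by simp only; omega)
      rw [e, e2, h.cons_last]
      exact hxz.symm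
    · have := h.cons_step i (by omega)
      rw [if_neg (by omega)] at this
      have e : oddPartner i = ⟨i + 1, by omega⟩ := by
        apply Fin.ext; rw [val_oddPartner, if_neg (by omega), if_neg hi0]
      rw [e]; exact this

lemma isBalanced (h : SwitchData F K N x y z p) (hN : Even (N + 2)) :
    IsBalanced K (cyclePairs hN x p) :=
  isBalanced_partnerPairs h.cons_injective (evenPartner_evenPartner hN)
    (oddPartner_oddPartner hN) (oddPartner_ne hN) (h.adj_evenPartner hN)
    fun i => (h.adj_oddPartner hN i).2

lemma cyclePairs_subset (h : SwitchData F K N x y z p) (hN : Even (N + 2)) {u v : V}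
    (huv : s(u, v) ∈ cyclePairs hN x p) : F.Adj u v := by
  obtain ⟨i, hi | hi⟩ := huv
  · have := h.le (h.adj_evenPartner hN i)
    rwa [← SimpleGraph.mem_edgeSet, ← hi] at this
  · have := (h.adj_oddPartner hN i).1
    rwa [← SimpleGraph.mem_edgeSet, ← hi] at this

lemma mem_cyclePairs_step (hN : Even (N + 2)) (t : ℕ) (ht : t < N) :
    s(p ⟨t, by omega⟩, p ⟨t + 1, by omega⟩) ∈ cyclePairs hN x p := by
  have e1 : (Fin.cons x p : Fin (N + 2) → V) ⟨t + 1, by omega⟩ = p ⟨t, by omega⟩ := rfl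
  have e2 : (Fin.cons x p : Fin (N + 2) → V) ⟨t + 1 + 1, by omega⟩ = p ⟨t + 1, by omega⟩ := rfl
  refine ⟨⟨t + 1, by omega⟩, ?_⟩
  rw [← e1, ← e2]
  rcases Nat.mod_two_eq_zero_or_one t with h0 | h0
  · right
    have e : oddPartner (⟨t + 1, by omega⟩ : Fin (N + 2)) = ⟨t + 1 + 1, by omega⟩ :=
      Fin.ext (by rw [val_oddPartner, if_neg (by simp only; omega), if_neg (by simp only; omega)])
    rw [e]
  · left
    have e : evenPartner hN (⟨t + 1, by omega⟩ : Fin (N + 2)) = ⟨t + 1 + 1, by omega⟩ :=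
      Fin.ext (by rw [val_evenPartner, if_pos (by simp only; omega)])
    rw [e]

lemma switch_le (h : SwitchData F K N x y z p) (hN : Even (N + 2)) :
    flip K (cyclePairs hN x p) ≤ F := by
  intro u v huv
  rcases huv.2 with h1 | h1
  · exact h.le h1.1
  · exact h.cyclePairs_subset hN h1.1

lemma mem_first (h : SwitchData F K N x y z p) (hN : Even (N + 2)) :
    s(x, y) ∈ cyclePairs hN x p := by
  refine ⟨0, Or.inl ?_⟩
  have : evenPartner hN 0 = (0 : Fin (N + 1)).succ := by
    apply Fin.ext; rw [val_evenPartner]; simp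
  rw [this, Fin.cons_zero, Fin.cons_succ, h.start_eq]

lemma mem_last (h : SwitchData F K N x y z p) (hN : Even (N + 2)) :
    s(x, z) ∈ cyclePairs hN x p := by
  refine ⟨0, Or.inr ?_⟩
  have : oddPartner (0 : Fin (N + 2)) = (Fin.last N).succ := by
    apply Fin.ext; rw [val_oddPartner]; simp
  rw [this, Fin.cons_zero, Fin.cons_succ, h.last_eq]

/-- Switching along an alternating cycle. -/
lemma switch (h : SwitchData F K N x y z p) (hN : Even (N + 2)) :
    SwitchData F (flip K (cyclePairs hN x p)) N x z y (p ∘ Fin.rev) where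
  le := h.switch_le hN
  edge := ⟨h.adj.ne, Or.inr ⟨h.mem_last hN, h.nonedge⟩⟩
  adj := h.le h.edge
  nonedge := fun hc => by
    rcases hc.2 with h1 | h1
    · exact h1.2 (h.mem_first hN)
    · exact h1.2 h.edge
  path := by
    have hN' := hN
    obtain ⟨r, hr⟩ := hN'
    refine Finset.mem_filter.2 ⟨Finset.mem_univ _, ⟨?_, ?_⟩, ⟨?_, ?_⟩, ?_⟩
    · simp [h.last_eq]
    · simp [h.start_eq]
    · exact h.injective.comp Fin.rev_injective
    · exact fun t => h.avoid _
    · intro t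
      have ht := t.isLt
      have e1 : (p ∘ Fin.rev) t.castSucc = p ⟨N - 1 - t + 1, by omega⟩ := by
        simp only [Function.comp]; congr 1; apply Fin.ext; simp [Fin.val_rev]; omega
      have e2 : (p ∘ Fin.rev) t.succ = p ⟨N - 1 - t, by omega⟩ := by
        simp only [Function.comp]; congr 1; apply Fin.ext; simp [Fin.val_rev]; omega
      have hs := h.step (N - 1 - t) (by omega)
      have hm := mem_cyclePairs_step (x := x) (p := p) hN (N - 1 - t) (by omega)
      rw [e1, e2]
      rcases Nat.mod_two_eq_zero_or_one t with h0 | h0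
      · rw [if_neg (by omega)] at hs
        rw [if_pos h0]
        refine SimpleGraph.Adj.symm ⟨h.le hs, fun hc => ?_⟩
        rcases hc.2 with h1 | h1
        · exact h1.2 hm
        · exact h1.2 hs
      · rw [if_pos (by omega)] at hs
        rw [if_neg (by omega)]
        exact SimpleGraph.Adj.symm ⟨hs.1.ne, Or.inr ⟨hm, hs.2⟩⟩

end SwitchData

end Switching

section Ratio

lemma IsRegularGraph.flip {K : SimpleGraph (Fin n)} {Z : Set (Sym2 (Fin n))} {d : ℕ}
    (hK : IsRegularGraph K d) (h : IsBalanced K Z) : IsRegularGraph (flip K Z) d := fun v => by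
  rw [deg_eq_card, h.card_flip v, ← deg_eq_card, hK v]

/-- The `d`-regular subgraphs of `F`. -/
def regSub (F : SimpleGraph (Fin n)) (d : ℕ) : Finset (SimpleGraph (Fin n)) :=
  Finset.univ.filter fun K => IsRegularGraph K d ∧ K ≤ F

variable {F : SimpleGraph (Fin n)} {d : ℕ}

lemma mem_regSub {K : SimpleGraph (Fin n)} : K ∈ regSub F d ↔ IsRegularGraph K d ∧ K ≤ F := by
  simp [regSub]

/-- The number of alternating paths is conserved by switching. -/
lemma sum_card_altPaths_le {N : ℕ} (hN : Even (N + 2)) {x y z : Fin n} (hxz : F.Adj x z) :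
    ∑ K ∈ (regSub F d).filter (fun K => K.Adj x y ∧ ¬ K.Adj x z),
      (altPaths (F \ K) K N x y z).card ≤
    ∑ K ∈ (regSub F d).filter (fun K => K.Adj x z ∧ ¬ K.Adj x y),
      (altPaths (F \ K) K N x z y).card := by
  rw [← Finset.card_sigma, ← Finset.card_sigma]
  have hdata : ∀ w ∈ ((regSub F d).filter (fun K => K.Adj x y ∧ ¬ K.Adj x z)).sigma
      (fun K => altPaths (F \ K) K N x y z), IsRegularGraph w.1 d ∧
        SwitchData F w.1 N x y z w.2 := by
    rintro ⟨K, p⟩ hw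
    rw [Finset.mem_sigma, Finset.mem_filter, mem_regSub] at hw
    exact ⟨hw.1.1.1, hw.1.1.2, hw.1.2.1, hxz, hw.1.2.2, hw.2⟩
  refine Finset.card_le_card_of_injOn
    (fun w => ⟨flip w.1 (cyclePairs hN x w.2), w.2 ∘ Fin.rev⟩) ?_ ?_
  · intro w hw
    obtain ⟨h1, h2⟩ := hdata w hw
    have h3 := h2.switch hN
    rw [Finset.mem_coe, Finset.mem_sigma, Finset.mem_filter, mem_regSub]
    exact ⟨⟨⟨h1.flip (h2.isBalanced hN), h3.le⟩, h3.edge, h3.nonedge⟩, h3.path⟩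
  · rintro ⟨K, p⟩ _ ⟨K', p'⟩ _ h
    simp only [Sigma.mk.injEq, heq_eq_eq] at h
    obtain ⟨h1, h2⟩ := h
    have hp : p = p' := by
      funext t
      have := congrFun h2 t.rev
      simpa using this
    subst hp
    have : K = K' := by
      rw [← flip_flip K (cyclePairs hN x p), h1, flip_flip]
    rw [this]

lemma card_adj_le_of_sum {N : ℕ} (hN : Even (N + 2)) {x y z : Fin n} (hxz : F.Adj x z)
    {B : Finset (SimpleGraph (Fin n))} {lo hi top : ℝ} (hlo : 0 ≤ lo)
    (htop : 0 ≤ top) (hhi : 0 ≤ hi)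
    (h1 : ∀ K ∈ regSub F d, K ∉ B → K.Adj x y → ¬ K.Adj x z →
      lo ≤ (altPaths (F \ K) K N x y z).card)
    (h2 : ∀ K ∈ regSub F d, K ∉ B → ((altPaths (F \ K) K N x z y).card : ℝ) ≤ hi)
    (h3 : ∀ K ∈ regSub F d, ((altPaths (F \ K) K N x z y).card : ℝ) ≤ top) :
    lo * ((regSub F d).filter (fun K => K.Adj x y ∧ ¬ K.Adj x z)).card ≤
      hi * ((regSub F d).filter (fun K => K.Adj x z ∧ ¬ K.Adj x y)).card +
      (lo + top) * B.card := by
  have key := sum_card_altPaths_le (d := d) hN (y := y) hxz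
  set A := (regSub F d).filter (fun K => K.Adj x y ∧ ¬ K.Adj x z)
  set A' := (regSub F d).filter (fun K => K.Adj x z ∧ ¬ K.Adj x y)
  have key' : ∑ K ∈ A, ((altPaths (F \ K) K N x y z).card : ℝ) ≤
      ∑ K ∈ A', ((altPaths (F \ K) K N x z y).card : ℝ) := by exact_mod_cast key
  have hA : lo * A.card - lo * B.card ≤ ∑ K ∈ A, ((altPaths (F \ K) K N x y z).card : ℝ) := by
    calc lo * A.card - lo * B.card ≤ ∑ K ∈ A, (lo - if K ∈ B then lo else 0) := by
          rw [Finset.sum_sub_distrib, Finset.sum_const, ← Finset.sum_filter, Finset.sum_const,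
            nsmul_eq_mul, nsmul_eq_mul, mul_comm lo, mul_comm lo]
          gcongr
          intro K; simp
      _ ≤ _ := by
          refine Finset.sum_le_sum fun K hK => ?_
          obtain ⟨hK1, hK2, hK3⟩ := Finset.mem_filter.1 hK
          split_ifs with hB
          · simp
          · simpa using h1 K hK1 hB hK2 hK3
  have hA' : ∑ K ∈ A', ((altPaths (F \ K) K N x z y).card : ℝ) ≤ hi * A'.card + top * B.card := by
    calc _ ≤ ∑ K ∈ A', (hi + if K ∈ B then top else 0) := by
          refine Finset.sum_le_sum fun K hK => ?_
          obtain ⟨hK1, -⟩ := Finset.mem_filter.1 hK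
          split_ifs with hB
          · linarith [h3 K hK1]
          · simpa using h2 K hK1 hB
      _ ≤ _ := by
          rw [Finset.sum_add_distrib, Finset.sum_const, ← Finset.sum_filter, Finset.sum_const,
            nsmul_eq_mul, nsmul_eq_mul, mul_comm hi, mul_comm top]
          gcongr
          intro K; simp
  linarith

lemma sum_card_adj (x : Fin n) :
    ∑ z ∈ Finset.univ.filter (fun z => F.Adj x z),
      ((regSub F d).filter fun K => K.Adj x z).card = d * (regSub F d).card := by
  simp only [Finset.card_filter (s := regSub F d)]
  rw [Finset.sum_comm, mul_comm, ← smul_eq_mul, ← Finset.sum_const]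
  refine Finset.sum_congr rfl fun K hK => ?_
  obtain ⟨h1, h2⟩ := mem_regSub.1 hK
  rw [← Finset.card_filter, Finset.filter_filter, ← h1 x, deg_eq_card]
  congr 1
  ext z
  simp only [Finset.mem_filter, Finset.mem_univ, true_and]
  exact ⟨fun h => h.2, fun h => ⟨h2 h, h⟩⟩

lemma card_adj_sdiff {K : SimpleGraph (Fin n)} (hK : K ∈ regSub F d) (v : Fin n) :
    (Finset.univ.filter fun u => (F \ K).Adj v u).card + d = deg F v := by
  obtain ⟨h1, h2⟩ := mem_regSub.1 hK
  rw [← h1 v, deg_eq_card, deg_eq_card, ← Finset.card_union_of_disjoint]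
  · congr 1
    ext u
    simp only [Finset.mem_union, Finset.mem_filter, Finset.mem_univ, true_and, SimpleGraph.sdiff_adj]
    have := @h2 v u
    tauto
  · rw [Finset.disjoint_filter]
    rintro u _ h
    exact h.2

lemma scaledAdj_mulVec_one (c : ℝ) (G : SimpleGraph (Fin n)) (v : Fin n) :
    (scaledAdj c G).mulVec 1 v = (Finset.univ.filter fun u => G.Adj v u).card * c⁻¹ := by
  simp [Matrix.mulVec, dotProduct, scaledAdj_apply, ← Finset.sum_filter]

/-- If edges at a common vertex are nearly equally likely, then all edges are. -/
lemma edge_ratio_of_local {η σ r : ℝ} (hη : η ≤ 1 / 1000) (hσ0 : 0 ≤ σ) (hσ : σ ≤ η)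
    (hr : 0 < r) {Δ : ℝ} (hΔ : Δ ≤ η * r * (regSub F d).card)
    (hdeg : ∀ v, d / (r * (1 + σ)) ≤ deg F v ∧ (deg F v : ℝ) ≤ d / (r * (1 - σ)))
    (hd : 0 < d)
    (hloc : ∀ x y z, F.Adj x y → F.Adj x z →
      (((regSub F d).filter fun K => K.Adj x y).card : ℝ) ≤
        (1 + 10 * η) * ((regSub F d).filter fun K => K.Adj x z).card + Δ)
    {x y u w : Fin n} (hxy : F.Adj x y) (huw : F.Adj u w) :
    (((regSub F d).filter fun K => K.Adj x y).card : ℝ) ≤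
      (1 + 40 * η) * ((regSub F d).filter fun K => K.Adj u w).card := by
  set X : ℝ := ((regSub F d).card : ℝ) with hX
  have hη0 : 0 ≤ η := hσ0.trans hσ
  have hX0 : 0 ≤ X := by positivity
  have hd' : (0 : ℝ) < d := by exact_mod_cast hd
  have hs := fun v => (sum_card_adj (F := F) (d := d) v)
  have hs' : ∀ v, ∑ z ∈ Finset.univ.filter (fun z => F.Adj v z),
      (((regSub F d).filter fun K => K.Adj v z).card : ℝ) = d * X := fun v => by
    rw [hX]; exact_mod_cast hs v
  have hcard : ∀ v, ((Finset.univ.filter fun z => F.Adj v z).card : ℝ) = deg F v := fun v => by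
    rw [deg_eq_card]
  have up : (deg F x : ℝ) * ((regSub F d).filter fun K => K.Adj x y).card ≤
      (1 + 10 * η) * (d * X) + deg F x * Δ := by
    rw [← hs' x, Finset.mul_sum, ← hcard x, ← nsmul_eq_mul, ← nsmul_eq_mul, ← Finset.sum_const,
      ← Finset.sum_const, ← Finset.sum_add_distrib]
    refine Finset.sum_le_sum fun z hz => ?_
    exact hloc x y z hxy (Finset.mem_filter.1 hz).2
  have down : d * X ≤ deg F u * ((1 + 10 * η) *
      ((regSub F d).filter fun K => K.Adj u w).card + Δ) := by
    rw [← hs' u, ← hcard u, ← nsmul_eq_mul, ← Finset.sum_const]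
    refine Finset.sum_le_sum fun z hz => ?_
    exact hloc u z w (Finset.mem_filter.1 hz).2 huw
  obtain ⟨hx1, -⟩ := hdeg x
  obtain ⟨-, hu2⟩ := hdeg u
  set a : ℝ := (((regSub F d).filter fun K => K.Adj x y).card : ℝ)
  set b : ℝ := (((regSub F d).filter fun K => K.Adj u w).card : ℝ)
  have ha0 : 0 ≤ a := by positivity
  have hb0 : 0 ≤ b := by positivity
  have hdx : (0 : ℝ) < deg F x := lt_of_lt_of_le (by positivity) hx1
  have hσ1 : 0 < 1 - σ := by linarith
  -- upper bound
  have h1 : a ≤ (1 + 10 * η) * (r * (1 + σ)) * X + η * r * X := by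
    have e1 : d / (r * (1 + σ)) * (a - η * r * X) ≤ (1 + 10 * η) * (d * X) := by
      by_cases hneg : a - η * r * X ≤ 0
      · exact (mul_nonpos_of_nonneg_of_nonpos (by positivity) hneg).trans (by positivity)
      · push Not at hneg
        calc _ ≤ deg F x * (a - η * r * X) := by gcongr
          _ ≤ deg F x * a - deg F x * Δ := by
            rw [mul_sub]; gcongr
          _ ≤ _ := by linarith
    rw [div_mul_eq_mul_div, div_le_iff₀ (by positivity)] at e1
    have e2 : (d : ℝ) * (a - η * r * X) ≤ d * ((1 + 10 * η) * (r * (1 + σ)) * X) := by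
      calc _ ≤ _ := e1
        _ = _ := by ring
    linarith [le_of_mul_le_mul_left e2 hd']
  have h2 : r * (1 - σ) * X ≤ (1 + 10 * η) * b + η * r * X := by
    have e1 : d * X ≤ d / (r * (1 - σ)) * ((1 + 10 * η) * b + η * r * X) := by
      calc d * X ≤ deg F u * ((1 + 10 * η) * b + Δ) := down
        _ ≤ deg F u * ((1 + 10 * η) * b + η * r * X) := by gcongr
        _ ≤ _ := by gcongr
    rw [div_mul_eq_mul_div, le_div_iff₀ (by positivity)] at e1
    have e2 : (d : ℝ) * (r * (1 - σ) * X) ≤ d * ((1 + 10 * η) * b + η * r * X) := by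
      calc _ = d * X * (r * (1 - σ)) := by ring
        _ ≤ _ := e1
    exact le_of_mul_le_mul_left e2 hd'
  have hrX : 0 ≤ r * X := by positivity
  have h1' : a ≤ (1 + 13 * η) * (r * X) := by
    refine h1.trans ?_
    have : (1 + 10 * η) * (1 + σ) + η ≤ 1 + 13 * η := by nlinarith
    calc _ = ((1 + 10 * η) * (1 + σ) + η) * (r * X) := by ring
      _ ≤ _ := by gcongr
  have h2' : (1 - 2 * η) * (r * X) ≤ (1 + 10 * η) * b := by
    have : (1 - 2 * η) * (r * X) ≤ (1 - σ - η) * (r * X) :=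
      mul_le_mul_of_nonneg_right (by linarith) hrX
    linarith
  have h3 : (1 + 13 * η) * (1 + 10 * η) ≤ (1 + 40 * η) * (1 - 2 * η) := by nlinarith
  have h4 : (1 - 2 * η) * a ≤ (1 - 2 * η) * ((1 + 40 * η) * b) := by
    have hpos : 0 ≤ 1 - 2 * η := by linarith
    calc (1 - 2 * η) * a ≤ (1 - 2 * η) * ((1 + 13 * η) * (r * X)) := by gcongr
      _ = (1 + 13 * η) * ((1 - 2 * η) * (r * X)) := by ring
      _ ≤ (1 + 13 * η) * ((1 + 10 * η) * b) := by gcongr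
      _ = ((1 + 13 * η) * (1 + 10 * η)) * b := by ring
      _ ≤ ((1 + 40 * η) * (1 - 2 * η)) * b := by gcongr
      _ = _ := by ring
  exact le_of_mul_le_mul_left h4 (by linarith)

set_option maxHeartbeats 1000000 in
/-- If nearly all regular subgraphs mix with their complements, then all edges are nearly equally
likely to be covered by a regular subgraph. -/
theorem edge_ratio {D γ σ κ θ η α δ : ℝ} {b l : ℕ} {B : Finset (SimpleGraph (Fin n))}
    (hD0 : 0 < D) (hDn : D ≤ n) (hd : 0 < d)
    (hmix : ∀ K ∈ regSub F d, K ∉ B →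
      MixingPair (scaledAdj D (F \ K)) (scaledAdj (d : ℝ) K) γ σ κ θ)
    (hB : (B.card : ℝ) ≤ δ * (regSub F d).card) (hδ : 6 * n ^ 3 * δ ≤ η) (hδ0 : 0 ≤ δ)
    (hκ : 0 ≤ κ) (hκ1 : κ ≤ 1) (hσ0 : 0 ≤ σ) (hγ0 : 0 < γ)
    (hγ : γ ≤ 1) (hσ : σ ≤ γ / 4) (hη : η ≤ 1 / 1000) (hση : 2 * σ ≤ η)
    (hup : (1 + κ) ^ (2 * l) * ((1 + σ) / (1 - σ)) ≤ 1 + η)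
    (hdown : 1 - η ≤ (1 - κ) ^ (2 * l) * ((1 - σ) / (1 + σ)))
    (hr : (1 - γ / 2) ^ b * √n + 4 * σ / γ ≤ η)
    (hl : l = 3 * (2 * b + 1)) (hDα : D⁻¹ ≤ α) (hdα : (d : ℝ)⁻¹ ≤ α)
    (herr : 2 * (3 * (2 * l + 1) ^ 2 * (2 * θ) + 8 * α) ≤ η) (hσl : (1 + σ) ^ l ≤ n)
    {e f : Sym2 (Fin n)} (he : e ∈ F.edgeSet) (hf : f ∈ F.edgeSet) :
    (((regSub F d).filter fun K => e ∈ K.edgeSet).card : ℝ) ≤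
      (1 + 40 * η) * ((regSub F d).filter fun K => f ∈ K.edgeSet).card := by
  induction e using Sym2.ind with | _ x y
  induction f using Sym2.ind with | _ u w
  simp only [SimpleGraph.mem_edgeSet] at he hf ⊢
  have hη0 : 0 ≤ η := by linarith
  have hd' : (0 : ℝ) < d := by exact_mod_cast hd
  have hn : 0 < n := x.pos
  have hn1 : (1 : ℝ) ≤ n := by exact_mod_cast hn
  have : Nonempty (Fin n) := ⟨x⟩
  by_cases hgood : ∃ K ∈ regSub F d, K ∉ B
  swap
  · push Not at hgood
    have h1 : ((regSub F d).card : ℝ) ≤ B.card := by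
      exact_mod_cast Finset.card_le_card (fun K hK => hgood K hK)
    have h2 : δ ≤ 1 / 2 := by
      have : (1 : ℝ) ≤ (n : ℝ) ^ 3 := one_le_pow₀ hn1
      nlinarith
    have h3 : ((regSub F d).card : ℝ) = 0 := by
      have : (0 : ℝ) ≤ (regSub F d).card := by positivity
      nlinarith
    have h4 : regSub F d = ∅ := by
      rw [← Finset.card_eq_zero]; exact_mod_cast h3
    simp [h4]
  obtain ⟨K₀, hK₀, hK₀B⟩ := hgood
  have hM₀ := hmix K₀ hK₀ hK₀B
  have hdegE : ∀ K ∈ regSub F d, ∀ v,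
      ((1 - σ) * D ≤ (Finset.univ.filter fun u => (F \ K).Adj v u).card ∧
      ((Finset.univ.filter fun u => (F \ K).Adj v u).card : ℝ) ≤ (1 + σ) * D) := by
    intro K hK v
    have h1 : (Finset.univ.filter fun u => (F \ K).Adj v u).card =
        (Finset.univ.filter fun u => (F \ K₀).Adj v u).card := by
      have := card_adj_sdiff hK v
      have := card_adj_sdiff hK₀ v
      omega
    have h2 := hM₀.row_left v
    have e : (scaledAdj D (F \ K₀)).mulVec 1 v =
        (Finset.univ.filter fun u => (F \ K₀).Adj v u).card * D⁻¹ := by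
      convert scaledAdj_mulVec_one D (F \ K₀) v
    rw [e, ← div_eq_mul_inv, abs_le] at h2
    rw [h1, ← le_div_iff₀ hD0, ← div_le_iff₀ hD0]
    constructor <;> linarith
  have hdegF : ∀ v, (deg F v : ℝ) = (Finset.univ.filter fun u => (F \ K₀).Adj v u).card + d :=
    fun v => by rw [← card_adj_sdiff hK₀ v]; push_cast; rfl
  set Λ : ℝ := (D * d) ^ l / n with hΛ
  have hΛ0 : 0 < Λ := by positivity
  have hNeven : Even (2 * l + 2) := ⟨l + 1, by ring⟩
  set r : ℝ := d / (d + D) with hrdef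
  have hr0 : 0 < r := by positivity
  have hrn : 1 / (2 * n) ≤ r := by
    rw [hrdef, div_le_div_iff₀ (by positivity) (by positivity)]
    have : (1 : ℝ) ≤ d := by exact_mod_cast hd
    nlinarith
  refine edge_ratio_of_local (η := η) (σ := 2 * σ) (r := r)
    (Δ := 3 * n ^ 2 * δ * (regSub F d).card) hη (by linarith) hση hr0 ?_ ?_ hd ?_ he hf
  · have h1 : 3 * n ^ 2 * δ ≤ η * (1 / (2 * n)) := by
      rw [mul_one_div, le_div_iff₀ (by positivity)]
      linarith
    have h2 : 3 * n ^ 2 * δ ≤ η * r := h1.trans (by gcongr)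
    gcongr
  · intro v
    obtain ⟨h1, h2⟩ := hdegE K₀ hK₀ v
    rw [hdegF v]
    have e1 : d / (r * (1 + 2 * σ)) = (d + D) / (1 + 2 * σ) := by
      rw [hrdef]; field_simp
    have hpos : 0 < 1 - 2 * σ := by linarith
    have e2 : d / (r * (1 - 2 * σ)) = (d + D) / (1 - 2 * σ) := by
      rw [hrdef]; field_simp
    rw [e1, e2, div_le_iff₀ (by positivity), le_div_iff₀ hpos]
    constructor
    · have : D ≤ (1 - σ) * D * (1 + 2 * σ) := by
        have : 1 ≤ (1 - σ) * (1 + 2 * σ) := by nlinarith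
        nlinarith
      nlinarith
    · have : (1 + σ) * D * (1 - 2 * σ) ≤ D := by
        have : (1 + σ) * (1 - 2 * σ) ≤ 1 := by nlinarith
        nlinarith
      nlinarith
  · intro x y z hxy hxz
    by_cases hyz : y = z
    · subst hyz
      have h1 : (0 : ℝ) ≤ ((regSub F d).filter fun K => K.Adj x y).card := by positivity
      have h2 : 0 ≤ 3 * n ^ 2 * δ * ((regSub F d).card : ℝ) := by positivity
      linarith [mul_nonneg hη0 h1]
    have hpw := fun K (hK : K ∈ regSub F d) (hKB : K ∉ B) =>
      fun y z hyz => (hmix K hK hKB).path_weight hκ hκ1 hσ0 hγ0 hγ hσ (by linarith) hup hdown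
        (α := α) (b := b) (N := 2 * l) (by simpa using hr) (by rw [hl]; ring)
        (fun v => by simp [scaledAdj_apply]) (fun v => by simp [scaledAdj_apply])
        (fun u v => by rw [scaledAdj_apply]; split_ifs; exacts [hDα, (by positivity : (0 : ℝ) ≤ D⁻¹).trans hDα])
        (fun u v => by rw [scaledAdj_apply]; split_ifs; exacts [hdα, (by positivity : (0 : ℝ) ≤ D⁻¹).trans hDα])
        (by push_cast; exact herr) y z hyz
    have hmain := card_adj_le_of_sum (d := d) (N := 2 * l) hNeven hxz (y := y) (B := B)
      (lo := (1 - 4 * η) * Λ) (hi := (1 + 4 * η) * Λ) (top := n ^ 2 * Λ)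
      (mul_nonneg (by linarith) hΛ0.le) (by positivity) (by positivity) ?_ ?_ ?_
    · set a : ℝ := (((regSub F d).filter fun K => K.Adj x y ∧ ¬ K.Adj x z).card : ℝ)
      set a' : ℝ := (((regSub F d).filter fun K => K.Adj x z ∧ ¬ K.Adj x y).card : ℝ)
      set c : ℝ := (((regSub F d).filter fun K => K.Adj x y ∧ K.Adj x z).card : ℝ)
      have ha'0 : 0 ≤ a' := by positivity
      have hc0 : 0 ≤ c := by positivity
      have ea : (((regSub F d).filter fun K => K.Adj x y).card : ℝ) = c + a := by
        have := Finset.card_filter_add_card_filter_not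
          (s := (regSub F d).filter fun K => K.Adj x y) (fun K => K.Adj x z)
        rw [Finset.filter_filter, Finset.filter_filter] at this
        exact (congrArg (Nat.cast : ℕ → ℝ) this.symm).trans (Nat.cast_add _ _)
      have ea' : (((regSub F d).filter fun K => K.Adj x z).card : ℝ) = c + a' := by
        have := Finset.card_filter_add_card_filter_not
          (s := (regSub F d).filter fun K => K.Adj x z) (fun K => K.Adj x y)
        rw [Finset.filter_filter, Finset.filter_filter] at this
        have e : ((regSub F d).filter fun K => K.Adj x z ∧ K.Adj x y) =
          (regSub F d).filter fun K => K.Adj x y ∧ K.Adj x z := by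
            ext K; simp only [Finset.mem_filter]; tauto
        rw [e] at this
        exact (congrArg (Nat.cast : ℕ → ℝ) this.symm).trans (Nat.cast_add _ _)
      rw [ea, ea']
      have h1 : (1 - 4 * η) * a ≤ (1 + 4 * η) * a' + (1 + n ^ 2) * (δ * (regSub F d).card) := by
        have h0 : Λ * ((1 - 4 * η) * a) ≤
            Λ * ((1 + 4 * η) * a' + (1 + n ^ 2) * (δ * (regSub F d).card)) := by
          have h00 : ((1 - 4 * η) * Λ + n ^ 2 * Λ) * B.card ≤
              Λ * ((1 + n ^ 2) * (δ * (regSub F d).card)) := by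
            calc _ = Λ * ((1 - 4 * η + n ^ 2) * B.card) := by ring
              _ ≤ Λ * ((1 + n ^ 2) * (δ * (regSub F d).card)) := by gcongr; linarith
          calc _ = (1 - 4 * η) * Λ * a := by ring
            _ ≤ (1 + 4 * η) * Λ * a' + ((1 - 4 * η) * Λ + n ^ 2 * Λ) * B.card := hmain
            _ ≤ (1 + 4 * η) * Λ * a' + Λ * ((1 + n ^ 2) * (δ * (regSub F d).card)) := by gcongr
            _ = _ := by ring
        exact le_of_mul_le_mul_left h0 hΛ0
      have h2 : (1 - 4 * η) * a ≤ (1 - 4 * η) * ((1 + 10 * η) * a' +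
          3 * n ^ 2 * δ * (regSub F d).card) := by
        refine h1.trans ?_
        rw [mul_add]
        have h3 : (1 + 4 * η) * a' ≤ (1 - 4 * η) * ((1 + 10 * η) * a') := by
          rw [← mul_assoc]; gcongr; nlinarith
        have h4 : (1 + n ^ 2) * (δ * (regSub F d).card) ≤
            (1 - 4 * η) * (3 * n ^ 2 * δ * (regSub F d).card) := by
          have h5 : 1 + (n : ℝ) ^ 2 ≤ (1 - 4 * η) * (3 * n ^ 2) := by
            have : (1 : ℝ) ≤ (n : ℝ) ^ 2 := one_le_pow₀ hn1
            nlinarith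
          calc _ ≤ ((1 - 4 * η) * (3 * n ^ 2)) * (δ * (regSub F d).card) := by gcongr
            _ = _ := by ring
        linarith
      have h3 := le_of_mul_le_mul_left h2 (by linarith)
      linarith [mul_nonneg hη0 hc0]
    · intro K hK hKB h1 h2
      have hKF := (mem_regSub.1 hK).2
      have := (hpw K hK hKB y z hyz).2 x h1.ne hxz.ne
        (by rw [scaledAdj_apply, if_neg]; exact fun h => h.2 h1.symm)
        (by rw [scaledAdj_apply, if_neg h2])
      rw [card_altPaths (F \ K) K hD0 hd' l x y z]
      calc (1 - 4 * η) * Λ = (D * d) ^ l * ((1 - 4 * η) / Fintype.card (Fin n)) := by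
            rw [hΛ, Fintype.card_fin]; ring
        _ ≤ _ := by gcongr
    · intro K hK hKB
      have := (hpw K hK hKB z y (Ne.symm hyz)).1
      rw [card_altPaths (F \ K) K hD0 hd' l x z y]
      calc _ ≤ (D * d) ^ l * ((1 + 4 * η) / Fintype.card (Fin n)) := by
            gcongr
            refine le_trans (Finset.sum_le_sum fun p _ => ?_) this
            have hw : 0 ≤ walkWeight (alternating (scaledAdj D (F \ K)) (scaledAdj (d : ℝ) K))
                (2 * l) p := walkWeight_nonneg (hmix K hK hKB).alternating_nonneg _ _
            split_ifs <;> simp_all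
        _ = (1 + 4 * η) * Λ := by rw [hΛ, Fintype.card_fin]; ring
    · intro K hK
      have h1 := card_altPaths_le (F \ K) K (a := ⌊(1 + σ) * D⌋₊) (d := d) l x z y
        (fun v => by convert Nat.le_floor (hdegE K hK v).2)
        (fun v => by rw [← deg_eq_card, (mem_regSub.1 hK).1 v])
      calc ((altPaths (F \ K) K (2 * l) x z y).card : ℝ) ≤ (⌊(1 + σ) * D⌋₊ * d) ^ l := by
            exact_mod_cast h1
        _ ≤ ((1 + σ) * D * d) ^ l := by
            gcongr
            exact Nat.floor_le (by positivity)
        _ = (1 + σ) ^ l * (D * d) ^ l := by rw [mul_assoc, mul_pow]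
        _ ≤ n * (D * d) ^ l := by gcongr
        _ = n ^ 2 * Λ := by rw [hΛ]; field_simp

end Ratio

section RandomSubsets

/-- The mode of a binomial distribution. -/
lemma pow_self_le_choose {N m : ℕ} (hm : m ≤ N) :
    N ^ N ≤ (N + 1) * (N.choose m * m ^ m * (N - m) ^ (N - m)) := by
  set f : ℕ → ℕ := fun k => m ^ k * (N - m) ^ (N - k) * N.choose k with hf
  have hrec : ∀ k, k < N → f (k + 1) * ((k + 1) * (N - m)) = f k * ((N - k) * m) := by
    intro k hk
    have h1 := Nat.choose_succ_right_eq N k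
    have h2 : (N - m) ^ (N - k) = (N - m) ^ (N - (k + 1)) * (N - m) := by
      rw [← pow_succ]; congr 1; omega
    simp only [hf]
    calc _ = m ^ k * m * ((N - m) ^ (N - (k + 1)) * (N - m)) * (N.choose (k + 1) * (k + 1)) := by
          ring
      _ = m ^ k * m * (N - m) ^ (N - k) * (N.choose k * (N - k)) := by
          rw [h1, h2]
      _ = _ := by ring
  have hup : ∀ k, k < m → f k ≤ f (k + 1) := by
    intro k hk
    rcases Nat.eq_or_lt_of_le hm with h | h
    · have : f k = 0 := by
        simp only [hf]
        rw [h, Nat.sub_self, zero_pow (by omega)]; simp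
      omega
    · have := hrec k (by omega)
      have h3 : (k + 1) * (N - m) ≤ (N - k) * m := by
        zify [hm, (by omega : k ≤ N)]
        have h1 : (k : ℤ) + 1 ≤ m := by exact_mod_cast hk
        have h2 : (m : ℤ) ≤ N := by exact_mod_cast hm
        nlinarith
      have hpos : 0 < (k + 1) * (N - m) := Nat.mul_pos (by omega) (by omega)
      refine Nat.le_of_mul_le_mul_right ?_ hpos
      rw [this]
      exact Nat.mul_le_mul_left _ h3
  have hdown : ∀ k, m ≤ k → k < N → f (k + 1) ≤ f k := by
    intro k hk hkN
    have := hrec k hkN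
    have h3 : (N - k) * m ≤ (k + 1) * (N - m) := by
      zify [hm, hkN.le]
      have h1 : (m : ℤ) ≤ k := by exact_mod_cast hk
      have h2 : (m : ℤ) ≤ N := by exact_mod_cast hm
      nlinarith
    have hpos : 0 < (k + 1) * (N - m) := Nat.mul_pos (by omega) (by omega)
    refine Nat.le_of_mul_le_mul_right ?_ hpos
    rw [this]
    exact Nat.mul_le_mul_left _ h3
  have hle : ∀ k, k ≤ N → f k ≤ f m := by
    intro k hk
    rcases le_total k m with h | h
    · refine Nat.le_induction (P := fun j _ => j ≤ m → f k ≤ f j) (fun _ => le_rfl) ?_ m h le_rfl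
      intro j _ ih hj
      exact (ih (by omega)).trans (hup j (by omega))
    · refine Nat.le_induction (P := fun j _ => j ≤ N → f j ≤ f m) (fun _ => le_rfl) ?_ k h hk
      intro j hj ih hjN
      exact (hdown j hj (by omega)).trans (ih (by omega))
  have hsum : ∑ k ∈ Finset.range (N + 1), f k = N ^ N := by
    have := add_pow m (N - m) N
    rw [Nat.add_sub_cancel' hm] at this
    rw [this]; simp [hf]
  rw [← hsum]
  refine (Finset.sum_le_card_nsmul _ _ (f m) fun k hk => hle k (by
    rw [Finset.mem_range] at hk; omega)).trans ?_
  rw [Finset.card_range, smul_eq_mul]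
  exact Nat.mul_le_mul_left _ (le_of_eq (by simp only [hf]; ring))

variable {α : Type*}

/-- The probability that the binomial random subset of `R` with density `p` is `E`. -/
def binWeight (p : ℝ) (R E : Finset α) : ℝ := p ^ E.card * (1 - p) ^ (R \ E).card

lemma binWeight_nonneg {p : ℝ} (hp0 : 0 ≤ p) (hp1 : p ≤ 1) (R E : Finset α) :
    0 ≤ binWeight p R E := mul_nonneg (pow_nonneg hp0 _) (pow_nonneg (by linarith) _)

/-- The probability of an event for the binomial random subset of `R`. -/
def binPr (p : ℝ) (R : Finset α) (A : Finset α → Prop) : ℝ :=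
  ∑ E ∈ R.powerset, binWeight p R E * if A E then 1 else 0

lemma sum_binWeight_mul_prod (p : ℝ) (R : Finset α) (z : α → ℝ) :
    ∑ E ∈ R.powerset, binWeight p R E * ∏ e ∈ E, z e = ∏ e ∈ R, (p * z e + (1 - p)) := by
  rw [Finset.prod_add]
  refine Finset.sum_congr rfl fun E _ => ?_
  rw [Finset.prod_mul_distrib, Finset.prod_const, Finset.prod_const, binWeight]
  ring

lemma sum_binWeight (p : ℝ) (R : Finset α) : ∑ E ∈ R.powerset, binWeight p R E = 1 := by
  have := sum_binWeight_mul_prod p R fun _ => 1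
  simpa using this

lemma binPr_mono {p : ℝ} (hp0 : 0 ≤ p) (hp1 : p ≤ 1) (R : Finset α) {A A' : Finset α → Prop}
    (h : ∀ E ⊆ R, A E → A' E) : binPr p R A ≤ binPr p R A' := by
  refine Finset.sum_le_sum fun E hE => mul_le_mul_of_nonneg_left ?_ (binWeight_nonneg hp0 hp1 _ _)
  have := h E (Finset.mem_powerset.1 hE)
  split_ifs <;> simp_all

lemma binPr_or_le {p : ℝ} (hp0 : 0 ≤ p) (hp1 : p ≤ 1) (R : Finset α) (A A' : Finset α → Prop) :
    binPr p R (fun E => A E ∨ A' E) ≤ binPr p R A + binPr p R A' := by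
  rw [binPr, binPr, binPr, ← Finset.sum_add_distrib]
  refine Finset.sum_le_sum fun E hE => ?_
  rw [← mul_add]
  refine mul_le_mul_of_nonneg_left ?_ (binWeight_nonneg hp0 hp1 _ _)
  split_ifs <;> simp_all

lemma binPr_exists_le {ι : Type*} {p : ℝ} (hp0 : 0 ≤ p) (hp1 : p ≤ 1) (R : Finset α)
    (I : Finset ι) (A : ι → Finset α → Prop) :
    binPr p R (fun E => ∃ i ∈ I, A i E) ≤ ∑ i ∈ I, binPr p R (A i) := by
  induction I using Finset.induction_on with
  | empty => simp [binPr]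
  | insert i I hi ih =>
    rw [Finset.sum_insert hi]
    refine le_trans ?_ ((binPr_or_le hp0 hp1 R (A i) fun E => ∃ i ∈ I, A i E).trans (by gcongr))
    exact binPr_mono hp0 hp1 R fun E _ h => by simpa using h

/-- Uniform random `m`-subsets are dominated by binomial random subsets. -/
lemma card_powersetCard_filter_le {m : ℕ} (R : Finset α) (hm : m ≤ R.card)
    (A : Finset α → Prop) :
    (((R.powersetCard m).filter A).card : ℝ) ≤
      (R.card + 1) * (R.card.choose m : ℝ) * binPr ((m : ℝ) / R.card) R A := by
  rcases Nat.eq_zero_or_pos R.card with h0 | hN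
  · have hm0 : m = 0 := by omega
    have hR : R = ∅ := Finset.card_eq_zero.1 h0
    subst hm0 hR
    by_cases hA : A ∅ <;> simp [binPr, binWeight, hA, Finset.filter_singleton]
  set N := R.card with hNdef
  set p : ℝ := (m : ℝ) / N with hp
  have hN' : (0 : ℝ) < N := by exact_mod_cast hN
  have hmN : (m : ℝ) ≤ N := by exact_mod_cast hm
  have hp0 : 0 ≤ p := by positivity
  have hp1 : p ≤ 1 := by rw [hp, div_le_one hN']; exact hmN
  have hmode : 1 ≤ (N + 1) * (N.choose m : ℝ) * (p ^ m * (1 - p) ^ (N - m)) := by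
    have h1 := pow_self_le_choose hm
    have h2 : (N : ℝ) ^ N ≤ (N + 1) * (N.choose m * m ^ m * (N - m) ^ (N - m)) := by
      rw [← Nat.cast_sub hm]; exact_mod_cast h1
    have h3 : p ^ m * (1 - p) ^ (N - m) * N ^ N = m ^ m * (N - m) ^ (N - m) := by
      have e1 : 1 - p = (N - m) / N := by rw [hp]; field_simp
      have e2 : (N : ℝ) ^ N = N ^ m * N ^ (N - m) := by rw [← pow_add, Nat.add_sub_cancel' hm]
      rw [e1, e2, hp, div_pow, div_pow]
      field_simp
    have h4 : (N : ℝ) ^ N * 1 ≤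
        N ^ N * ((N + 1) * (N.choose m : ℝ) * (p ^ m * (1 - p) ^ (N - m))) := by
      calc _ = (N : ℝ) ^ N := mul_one _
        _ ≤ _ := h2
        _ = (N + 1) * N.choose m * (m ^ m * (N - m) ^ (N - m)) := by ring
        _ = _ := by rw [← h3]; ring
    exact le_of_mul_le_mul_left h4 (by positivity)
  have hlow : (((R.powersetCard m).filter A).card : ℝ) * (p ^ m * (1 - p) ^ (N - m)) ≤
      binPr p R A := by
    rw [binPr, ← nsmul_eq_mul, ← Finset.sum_const]
    calc _ = ∑ E ∈ (R.powersetCard m).filter A, binWeight p R E * if A E then 1 else 0 := by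
          refine Finset.sum_congr rfl fun E hE => ?_
          obtain ⟨h1, h2⟩ := Finset.mem_filter.1 hE
          obtain ⟨h3, h4⟩ := Finset.mem_powersetCard.1 h1
          rw [if_pos h2, binWeight, Finset.card_sdiff_of_subset h3, h4, mul_one]
      _ ≤ _ := by
          refine Finset.sum_le_sum_of_subset_of_nonneg ?_ ?_
          · intro E hE
            exact Finset.mem_powerset.2
              (Finset.mem_powersetCard.1 (Finset.mem_filter.1 hE).1).1
          · intro E _ _
            exact mul_nonneg (binWeight_nonneg hp0 hp1 _ _) (by split_ifs <;> norm_num)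
  calc (((R.powersetCard m).filter A).card : ℝ) = ((R.powersetCard m).filter A).card * 1 :=
        (mul_one _).symm
    _ ≤ ((R.powersetCard m).filter A).card *
        ((N + 1) * (N.choose m : ℝ) * (p ^ m * (1 - p) ^ (N - m))) := by gcongr
    _ = (N + 1) * (N.choose m : ℝ) *
        (((R.powersetCard m).filter A).card * (p ^ m * (1 - p) ^ (N - m))) := by ring
    _ ≤ _ := by gcongr

/-- The exponential moment bound. -/
lemma binPr_le_of_prod {p : ℝ} (hp0 : 0 ≤ p) (hp1 : p ≤ 1) (R : Finset α)
    {A : Finset α → Prop} {z : α → ℝ} (hz : ∀ e, 0 ≤ z e) {c : ℝ} (hc : 0 ≤ c)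
    (h : ∀ E ⊆ R, A E → 1 ≤ c * ∏ e ∈ E, z e) :
    binPr p R A ≤ c * Real.exp (p * ∑ e ∈ R, (z e - 1)) := by
  calc binPr p R A ≤ ∑ E ∈ R.powerset, c * (binWeight p R E * ∏ e ∈ E, z e) := by
        refine Finset.sum_le_sum fun E hE => ?_
        have hw := binWeight_nonneg hp0 hp1 R E
        have hpr : 0 ≤ ∏ e ∈ E, z e := Finset.prod_nonneg fun e _ => hz e
        split_ifs with hA
        · have := h E (Finset.mem_powerset.1 hE) hA
          nlinarith
        · rw [mul_zero]; positivity
    _ = c * ∏ e ∈ R, (p * z e + (1 - p)) := by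
        rw [← Finset.mul_sum, sum_binWeight_mul_prod]
    _ ≤ c * Real.exp (p * ∑ e ∈ R, (z e - 1)) := by
        rw [Finset.mul_sum, Real.exp_sum]
        refine mul_le_mul_of_nonneg_left (Finset.prod_le_prod (fun e _ => ?_) fun e _ => ?_) hc
        · have := mul_nonneg hp0 (hz e); linarith
        · have := Real.add_one_le_exp (p * (z e - 1)); linarith

lemma exp_sub_one_le {x : ℝ} (hx : |x| ≤ 1) : Real.exp x - 1 ≤ x + x ^ 2 := by
  have := abs_le.1 (Real.abs_exp_sub_one_sub_id_le hx)
  linarith [this.2]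

/-- A one-sided tail bound for linear statistics. -/
lemma binPr_upper_tail {p : ℝ} (hp0 : 0 ≤ p) (hp1 : p ≤ 1) (R : Finset α)
    {W : α → ℝ} {l s Q : ℝ} (hW : ∀ e, |l * W e| ≤ 1) (hQ : p * ∑ e ∈ R, W e ^ 2 ≤ Q)
    (hl : 0 ≤ l) :
    binPr p R (fun E => p * ∑ e ∈ R, W e + s ≤ ∑ e ∈ E, W e) ≤
      Real.exp (-(l * s) + l ^ 2 * Q) := by
  refine (binPr_le_of_prod hp0 hp1 R (z := fun e => Real.exp (l * W e))
    (c := Real.exp (-(l * (p * ∑ e ∈ R, W e + s)))) (fun e => (Real.exp_pos _).le)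
    (Real.exp_pos _).le ?_).trans ?_
  · intro E _ hE
    rw [← Real.exp_sum, ← Real.exp_add, ← Finset.mul_sum]
    refine Real.one_le_exp ?_
    have := mul_le_mul_of_nonneg_left hE hl
    linarith
  · rw [← Real.exp_add]
    refine Real.exp_le_exp.2 ?_
    have h1 : ∑ e ∈ R, (Real.exp (l * W e) - 1) ≤ ∑ e ∈ R, (l * W e + (l * W e) ^ 2) :=
      Finset.sum_le_sum fun e _ => exp_sub_one_le (hW e)
    have h2 : ∑ e ∈ R, (l * W e + (l * W e) ^ 2) =
        l * ∑ e ∈ R, W e + l ^ 2 * ∑ e ∈ R, W e ^ 2 := by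
      rw [Finset.sum_add_distrib, Finset.mul_sum, Finset.mul_sum]
      congr 1
      exact Finset.sum_congr rfl fun e _ => by ring
    have h3 := mul_le_mul_of_nonneg_left (h1.trans h2.le) hp0
    have h4 := mul_le_mul_of_nonneg_left hQ (sq_nonneg l)
    nlinarith

/-- A two-sided tail bound for linear statistics. -/
lemma binPr_tail {p : ℝ} (hp0 : 0 ≤ p) (hp1 : p ≤ 1) (R : Finset α)
    {W : α → ℝ} {l s Q : ℝ} (hW : ∀ e, |l * W e| ≤ 1) (hQ : p * ∑ e ∈ R, W e ^ 2 ≤ Q)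
    (hl : 0 ≤ l) :
    binPr p R (fun E => s ≤ |∑ e ∈ E, W e - p * ∑ e ∈ R, W e|) ≤
      2 * Real.exp (-(l * s) + l ^ 2 * Q) := by
  have h1 := binPr_upper_tail hp0 hp1 R (s := s) hW hQ hl
  have h2 := binPr_upper_tail hp0 hp1 R (W := fun e => - W e) (s := s) (l := l) (Q := Q)
    (fun e => by simpa using hW e) (by simpa using hQ) hl
  refine le_trans (binPr_mono hp0 hp1 R ?_) ((binPr_or_le hp0 hp1 R _ _).trans
    ((add_le_add h1 h2).trans (le_of_eq (two_mul _).symm)))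
  intro E _ h
  simp only [Finset.sum_neg_distrib]
  rcases le_abs.1 h with h | h
  · left; linarith
  · right; linarith

/-- Conditioning on the part of the random set inside `R₁`. -/
lemma binPr_split_le {p : ℝ} (hp0 : 0 ≤ p) (hp1 : p ≤ 1) {R₁ R₂ : Finset α}
    (hR : Disjoint R₁ R₂) {A : Finset α → Finset α → Prop} {c : ℝ}
    (h : ∀ E₁ ⊆ R₁, binPr p R₂ (A E₁) ≤ c) :
    binPr p (R₁ ∪ R₂) (fun E => A (E ∩ R₁) (E ∩ R₂)) ≤ c := by
  have key : binPr p (R₁ ∪ R₂) (fun E => A (E ∩ R₁) (E ∩ R₂)) =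
      ∑ E₁ ∈ R₁.powerset, binWeight p R₁ E₁ * binPr p R₂ (A E₁) := by
    simp only [binPr, Finset.mul_sum]
    rw [← Finset.sum_product']
    refine Finset.sum_nbij' (fun E => (E ∩ R₁, E ∩ R₂)) (fun w => w.1 ∪ w.2) ?_ ?_ ?_ ?_ ?_
    · intro E _; simp
    · intro w hw
      rw [Finset.mem_product, Finset.mem_powerset, Finset.mem_powerset] at hw
      exact Finset.mem_powerset.2 (Finset.union_subset_union hw.1 hw.2)
    · intro E hE
      rw [← Finset.inter_union_distrib_left]
      exact Finset.inter_eq_left.2 (Finset.mem_powerset.1 hE)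
    · intro w hw
      rw [Finset.mem_product, Finset.mem_powerset, Finset.mem_powerset] at hw
      have d1 : w.2 ∩ R₁ = ∅ := Finset.disjoint_iff_inter_eq_empty.1 (hR.symm.mono_left hw.2)
      have d2 : w.1 ∩ R₂ = ∅ := Finset.disjoint_iff_inter_eq_empty.1 (hR.mono_left hw.1)
      ext1
      · simp only
        rw [Finset.union_inter_distrib_right, d1, Finset.union_empty,
          Finset.inter_eq_left.2 hw.1]
      · simp only
        rw [Finset.union_inter_distrib_right, d2, Finset.empty_union,
          Finset.inter_eq_left.2 hw.2]
    · intro E hE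
      have hE' := Finset.mem_powerset.1 hE
      have c1 : E.card = (E ∩ R₁).card + (E ∩ R₂).card := by
        rw [← Finset.card_union_of_disjoint (hR.mono Finset.inter_subset_right
          Finset.inter_subset_right), ← Finset.inter_union_distrib_left,
          Finset.inter_eq_left.2 hE']
      have c2 : ((R₁ ∪ R₂) \ E).card = (R₁ \ (E ∩ R₁)).card + (R₂ \ (E ∩ R₂)).card := by
        rw [Finset.union_sdiff_distrib, Finset.card_union_of_disjoint
          (hR.mono Finset.sdiff_subset Finset.sdiff_subset), Finset.sdiff_inter_self_right,
          Finset.sdiff_inter_self_right]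
      simp only [binWeight]
      rw [c1, c2, pow_add, pow_add]
      ring
  rw [key]
  calc _ ≤ ∑ E₁ ∈ R₁.powerset, binWeight p R₁ E₁ * c :=
        Finset.sum_le_sum fun E₁ hE => mul_le_mul_of_nonneg_left
          (h E₁ (Finset.mem_powerset.1 hE)) (binWeight_nonneg hp0 hp1 _ _)
    _ = c := by rw [← Finset.sum_mul, sum_binWeight, one_mul]

end RandomSubsets

section Discrepancy

/-- The `i`-th binary digit of a natural number, as a real number. -/
def binDigit (i u : ℕ) : ℝ := ((u / 2 ^ i % 2 : ℕ) : ℝ)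

lemma binDigit_eq (i u : ℕ) : binDigit i u = if u / 2 ^ i % 2 = 1 then 1 else 0 := by
  unfold binDigit
  rcases Nat.mod_two_eq_zero_or_one (u / 2 ^ i) with h | h <;> simp [h]

lemma binDigit_nonneg (i u : ℕ) : 0 ≤ binDigit i u := Nat.cast_nonneg _

lemma binDigit_le_one (i u : ℕ) : binDigit i u ≤ 1 := by
  rw [binDigit_eq]; split_ifs <;> norm_num

lemma binDigit_sq (i u : ℕ) : binDigit i u ^ 2 = binDigit i u := by
  rw [binDigit_eq]; split_ifs <;> norm_num

lemma sum_binDigit {L u : ℕ} (hu : u < 2 ^ L) :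
    (u : ℝ) = ∑ i ∈ Finset.range L, 2 ^ i * binDigit i u := by
  have h : ∀ L, u % 2 ^ L = ∑ i ∈ Finset.range L, 2 ^ i * (u / 2 ^ i % 2) := by
    intro L
    induction L with
    | zero => simp [Nat.mod_one]
    | succ L ih => rw [Finset.sum_range_succ, Nat.mod_pow_succ, ih]
  have h1 := h L
  rw [Nat.mod_eq_of_lt hu] at h1
  conv_lhs => rw [h1]
  push_cast [binDigit]
  rfl

variable {V : Type*} [Fintype V] [DecidableEq V]

lemma sum_four_pow_binDigit_le {L : ℕ} {u : V → ℕ} (hu : ∀ v, u v < 2 ^ L) :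
    ∑ i ∈ Finset.range L, 4 ^ i * ∑ v, binDigit i (u v) ≤ ∑ v, (u v : ℝ) ^ 2 := by
  simp only [Finset.mul_sum]
  rw [Finset.sum_comm]
  refine Finset.sum_le_sum fun v _ => ?_
  calc ∑ i ∈ Finset.range L, 4 ^ i * binDigit i (u v)
      = ∑ i ∈ Finset.range L, (2 ^ i * binDigit i (u v)) * (2 ^ i * binDigit i (u v)) := by
        refine Finset.sum_congr rfl fun i _ => ?_
        have h := binDigit_sq i (u v)
        rw [show (4 : ℝ) = 2 * 2 by norm_num, mul_pow]
        linear_combination (-(2 : ℝ) ^ i * 2 ^ i) * h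
    _ ≤ ∑ i ∈ Finset.range L, (2 ^ i * binDigit i (u v)) * (u v : ℝ) := by
        refine Finset.sum_le_sum fun i hi => mul_le_mul_of_nonneg_left ?_
          (mul_nonneg (by positivity) (binDigit_nonneg _ _))
        rw [sum_binDigit (hu v)]
        exact Finset.single_le_sum (f := fun i => 2 ^ i * binDigit i (u v))
          (fun i _ => mul_nonneg (by positivity) (binDigit_nonneg _ _)) hi
    _ = (u v : ℝ) ^ 2 := by rw [← Finset.sum_mul, ← sum_binDigit (hu v), sq]

lemma sum_two_pow_far (r i L : ℕ) :
    ∑ j ∈ (Finset.range L).filter (fun j => j + r < i), (2 : ℝ) ^ j ≤ 2 ^ i / 2 ^ r := by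
  rcases le_or_gt r i with h | h
  · calc _ ≤ ∑ j ∈ Finset.range (i - r), (2 : ℝ) ^ j := by
          refine Finset.sum_le_sum_of_subset_of_nonneg ?_ fun _ _ _ => by positivity
          intro j hj
          rw [Finset.mem_filter] at hj
          rw [Finset.mem_range]; omega
      _ ≤ 2 ^ (i - r) := by
          have := Nat.geomSum_eq (le_refl 2) (i - r)
          have h2 : ∑ j ∈ Finset.range (i - r), 2 ^ j ≤ 2 ^ (i - r) := by
            rw [this]; simp
          exact_mod_cast h2
      _ = _ := by rw [pow_sub₀ _ (by norm_num) h, div_eq_mul_inv]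
  · rw [Finset.filter_false_of_mem (fun j _ => by omega), Finset.sum_empty]
    positivity

/-- The contribution of pairs of digits far apart. -/
lemma sum_far_le {M : V → V → ℝ} (hM0 : ∀ x y, 0 ≤ M x y) {c : ℝ} (hrow : ∀ x, ∑ y, M x y ≤ c)
    (u w : V → ℕ) (r L : ℕ) :
    ∑ i ∈ Finset.range L, ∑ j ∈ (Finset.range L).filter (fun j => j + r < i),
      2 ^ i * 2 ^ j * ∑ x, ∑ y, M x y * (binDigit i (u x) * binDigit j (w y)) ≤
    c / 2 ^ r * ∑ i ∈ Finset.range L, 4 ^ i * ∑ v, binDigit i (u v) := by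
  rw [Finset.mul_sum]
  refine Finset.sum_le_sum fun i _ => ?_
  have h1 : ∀ j, ∑ x, ∑ y, M x y * (binDigit i (u x) * binDigit j (w y)) ≤
      c * ∑ x, binDigit i (u x) := by
    intro j
    rw [Finset.mul_sum]
    refine Finset.sum_le_sum fun x _ => ?_
    calc _ ≤ ∑ y, M x y * binDigit i (u x) := by
          refine Finset.sum_le_sum fun y _ => mul_le_mul_of_nonneg_left ?_ (hM0 x y)
          exact mul_le_of_le_one_right (binDigit_nonneg _ _) (binDigit_le_one _ _)
      _ = (∑ y, M x y) * binDigit i (u x) := by rw [Finset.sum_mul]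
      _ ≤ _ := mul_le_mul_of_nonneg_right (hrow x) (binDigit_nonneg _ _)
  have h0 : 0 ≤ c * ∑ x, binDigit i (u x) := le_trans (Finset.sum_nonneg fun x _ =>
    Finset.sum_nonneg fun y _ => mul_nonneg (hM0 x y)
      (mul_nonneg (binDigit_nonneg _ _) (binDigit_nonneg _ _))) (h1 0)
  have hs : c / 2 ^ r * (4 ^ i * ∑ v, binDigit i (u v)) =
      2 ^ i * (c * ∑ x, binDigit i (u x)) * (2 ^ i / 2 ^ r) := by
    rw [show (4 : ℝ) = 2 * 2 by norm_num, mul_pow]; ring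
  rw [hs]
  generalize c * ∑ x, binDigit i (u x) = t at h0 h1
  calc _ ≤ ∑ j ∈ (Finset.range L).filter (fun j => j + r < i),
        2 ^ i * 2 ^ j * t :=
        Finset.sum_le_sum fun j _ => mul_le_mul_of_nonneg_left (h1 j) (by positivity)
    _ = 2 ^ i * t *
        ∑ j ∈ (Finset.range L).filter (fun j => j + r < i), 2 ^ j := by
        rw [Finset.mul_sum]; exact Finset.sum_congr rfl fun j _ => by ring
    _ ≤ 2 ^ i * t * (2 ^ i / 2 ^ r) :=
        mul_le_mul_of_nonneg_left (sum_two_pow_far r i L) (by positivity)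

lemma sum_near_le {ρ : ℝ} (hρ : 0 ≤ ρ) {a : ℕ → ℝ} (ha : ∀ i, 0 ≤ a i) (r L : ℕ) :
    ∑ i ∈ Finset.range L, ∑ _j ∈ (Finset.range L).filter (fun j => ¬ j + r < i ∧ ¬ i + r < j),
      ρ * a i ≤ (2 * r + 1) * ρ * ∑ i ∈ Finset.range L, a i := by
  rw [Finset.mul_sum]
  refine Finset.sum_le_sum fun i _ => ?_
  rw [Finset.sum_const, nsmul_eq_mul, mul_assoc]
  refine mul_le_mul_of_nonneg_right ?_ (mul_nonneg hρ (ha i))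
  have : ((Finset.range L).filter (fun j => ¬ j + r < i ∧ ¬ i + r < j)).card ≤ 2 * r + 1 := by
    calc _ ≤ (Finset.Icc (i - r) (i + r)).card := by
          refine Finset.card_le_card fun j hj => ?_
          rw [Finset.mem_filter] at hj
          rw [Finset.mem_Icc]; omega
      _ ≤ 2 * r + 1 := by rw [Nat.card_Icc]; omega
  exact_mod_cast this

/-- A matrix with small discrepancy has a small bilinear form on nonnegative integer vectors. -/
lemma abs_bilin_nat_le {M : V → V → ℝ} (hM : ∀ x y, M x y = M y x) {ρ c : ℝ} (hρ : 0 ≤ ρ)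
    (hdisc : ∀ S T : Finset V, |∑ x ∈ S, ∑ y ∈ T, M x y| ≤ ρ * √(S.card * T.card))
    (hrow : ∀ x, ∑ y, |M x y| ≤ c) (r : ℕ) (u w : V → ℕ) :
    |∑ x, ∑ y, M x y * ((u x : ℝ) * w y)| ≤
      ((2 * r + 1) * ρ + c / 2 ^ r) * (∑ v, (u v : ℝ) ^ 2 + ∑ v, (w v : ℝ) ^ 2) := by
  obtain ⟨L, hu, hw⟩ : ∃ L, (∀ v, u v < 2 ^ L) ∧ ∀ v, w v < 2 ^ L := by
    refine ⟨∑ v, (u v + w v), fun v => ?_, fun v => ?_⟩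
    · have := Finset.single_le_sum (f := fun v => u v + w v) (fun _ _ => Nat.zero_le _)
        (Finset.mem_univ v)
      exact (lt_of_le_of_lt (by omega) Nat.lt_two_pow_self)
    · have := Finset.single_le_sum (f := fun v => u v + w v) (fun _ _ => Nat.zero_le _)
        (Finset.mem_univ v)
      exact (lt_of_le_of_lt (by omega) Nat.lt_two_pow_self)
  set m : ℕ → ℕ → ℝ := fun i j => ∑ x, ∑ y, M x y * (binDigit i (u x) * binDigit j (w y)) with hm
  set q : ℕ → ℕ → ℝ := fun i j => ∑ x, ∑ y, |M x y| * (binDigit i (u x) * binDigit j (w y))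
    with hq
  set a : ℕ → ℝ := fun i => ∑ v, binDigit i (u v) with ha
  set b : ℕ → ℝ := fun i => ∑ v, binDigit i (w v) with hb
  have ha0 : ∀ i, 0 ≤ a i := fun i => Finset.sum_nonneg fun v _ => binDigit_nonneg _ _
  have hb0 : ∀ i, 0 ≤ b i := fun i => Finset.sum_nonneg fun v _ => binDigit_nonneg _ _
  have hexp : ∑ x, ∑ y, M x y * ((u x : ℝ) * w y) =
      ∑ i ∈ Finset.range L, ∑ j ∈ Finset.range L, 2 ^ i * 2 ^ j * m i j := by
    have e1 : ∀ x y, M x y * ((u x : ℝ) * w y) = ∑ i ∈ Finset.range L, ∑ j ∈ Finset.range L,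
        2 ^ i * 2 ^ j * (M x y * (binDigit i (u x) * binDigit j (w y))) := by
      intro x y
      rw [sum_binDigit (hu x), sum_binDigit (hw y), Finset.sum_mul_sum, Finset.mul_sum]
      refine Finset.sum_congr rfl fun i _ => ?_
      rw [Finset.mul_sum]
      exact Finset.sum_congr rfl fun j _ => by ring
    simp only [e1, hm, Finset.mul_sum]
    calc _ = ∑ x, ∑ i ∈ Finset.range L, ∑ j ∈ Finset.range L, ∑ y,
          2 ^ i * 2 ^ j * (M x y * (binDigit i (u x) * binDigit j (w y))) := by
          refine Finset.sum_congr rfl fun x _ => ?_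
          rw [Finset.sum_comm]
          exact Finset.sum_congr rfl fun i _ => Finset.sum_comm
      _ = _ := by
          rw [Finset.sum_comm]
          exact Finset.sum_congr rfl fun i _ => Finset.sum_comm
  have hmq : ∀ i j, |m i j| ≤ q i j := by
    intro i j
    refine (Finset.abs_sum_le_sum_abs _ _).trans (Finset.sum_le_sum fun x _ =>
      (Finset.abs_sum_le_sum_abs _ _).trans (Finset.sum_le_sum fun y _ => ?_))
    rw [abs_mul, abs_of_nonneg (mul_nonneg (binDigit_nonneg _ _) (binDigit_nonneg _ _))]
  have hmd : ∀ i j, |m i j| ≤ ρ * √(a i * b j) := by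
    intro i j
    have e1 : m i j = ∑ x ∈ Finset.univ.filter (fun x => u x / 2 ^ i % 2 = 1),
        ∑ y ∈ Finset.univ.filter (fun y => w y / 2 ^ j % 2 = 1), M x y := by
      simp only [hm, binDigit_eq]
      rw [Finset.sum_filter]
      refine Finset.sum_congr rfl fun x _ => ?_
      rw [Finset.sum_filter]
      split_ifs with h1
      · exact Finset.sum_congr rfl fun y _ => by split_ifs <;> simp
      · simp
    have e2 : a i = (Finset.univ.filter (fun x => u x / 2 ^ i % 2 = 1)).card := by
      simp only [ha, binDigit_eq]
      rw [Finset.sum_boole]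
    have e3 : b j = (Finset.univ.filter (fun x => w x / 2 ^ j % 2 = 1)).card := by
      simp only [hb, binDigit_eq]
      rw [Finset.sum_boole]
    rw [e1, e2, e3]
    exact hdisc _ _
  have hnear : ∀ i j, 2 ^ i * 2 ^ j * |m i j| ≤ ρ * (4 ^ i * a i) + ρ * (4 ^ j * b j) := by
    intro i j
    have h1 : 2 ^ i * 2 ^ j * √(a i * b j) ≤ 4 ^ i * a i + 4 ^ j * b j := by
      have e : 2 ^ i * 2 ^ j * √(a i * b j) = √((4 ^ i * a i) * (4 ^ j * b j)) := by
        have h4 : ∀ i : ℕ, (4 : ℝ) ^ i = 2 ^ i * 2 ^ i := fun i => by rw [← mul_pow]; norm_num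
        rw [show (4 : ℝ) ^ i * a i * (4 ^ j * b j) = (2 ^ i * 2 ^ j) ^ 2 * (a i * b j) by
          rw [h4, h4]; ring, Real.sqrt_mul (by positivity : (0 : ℝ) ≤ (2 ^ i * 2 ^ j) ^ 2),
          Real.sqrt_sq (by positivity : (0 : ℝ) ≤ 2 ^ i * 2 ^ j)]
      rw [e]
      have p1 : 0 ≤ 4 ^ i * a i := mul_nonneg (by positivity) (ha0 i)
      have p2 : 0 ≤ 4 ^ j * b j := mul_nonneg (by positivity) (hb0 j)
      rw [Real.sqrt_le_left (by positivity)]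
      nlinarith
    calc _ ≤ 2 ^ i * 2 ^ j * (ρ * √(a i * b j)) := by gcongr; exact hmd i j
      _ = ρ * (2 ^ i * 2 ^ j * √(a i * b j)) := by ring
      _ ≤ ρ * (4 ^ i * a i + 4 ^ j * b j) := by gcongr
      _ = _ := by ring
  have hsa := sum_four_pow_binDigit_le hu
  have hsb := sum_four_pow_binDigit_le hw
  have hq0 : ∀ i j, 0 ≤ q i j := fun i j => (abs_nonneg _).trans (hmq i j)
  have hfar1 := sum_far_le (M := fun x y => |M x y|) (fun _ _ => abs_nonneg _) hrow u w r L
  have hfar2 := sum_far_le (M := fun x y => |M x y|) (fun _ _ => abs_nonneg _) hrow w u r L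
  have hnear1 := sum_near_le hρ (a := fun i => 4 ^ i * a i)
    (fun i => mul_nonneg (by positivity) (ha0 i)) r L
  have hnear2 := sum_near_le hρ (a := fun i => 4 ^ i * b i)
    (fun i => mul_nonneg (by positivity) (hb0 i)) r L
  rcases isEmpty_or_nonempty V with hV | ⟨⟨v₀⟩⟩
  · simp
  have hc : 0 ≤ c := (Finset.sum_nonneg fun _ _ => abs_nonneg _).trans (hrow v₀)
  rw [hexp]
  calc _ ≤ ∑ i ∈ Finset.range L, ∑ j ∈ Finset.range L, 2 ^ i * 2 ^ j * |m i j| := by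
        refine (Finset.abs_sum_le_sum_abs _ _).trans (Finset.sum_le_sum fun i _ =>
          (Finset.abs_sum_le_sum_abs _ _).trans (Finset.sum_le_sum fun j _ => ?_))
        rw [abs_mul, abs_of_nonneg (by positivity : (0 : ℝ) ≤ 2 ^ i * 2 ^ j)]
    _ ≤ ∑ i ∈ Finset.range L, ∑ j ∈ Finset.range L,
        ((if j + r < i then 2 ^ i * 2 ^ j * q i j else 0) +
          (if i + r < j then 2 ^ i * 2 ^ j * q i j else 0) +
          ((if ¬ j + r < i ∧ ¬ i + r < j then ρ * (4 ^ i * a i) else 0) +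
          (if ¬ j + r < i ∧ ¬ i + r < j then ρ * (4 ^ j * b j) else 0))) := by
        refine Finset.sum_le_sum fun i _ => Finset.sum_le_sum fun j _ => ?_
        have h1 : 2 ^ i * 2 ^ j * |m i j| ≤ 2 ^ i * 2 ^ j * q i j := by
          gcongr; exact hmq i j
        have h2 := hnear i j
        have h3 : 0 ≤ 2 ^ i * 2 ^ j * q i j := mul_nonneg (by positivity) (hq0 i j)
        by_cases c1 : j + r < i
        · have c2 : ¬ i + r < j := by omega
          simp only [c1, c2, if_true, if_false, not_true, false_and]; linarith
        · by_cases c2 : i + r < j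
          · simp only [c1, c2, if_true, if_false, not_true, and_false]; linarith
          · simp only [c1, c2, if_false, not_false_eq_true, and_self, if_true]; linarith
    _ = (∑ i ∈ Finset.range L, ∑ j ∈ (Finset.range L).filter (fun j => j + r < i),
          2 ^ i * 2 ^ j * q i j) +
        (∑ j ∈ Finset.range L, ∑ i ∈ (Finset.range L).filter (fun i => i + r < j),
          2 ^ i * 2 ^ j * q i j) +
        ((∑ i ∈ Finset.range L,
          ∑ _j ∈ (Finset.range L).filter (fun j => ¬ j + r < i ∧ ¬ i + r < j),
            ρ * (4 ^ i * a i)) +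
        (∑ j ∈ Finset.range L,
          ∑ _i ∈ (Finset.range L).filter (fun i => ¬ i + r < j ∧ ¬ j + r < i),
            ρ * (4 ^ j * b j))) := by
        simp only [Finset.sum_add_distrib, Finset.sum_filter]
        congr 1
        · congr 1
          rw [Finset.sum_comm]
        · congr 1
          rw [Finset.sum_comm]
          simp only [and_comm]
    _ ≤ c / 2 ^ r * ∑ v, (u v : ℝ) ^ 2 + c / 2 ^ r * ∑ v, (w v : ℝ) ^ 2 +
        ((2 * r + 1) * ρ * ∑ v, (u v : ℝ) ^ 2 + (2 * r + 1) * ρ * ∑ v, (w v : ℝ) ^ 2) := by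
        refine add_le_add (add_le_add (hfar1.trans (by gcongr)) (le_trans (le_of_eq ?_)
          (hfar2.trans (by gcongr)))) (add_le_add (hnear1.trans (by gcongr))
          (hnear2.trans (by gcongr)))
        refine Finset.sum_congr rfl fun j _ => Finset.sum_congr rfl fun i _ => ?_
        rw [mul_comm (2 ^ i : ℝ), hq]
        congr 1
        simp only
        rw [Finset.sum_comm]
        refine Finset.sum_congr rfl fun x _ => Finset.sum_congr rfl fun y _ => ?_
        rw [hM, mul_comm (binDigit i _)]
    _ = _ := by ring

lemma abs_bilin_nonneg_le {M : V → V → ℝ} (hM : ∀ x y, M x y = M y x) {ρ c : ℝ} (hρ : 0 ≤ ρ)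
    (hdisc : ∀ S T : Finset V, |∑ x ∈ S, ∑ y ∈ T, M x y| ≤ ρ * √(S.card * T.card))
    (hrow : ∀ x, ∑ y, |M x y| ≤ c) (r : ℕ) {u w : V → ℝ} (hu : ∀ v, 0 ≤ u v)
    (hw : ∀ v, 0 ≤ w v) :
    |∑ x, ∑ y, M x y * (u x * w y)| ≤
      ((2 * r + 1) * ρ + c / 2 ^ r) * (∑ v, u v ^ 2 + ∑ v, w v ^ 2) := by
  have lim : ∀ a : ℝ, 0 ≤ a →
      Filter.Tendsto (fun k : ℕ => (⌊a * k⌋₊ : ℝ) / k) Filter.atTop (nhds a) := fun a ha =>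
    (tendsto_nat_floor_mul_div_atTop ha).comp tendsto_natCast_atTop_atTop
  have t1 : Filter.Tendsto (fun k : ℕ => |∑ x, ∑ y, M x y *
      (((⌊u x * k⌋₊ : ℝ) / k) * ((⌊w y * k⌋₊ : ℝ) / k))|) Filter.atTop
      (nhds |∑ x, ∑ y, M x y * (u x * w y)|) :=
    (tendsto_finsetSum _ fun x _ => tendsto_finsetSum _ fun y _ =>
      ((lim _ (hu x)).mul (lim _ (hw y))).const_mul _).abs
  have t2 : Filter.Tendsto (fun k : ℕ => ((2 * r + 1) * ρ + c / 2 ^ r) *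
      (∑ v, ((⌊u v * k⌋₊ : ℝ) / k) ^ 2 + ∑ v, ((⌊w v * k⌋₊ : ℝ) / k) ^ 2)) Filter.atTop
      (nhds (((2 * r + 1) * ρ + c / 2 ^ r) * (∑ v, u v ^ 2 + ∑ v, w v ^ 2))) :=
    ((tendsto_finsetSum _ fun x _ => (lim _ (hu x)).pow 2).add
      (tendsto_finsetSum _ fun x _ => (lim _ (hw x)).pow 2)).const_mul _
  refine le_of_tendsto_of_tendsto t1 t2 ?_
  filter_upwards [Filter.eventually_gt_atTop 0] with k hk
  have hk' : (0 : ℝ) < k := by exact_mod_cast hk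
  have h := abs_bilin_nat_le hM hρ hdisc hrow r (fun x => ⌊u x * k⌋₊) (fun x => ⌊w x * k⌋₊)
  have e1 : ∑ x, ∑ y, M x y * (((⌊u x * k⌋₊ : ℝ) / k) * ((⌊w y * k⌋₊ : ℝ) / k)) =
      (∑ x, ∑ y, M x y * ((⌊u x * k⌋₊ : ℝ) * ⌊w y * k⌋₊)) / k ^ 2 := by
    simp only [Finset.sum_div]
    exact Finset.sum_congr rfl fun x _ => Finset.sum_congr rfl fun y _ => by field_simp
  have e2 : ∀ f : V → ℝ, ∑ v, ((⌊f v * k⌋₊ : ℝ) / k) ^ 2 =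
      (∑ v, (⌊f v * k⌋₊ : ℝ) ^ 2) / k ^ 2 := by
    intro f
    simp only [Finset.sum_div, div_pow]
  rw [e1, e2, e2, abs_div, abs_of_pos (by positivity : (0 : ℝ) < (k : ℝ) ^ 2), ← add_div,
    mul_div_assoc']
  gcongr

lemma abs_bilin_le {M : V → V → ℝ} (hM : ∀ x y, M x y = M y x) {ρ c : ℝ} (hρ : 0 ≤ ρ)
    (hdisc : ∀ S T : Finset V, |∑ x ∈ S, ∑ y ∈ T, M x y| ≤ ρ * √(S.card * T.card))
    (hrow : ∀ x, ∑ y, |M x y| ≤ c) (r : ℕ) (u w : V → ℝ) :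
    |∑ x, ∑ y, M x y * (u x * w y)| ≤
      2 * ((2 * r + 1) * ρ + c / 2 ^ r) * (∑ v, u v ^ 2 + ∑ v, w v ^ 2) := by
  have key := fun (f g : V → ℝ) hf hg =>
    abs_bilin_nonneg_le hM hρ hdisc hrow r (u := f) (w := g) hf hg
  set P : (V → ℝ) → V → ℝ := fun f v => max (f v) 0 with hP
  set N : (V → ℝ) → V → ℝ := fun f v => max (-f v) 0 with hN
  have hP0 : ∀ f v, 0 ≤ P f v := fun f v => le_max_right _ _
  have hN0 : ∀ f v, 0 ≤ N f v := fun f v => le_max_right _ _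
  have hsub : ∀ f v, f v = P f v - N f v := fun f v => by
    simp only [hP, hN]
    rcases le_total 0 (f v) with h | h
    · rw [max_eq_left h, max_eq_right (by linarith)]; ring
    · rw [max_eq_right h, max_eq_left (by linarith)]; ring
  have hsq : ∀ f : V → ℝ, ∑ v, f v ^ 2 = ∑ v, P f v ^ 2 + ∑ v, N f v ^ 2 := fun f => by
    rw [← Finset.sum_add_distrib]
    refine Finset.sum_congr rfl fun v _ => ?_
    simp only [hP, hN]
    rcases le_total 0 (f v) with h | h
    · rw [max_eq_left h, max_eq_right (by linarith)]; ring
    · rw [max_eq_right h, max_eq_left (by linarith)]; ring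
  have e : ∑ x, ∑ y, M x y * (u x * w y) =
      ∑ x, ∑ y, M x y * (P u x * P w y) - ∑ x, ∑ y, M x y * (P u x * N w y)
      - ∑ x, ∑ y, M x y * (N u x * P w y) + ∑ x, ∑ y, M x y * (N u x * N w y) := by
    simp only [← Finset.sum_sub_distrib, ← Finset.sum_add_distrib]
    refine Finset.sum_congr rfl fun x _ => Finset.sum_congr rfl fun y _ => ?_
    rw [hsub u x, hsub w y, ← hsub u x, ← hsub w y]
    linear_combination M x y * w y * hsub u x + M x y * (P u x - N u x) * hsub w y
  have k1 := abs_le.1 (key _ _ (hP0 u) (hP0 w))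
  have k2 := abs_le.1 (key _ _ (hP0 u) (hN0 w))
  have k3 := abs_le.1 (key _ _ (hN0 u) (hP0 w))
  have k4 := abs_le.1 (key _ _ (hN0 u) (hN0 w))
  rw [e, hsq u, hsq w, abs_le]
  constructor <;> nlinarith

lemma l2_mulVec_le_of_discrepancy {M : Matrix V V ℝ} (hM : ∀ x y, M x y = M y x) {ρ c : ℝ}
    (hρ : 0 ≤ ρ)
    (hdisc : ∀ S T : Finset V, |∑ x ∈ S, ∑ y ∈ T, M x y| ≤ ρ * √(S.card * T.card))
    (hrow : ∀ x, ∑ y, |M x y| ≤ c) (r : ℕ) (w : V → ℝ) :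
    l2 (M.mulVec w) ≤ 4 * ((2 * r + 1) * ρ + c / 2 ^ r) * l2 w := by
  rcases isEmpty_or_nonempty V with hV | ⟨⟨v₀⟩⟩
  · simp [l2]
  have hc : 0 ≤ c := (Finset.sum_nonneg fun _ _ => abs_nonneg _).trans (hrow v₀)
  set C := (2 * r + 1) * ρ + c / 2 ^ r with hC
  have hC0 : 0 ≤ C := by positivity
  set a := l2 (M.mulVec w) with ha
  set b := l2 w with hb
  have ha0 : 0 ≤ a := l2_nonneg _
  have hb0 : 0 ≤ b := l2_nonneg _
  have hab : ∀ s t : ℝ, s * t * a ^ 2 ≤ 2 * C * (s ^ 2 * a ^ 2 + t ^ 2 * b ^ 2) := by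
    intro s t
    have h := (le_abs_self _).trans
      (abs_bilin_le hM hρ hdisc hrow r (s • M.mulVec w) (t • w))
    have e1 : ∑ x, ∑ y, M x y * ((s • M.mulVec w) x * (t • w) y) = s * t * a ^ 2 := by
      rw [ha, l2_sq, Finset.mul_sum]
      refine Finset.sum_congr rfl fun x _ => ?_
      have : (M.mulVec w) x = ∑ y, M x y * w y := rfl
      simp only [Pi.smul_apply, smul_eq_mul]
      rw [show s * t * (M.mulVec w) x ^ 2 = (s * t * (M.mulVec w) x) * ∑ y, M x y * w y by
        rw [← this]; ring, Finset.mul_sum]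
      exact Finset.sum_congr rfl fun y _ => by ring
    rw [e1] at h
    simp only [Pi.smul_apply, smul_eq_mul, mul_pow, ← Finset.mul_sum] at h
    rw [ha, l2_sq] at h ⊢
    rwa [hb, l2_sq]
  rcases ha0.eq_or_lt with h0 | h0
  · rw [← h0]; positivity
  have h1 := hab b a
  rcases hb0.eq_or_lt with hb' | hb'
  · have h2 := hab 1 (4 * C + 1)
    rw [← hb'] at h2
    nlinarith [sq_pos_of_pos h0]
  · have : a * (b * a ^ 2) ≤ (4 * C * b) * (b * a ^ 2) := by nlinarith
    exact le_of_mul_le_mul_right this (by positivity)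

end Discrepancy

section RandomGraph

/-- The adjacency matrix of a set of pairs. -/
def edgeMat (E : Finset (Sym2 (Fin n))) : Matrix (Fin n) (Fin n) ℝ :=
  fun x y => if s(x, y) ∈ E then 1 else 0

lemma edgeMat_apply (E : Finset (Sym2 (Fin n))) (x y : Fin n) :
    edgeMat E x y = if s(x, y) ∈ E then 1 else 0 := rfl

lemma edgeMat_symm (E : Finset (Sym2 (Fin n))) (x y : Fin n) : edgeMat E x y = edgeMat E y x := by
  rw [edgeMat_apply, edgeMat_apply, Sym2.eq_swap]

lemma edgeMat_nonneg (E : Finset (Sym2 (Fin n))) (x y : Fin n) : 0 ≤ edgeMat E x y := by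
  rw [edgeMat_apply]; split_ifs <;> norm_num

lemma edgeMat_union {E E' : Finset (Sym2 (Fin n))} (h : Disjoint E E') :
    edgeMat (E ∪ E') = edgeMat E + edgeMat E' := by
  ext x y
  rw [Matrix.add_apply, edgeMat_apply, edgeMat_apply, edgeMat_apply]
  have := fun h1 : s(x, y) ∈ E => Finset.disjoint_left.1 h h1
  by_cases h1 : s(x, y) ∈ E <;> by_cases h2 : s(x, y) ∈ E' <;> simp_all

/-- The total weight of the two orientations of a pair. -/
def symSum (f : Fin n → Fin n → ℝ) (e : Sym2 (Fin n)) : ℝ :=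
  ∑ x, ∑ y, if s(x, y) = e then f x y else 0

lemma sum_mul_edgeMat (f : Fin n → Fin n → ℝ) (E : Finset (Sym2 (Fin n))) :
    ∑ x, ∑ y, f x y * edgeMat E x y = ∑ e ∈ E, symSum f e := by
  unfold symSum
  rw [Finset.sum_comm (s := E)]
  refine Finset.sum_congr rfl fun x _ => ?_
  rw [Finset.sum_comm (s := E)]
  refine Finset.sum_congr rfl fun y _ => ?_
  rw [Finset.sum_ite_eq, edgeMat_apply, mul_ite, mul_one, mul_zero]

lemma symSum_mk (f : Fin n → Fin n → ℝ) {a b : Fin n} (hab : a ≠ b) :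
    symSum f s(a, b) = f a b + f b a := by
  unfold symSum
  have h : ∀ x y, (if s(x, y) = s(a, b) then f x y else 0) =
      (if x = a then if y = b then f x y else 0 else 0) +
      (if x = b then if y = a then f x y else 0 else 0) := by
    intro x y
    simp only [Sym2.eq_iff]
    by_cases h1 : x = a <;> by_cases h2 : y = b <;> by_cases h3 : x = b <;>
      by_cases h4 : y = a <;> simp_all
  simp only [h, Finset.sum_add_distrib]
  congr 1 <;> simp

lemma symSum_sq_le (f : Fin n → Fin n → ℝ) {e : Sym2 (Fin n)} (he : ¬ e.IsDiag) :
    symSum f e ^ 2 ≤ 2 * symSum (fun x y => f x y ^ 2) e := by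
  induction e with
  | _ a b =>
    rw [Sym2.mk_isDiag_iff] at he
    rw [symSum_mk _ he, symSum_mk _ he]
    nlinarith [sq_nonneg (f a b - f b a)]

lemma abs_symSum_le {f : Fin n → Fin n → ℝ} {b : ℝ} (hf : ∀ x y, |f x y| ≤ b) {e : Sym2 (Fin n)}
    (he : ¬ e.IsDiag) : |symSum f e| ≤ 2 * b := by
  induction e with
  | _ x y =>
    rw [Sym2.mk_isDiag_iff] at he
    rw [symSum_mk _ he]
    have := abs_add_le (f x y) (f y x)
    linarith [hf x y, hf y x]

/-- A tail bound for bilinear statistics of a random graph. -/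
lemma binPr_bilin_tail {p : ℝ} (hp0 : 0 ≤ p) (hp1 : p ≤ 1) {R : Finset (Sym2 (Fin n))}
    (hR : ∀ e ∈ R, ¬ e.IsDiag) {f : Fin n → Fin n → ℝ} {b l s Q : ℝ} (hf : ∀ x y, |f x y| ≤ b)
    (hl : 0 ≤ l) (hlb : l * (2 * b) ≤ 1)
    (hQ : p * ∑ x, ∑ y, 2 * f x y ^ 2 * edgeMat R x y ≤ Q) :
    binPr p R (fun E => s ≤ |∑ x, ∑ y, f x y * (edgeMat E x y - p * edgeMat R x y)|) ≤
      2 * Real.exp (-(l * s) + l ^ 2 * Q) := by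
  refine le_trans (binPr_mono hp0 hp1 R ?_) (binPr_tail hp0 hp1 R
    (W := fun e => if e ∈ R then symSum f e else 0) (l := l) (s := s) (Q := Q) ?_ ?_ hl)
  · intro E hE h
    refine h.trans (le_of_eq ?_)
    congr 1
    have e1 : ∑ e ∈ E, (if e ∈ R then symSum f e else 0) = ∑ e ∈ E, symSum f e :=
      Finset.sum_congr rfl fun e he => if_pos (hE he)
    have e2 : ∑ e ∈ R, (if e ∈ R then symSum f e else 0) = ∑ e ∈ R, symSum f e :=
      Finset.sum_congr rfl fun e he => if_pos he
    rw [e1, e2, ← sum_mul_edgeMat, ← sum_mul_edgeMat, Finset.mul_sum, ← Finset.sum_sub_distrib]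
    refine Finset.sum_congr rfl fun x _ => ?_
    rw [Finset.mul_sum, ← Finset.sum_sub_distrib]
    exact Finset.sum_congr rfl fun y _ => by ring
  · intro e
    by_cases he : e ∈ R
    · simp only [he, if_true]
      rw [abs_mul, abs_of_nonneg hl]
      exact (mul_le_mul_of_nonneg_left (abs_symSum_le hf (hR e he)) hl).trans hlb
    · simp [he]
  · refine le_trans (mul_le_mul_of_nonneg_left ?_ hp0) hQ
    rw [sum_mul_edgeMat]
    refine Finset.sum_le_sum fun e he => ?_
    simp only [he, if_true]
    refine (symSum_sq_le f (hR e he)).trans (le_of_eq ?_)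
    unfold symSum
    rw [Finset.mul_sum]
    refine Finset.sum_congr rfl fun x _ => ?_
    rw [Finset.mul_sum]
    exact Finset.sum_congr rfl fun y _ => by split_ifs <;> ring

variable {R : Finset (Sym2 (Fin n))} {p k D : ℝ}

/-- A tail bound for the degrees of a random graph. -/
lemma binPr_degree_tail (hp0 : 0 ≤ p) (hp1 : p ≤ 1) (hR : ∀ e ∈ R, ¬ e.IsDiag)
    (hk : ∀ x, ∑ y, edgeMat R x y = k) (hD : p * k = D) (v : Fin n) {l s : ℝ} (hl : 0 ≤ l)
    (hl1 : l * 2 ≤ 1) :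
    binPr p R (fun E => s ≤ |∑ y, edgeMat E v y - D|) ≤
      2 * Real.exp (-(l * s) + l ^ 2 * (2 * D)) := by
  have h0 : ∀ g : Fin n → Fin n → ℝ, ∑ x, ∑ y, (if x = v then (1 : ℝ) else 0) * g x y =
      ∑ y, g v y := by
    intro g
    simp only [ite_mul, one_mul, zero_mul]
    rw [Finset.sum_eq_single v]
    · simp
    · intro x _ hx; simp [hx]
    · simp
  refine le_trans (binPr_mono hp0 hp1 R ?_) (binPr_bilin_tail hp0 hp1 hR
    (f := fun x _ => if x = v then 1 else 0) (b := 1) (s := s) (Q := 2 * D) ?_ hl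
    (by linarith) ?_)
  · intro E _ h
    refine h.trans (le_of_eq ?_)
    rw [h0 (fun x y => edgeMat E x y - p * edgeMat R x y), Finset.sum_sub_distrib,
      ← Finset.mul_sum, hk, hD]
  · intro x _; split_ifs <;> simp
  · refine le_of_eq ?_
    have : ∀ x y : Fin n, 2 * (if x = v then (1 : ℝ) else 0) ^ 2 * edgeMat R x y =
        (if x = v then (1 : ℝ) else 0) * (2 * edgeMat R x y) := by
      intro x y; split_ifs <;> ring
    simp only [this]
    rw [h0 (fun x y => 2 * edgeMat R x y), ← Finset.mul_sum, hk, ← hD]; ring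

lemma sum_inv_pow_card_le (hn : 0 < n) : ∑ S : Finset (Fin n), ((n : ℝ)⁻¹) ^ S.card ≤ 3 := by
  have h1 := Finset.sum_pow_mul_eq_add_pow ((n : ℝ)⁻¹) 1 (Finset.univ : Finset (Fin n))
  simp only [one_pow, mul_one, Finset.card_univ, Fintype.card_fin, Finset.powerset_univ] at h1
  rw [h1]
  have hn' : (0 : ℝ) < n := by exact_mod_cast hn
  calc ((n : ℝ)⁻¹ + 1) ^ n ≤ Real.exp ((n : ℝ)⁻¹) ^ n :=
        pow_le_pow_left₀ (by positivity) (Real.add_one_le_exp _) n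
    _ = Real.exp 1 := by rw [← Real.exp_nat_mul, mul_inv_cancel₀ hn'.ne']
    _ ≤ 3 := Real.exp_one_lt_three.le

/-- The discrepancy of a random graph is small. -/
lemma binPr_discrepancy (hp0 : 0 ≤ p) (hp1 : p ≤ 1) (hR : ∀ e ∈ R, ¬ e.IsDiag) (hn : 0 < n)
    (hD : 0 ≤ D) {c ρ l : ℝ} (hρ : 0 < ρ) (hc : 0 ≤ c)
    (hpc : p * n ≤ c * D) (hl : 0 ≤ l) (hl1 : l * 2 ≤ 1) (hlc : l * (4 * c) ≤ ρ)
    (hbig : 256 * Real.log n ≤ l * ρ ^ 2 * D) :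
    binPr p R (fun E => (∀ x, ∑ y, |edgeMat E x y - p * edgeMat R x y| ≤ 4 * D) ∧
      ∃ S T : Finset (Fin n), ρ * D * √(S.card * T.card) <
        |∑ x ∈ S, ∑ y ∈ T, (edgeMat E x y - p * edgeMat R x y)|) ≤ 18 / (n : ℝ) ^ 15 := by
  have hn' : (0 : ℝ) < n := by exact_mod_cast hn
  set I : Finset (Finset (Fin n) × Finset (Fin n)) := Finset.univ.filter fun w =>
    1 ≤ w.1.card + w.2.card ∧
      ρ * ((w.1.card : ℝ) + w.2.card) ≤ 8 * √(w.1.card * w.2.card) with hI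
  set f : Finset (Fin n) × Finset (Fin n) → Fin n → Fin n → ℝ := fun w x y =>
    if x ∈ w.1 ∧ y ∈ w.2 then 1 else 0 with hf
  have hfs : ∀ w (g : Fin n → Fin n → ℝ), ∑ x, ∑ y, f w x y * g x y =
      ∑ x ∈ w.1, ∑ y ∈ w.2, g x y := by
    intro w g
    rw [← Finset.sum_subset (Finset.subset_univ w.1)]
    · refine Finset.sum_congr rfl fun x hx => ?_
      rw [← Finset.sum_subset (Finset.subset_univ w.2)]
      · exact Finset.sum_congr rfl fun y hy => by simp [hf, hx, hy]
      · intro y _ hy; simp [hf, hy]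
    · intro x _ hx; simp [hf, hx]
  have hone : ∀ w ∈ I, binPr p R (fun E => ρ * D * √(w.1.card * w.2.card) ≤
      |∑ x, ∑ y, f w x y * (edgeMat E x y - p * edgeMat R x y)|) ≤
      2 / (n : ℝ) ^ 15 * ((n : ℝ)⁻¹ ^ w.1.card * (n : ℝ)⁻¹ ^ w.2.card) := by
    intro w hw
    rw [hI, Finset.mem_filter] at hw
    obtain ⟨-, hw1, hw2⟩ := hw
    have hc0 : ∀ S : Finset (Fin n), (0 : ℝ) ≤ S.card := fun S => Nat.cast_nonneg _
    obtain ⟨q, hq⟩ : ∃ q, q = √((w.1.card : ℝ) * w.2.card) := ⟨_, rfl⟩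
    rw [← hq] at hw2 ⊢
    have hq0 : 0 ≤ q := hq ▸ Real.sqrt_nonneg _
    have hqq : (w.1.card : ℝ) * w.2.card = q * q := by
      rw [hq, Real.mul_self_sqrt (mul_nonneg (hc0 _) (hc0 _))]
    have hcard : ∀ S : Finset (Fin n), (S.card : ℝ) ≤ n := fun S => by
      have := S.card_le_univ
      rw [Fintype.card_fin] at this
      exact_mod_cast this
    have hqn : q ≤ n := by
      rw [hq]
      refine Real.sqrt_le_iff.2 ⟨hn'.le, ?_⟩
      have := mul_le_mul (hcard w.1) (hcard w.2) (hc0 _) hn'.le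
      linarith
    refine (binPr_bilin_tail hp0 hp1 hR (f := f w) (b := 1) (l := l) (Q := 2 * c * D * q)
      ?_ hl (by linarith) ?_).trans ?_
    · intro x y; simp only [hf]; split_ifs <;> simp
    · have h1 : ∑ x, ∑ y, 2 * f w x y ^ 2 * edgeMat R x y ≤ 2 * (q * q) := by
        calc _ ≤ ∑ x, ∑ y, f w x y * 2 := by
              refine Finset.sum_le_sum fun x _ => Finset.sum_le_sum fun y _ => ?_
              simp only [hf, edgeMat_apply]
              split_ifs <;> norm_num
          _ = 2 * (q * q) := by
              rw [hfs w fun _ _ => 2, ← hqq]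
              simp only [Finset.sum_const, nsmul_eq_mul]; ring
      calc _ ≤ p * (2 * (q * q)) := mul_le_mul_of_nonneg_left h1 hp0
        _ = p * q * (2 * q) := by ring
        _ ≤ p * n * (2 * q) := by gcongr
        _ ≤ c * D * (2 * q) := by gcongr
        _ = _ := by ring
    · have e1 : -(l * (ρ * D * q)) + l ^ 2 * (2 * c * D * q) ≤
          -(16 * (w.1.card + w.2.card : ℝ) * Real.log n) := by
        have a1 : l * (4 * c) * (l * D * q) ≤ ρ * (l * D * q) := by gcongr
        have a2 : (l * ρ * D) * (ρ * ((w.1.card : ℝ) + w.2.card)) ≤ (l * ρ * D) * (8 * q) := by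
          gcongr
        have a3 : 256 * Real.log n * ((w.1.card : ℝ) + w.2.card) ≤
          l * ρ ^ 2 * D * ((w.1.card : ℝ) + w.2.card) :=
          mul_le_mul_of_nonneg_right hbig (add_nonneg (hc0 _) (hc0 _))
        nlinarith
      have e2 : Real.exp (-(16 * (w.1.card + w.2.card : ℝ) * Real.log n)) =
          ((n : ℝ)⁻¹) ^ (16 * (w.1.card + w.2.card)) := by
        rw [← Real.exp_log (inv_pos.2 hn'), ← Real.exp_nat_mul, Real.log_inv]
        congr 1; push_cast; ring
      have hinv : ((n : ℝ)⁻¹) ≤ 1 := inv_le_one_of_one_le₀ (by exact_mod_cast hn)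
      calc _ ≤ 2 * ((n : ℝ)⁻¹) ^ (16 * (w.1.card + w.2.card)) := by
            rw [← e2]; gcongr
        _ ≤ 2 * ((n : ℝ)⁻¹) ^ (15 + (w.1.card + w.2.card)) := by
            gcongr 2 * ?_
            exact pow_le_pow_of_le_one (by positivity) hinv (by omega)
        _ = _ := by rw [pow_add, pow_add, inv_pow]; ring
  calc _ ≤ binPr p R (fun E => ∃ w ∈ I, ρ * D * √(w.1.card * w.2.card) ≤
      |∑ x, ∑ y, f w x y * (edgeMat E x y - p * edgeMat R x y)|) := by
        refine binPr_mono hp0 hp1 R ?_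
        rintro E - ⟨hrow, S, T, hST⟩
        refine ⟨(S, T), ?_, by rw [hfs]; exact hST.le⟩
        set M : Fin n → Fin n → ℝ := fun x y => edgeMat E x y - p * edgeMat R x y with hM
        have hMs : ∀ x y, M x y = M y x := fun x y => by
          simp only [hM]; rw [edgeMat_symm E, edgeMat_symm R]
        have b1 : ∀ S T : Finset (Fin n), |∑ x ∈ S, ∑ y ∈ T, M x y| ≤ 4 * D * S.card := by
          intro S T
          calc _ ≤ ∑ x ∈ S, ∑ y ∈ T, |M x y| := (Finset.abs_sum_le_sum_abs _ _).trans
                (Finset.sum_le_sum fun x _ => Finset.abs_sum_le_sum_abs _ _)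
            _ ≤ ∑ x ∈ S, 4 * D := Finset.sum_le_sum fun x _ =>
                (Finset.sum_le_univ_sum_of_nonneg fun y => abs_nonneg _).trans (hrow x)
            _ = _ := by rw [Finset.sum_const, nsmul_eq_mul, mul_comm]
        have b2 : |∑ x ∈ S, ∑ y ∈ T, M x y| ≤ 4 * D * T.card := by
          rw [Finset.sum_comm]
          simp only [hMs]
          exact b1 T S
        have b3 := b1 S T
        obtain ⟨s, hs⟩ : ∃ s, s = √(S.card : ℝ) := ⟨_, rfl⟩
        obtain ⟨t, ht⟩ : ∃ t, t = √(T.card : ℝ) := ⟨_, rfl⟩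
        have hss : (S.card : ℝ) = s * s := by rw [hs, Real.mul_self_sqrt (Nat.cast_nonneg _)]
        have htt : (T.card : ℝ) = t * t := by rw [ht, Real.mul_self_sqrt (Nat.cast_nonneg _)]
        have hs0 : 0 ≤ s := hs ▸ Real.sqrt_nonneg _
        have ht0 : 0 ≤ t := ht ▸ Real.sqrt_nonneg _
        have hst : √((S.card : ℝ) * T.card) = s * t := by
          rw [hs, ht, Real.sqrt_mul (Nat.cast_nonneg _)]
        rw [hst] at hST
        rw [hss] at b3
        rw [htt] at b2
        have c1 : ρ * t ≤ 4 * s := by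
          by_contra hcon
          have := mul_le_mul_of_nonneg_left (not_le.1 hcon).le (mul_nonneg hD hs0)
          nlinarith
        have c2 : ρ * s ≤ 4 * t := by
          by_contra hcon
          have := mul_le_mul_of_nonneg_left (not_le.1 hcon).le (mul_nonneg hD ht0)
          nlinarith
        rw [hI, Finset.mem_filter]
        refine ⟨Finset.mem_univ _, ?_, ?_⟩
        · by_contra hcon
          have h1 : S.card = 0 := by simp only at hcon; omega
          have h2 := b1 S T
          rw [h1, Nat.cast_zero, mul_zero] at h2
          have : 0 ≤ ρ * D * (s * t) := by positivity
          linarith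
        · simp only
          rw [hst, hss, htt]
          nlinarith [mul_le_mul_of_nonneg_left c1 ht0, mul_le_mul_of_nonneg_left c2 hs0]
    _ ≤ ∑ w ∈ I, 2 / (n : ℝ) ^ 15 * ((n : ℝ)⁻¹ ^ w.1.card * (n : ℝ)⁻¹ ^ w.2.card) :=
        (binPr_exists_le hp0 hp1 R I _).trans (Finset.sum_le_sum hone)
    _ ≤ ∑ w : Finset (Fin n) × Finset (Fin n),
        2 / (n : ℝ) ^ 15 * ((n : ℝ)⁻¹ ^ w.1.card * (n : ℝ)⁻¹ ^ w.2.card) :=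
        Finset.sum_le_univ_sum_of_nonneg fun w => by positivity
    _ = 2 / (n : ℝ) ^ 15 * ((∑ S : Finset (Fin n), ((n : ℝ)⁻¹) ^ S.card) *
        ∑ S : Finset (Fin n), ((n : ℝ)⁻¹) ^ S.card) := by
        rw [← Finset.mul_sum, Finset.sum_mul_sum, ← Finset.univ_product_univ,
          Finset.sum_product]
    _ ≤ 2 / (n : ℝ) ^ 15 * (3 * 3) := by
        have := sum_inv_pow_card_le hn
        have h0 : 0 ≤ ∑ S : Finset (Fin n), ((n : ℝ)⁻¹) ^ S.card :=
          Finset.sum_nonneg fun _ _ => by positivity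
        gcongr
    _ = _ := by ring

end RandomGraph

section TypicalPair

lemma binPr_count_tail {α : Type*} {p : ℝ} (hp0 : 0 ≤ p) (hp1 : p ≤ 1) (R W : Finset α) {l t : ℝ}
    (hl : 0 ≤ l) :
    binPr p R (fun E => t ≤ ((E ∩ W).card : ℝ)) ≤ Real.exp (-(l * t) + p * (W.card * Real.exp l)) := by
  refine (binPr_le_of_prod hp0 hp1 R (z := fun e => if e ∈ W then Real.exp l else 1)
    (c := Real.exp (-(l * t))) (fun e => ?_) (Real.exp_pos _).le ?_).trans ?_
  · split_ifs <;> positivity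
  · intro E _ hE
    rw [Finset.prod_ite, Finset.prod_const_one, mul_one, Finset.prod_const,
      Finset.filter_mem_eq_inter, ← Real.exp_nat_mul, ← Real.exp_add]
    refine Real.one_le_exp ?_
    have := mul_le_mul_of_nonneg_left hE hl
    linarith
  · rw [← Real.exp_add]
    refine Real.exp_le_exp.2 (add_le_add le_rfl (mul_le_mul_of_nonneg_left ?_ hp0))
    have h1 : ∀ e ∈ R, (if e ∈ W then Real.exp l else 1) - 1 = if e ∈ W then Real.exp l - 1 else 0 := by
      intro e _; split_ifs <;> ring
    rw [Finset.sum_congr rfl h1, ← Finset.sum_filter, Finset.sum_const, nsmul_eq_mul]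
    have h2 : (((R.filter (· ∈ W)).card : ℕ) : ℝ) ≤ W.card := by
      rw [Finset.filter_mem_eq_inter]
      exact_mod_cast Finset.card_le_card Finset.inter_subset_right
    have h3 := Real.one_le_exp hl
    nlinarith [mul_le_mul_of_nonneg_right h2 (sub_nonneg.2 h3), (Nat.cast_nonneg W.card : (0:ℝ) ≤ W.card)]

lemma mixingPair_smul {X Y : Matrix (Fin n) (Fin n) ℝ} {D d γ σ κ θ : ℝ} (hD : 0 < D) (hd : 0 < d)
    (hX0 : ∀ x y, 0 ≤ X x y) (hY0 : ∀ x y, 0 ≤ Y x y) (hX : ∀ x y, X x y = X y x)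
    (hY : ∀ x y, Y x y = Y y x) (hYd : ∀ x, ∑ y, Y x y = d)
    (h1 : ∀ v, |∑ y, X v y - D| ≤ σ * D) (h2 : ∀ x y, (X * Y) x y ≤ θ * (D * d))
    (h3 : ∀ v, |∑ x, ∑ y, (X * Y) v x * X x y - D * d * ∑ y, X v y| ≤
      κ * (D * d) * ∑ y, X v y)
    (h4 : ∀ g : Fin n → ℝ, ∑ x, g x = 0 → l2 ((X * Y).mulVec g) ≤ (1 - γ) * (D * d) * l2 g) :
    MixingPair (D⁻¹ • X) (d⁻¹ • Y) γ σ κ θ := by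
  have hXY : (D⁻¹ • X) * (d⁻¹ • Y) = (D * d)⁻¹ • (X * Y) := by
    rw [Matrix.smul_mul, Matrix.mul_smul, smul_smul, mul_inv]
  have hX1 : ∀ x, (D⁻¹ • X).mulVec 1 x = D⁻¹ * ∑ y, X x y := fun x => by
    simp [Matrix.mulVec, dotProduct, Finset.mul_sum]
  constructor
  · intro x y; exact mul_nonneg (by positivity) (hX0 x y)
  · intro x y; exact mul_nonneg (by positivity) (hY0 x y)
  · ext x y; simp [hX y x]
  · ext x y; simp [hY y x]
  · ext x
    have : (d⁻¹ • Y).mulVec 1 x = d⁻¹ * ∑ y, Y x y := by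
      simp [Matrix.mulVec, dotProduct, Finset.mul_sum]
    rw [this, hYd, inv_mul_cancel₀ hd.ne', Pi.one_apply]
  · intro x
    rw [hX1, show D⁻¹ * ∑ y, X x y - 1 = D⁻¹ * (∑ y, X x y - D) by field_simp, abs_mul,
      abs_of_pos (inv_pos.2 hD), inv_mul_le_iff₀ hD]
    linarith [h1 x]
  · intro x y
    rw [hXY, Matrix.smul_apply, smul_eq_mul, inv_mul_le_iff₀ (by positivity)]
    linarith [h2 x y]
  · intro v
    have e : ((D⁻¹ • X) * (d⁻¹ • Y)).mulVec ((D⁻¹ • X).mulVec 1) v =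
        (D * (D * d))⁻¹ * ∑ x, ∑ y, (X * Y) v x * X x y := by
      rw [hXY]
      have : ∀ (Z : Matrix (Fin n) (Fin n) ℝ) g, Z.mulVec g v = ∑ x, Z v x * g x := fun _ _ => rfl
      rw [this, Finset.mul_sum]
      refine Finset.sum_congr rfl fun x _ => ?_
      rw [hX1, Matrix.smul_apply, smul_eq_mul, ← Finset.mul_sum, mul_inv D]
      ring
    rw [e, hX1]
    have h := h3 v
    set a := ∑ x, ∑ y, (X * Y) v x * X x y
    set b := ∑ y, X v y
    rw [show (D * (D * d))⁻¹ * a - D⁻¹ * b = (D * (D * d))⁻¹ * (a - D * d * b) by field_simp,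
      abs_mul, abs_of_pos (by positivity : (0 : ℝ) < (D * (D * d))⁻¹)]
    calc _ ≤ (D * (D * d))⁻¹ * (κ * (D * d) * b) := by gcongr
      _ = _ := by field_simp
  · intro g hg
    rw [hXY, Matrix.smul_mulVec, l2_smul, abs_of_pos (by positivity : (0 : ℝ) < (D * d)⁻¹),
      inv_mul_le_iff₀ (by positivity)]
    linarith [h4 g hg]

lemma l2_mulVec_le_of_row_sum {Y : Matrix (Fin n) (Fin n) ℝ} {d : ℝ} (hd : 0 < d)
    (hY0 : ∀ x y, 0 ≤ Y x y) (hY : ∀ x y, Y x y = Y y x) (hYd : ∀ x, ∑ y, Y x y = d)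
    (g : Fin n → ℝ) : l2 (Y.mulVec g) ≤ d * l2 g := by
  have h1 : ∀ x, ∑ y, (d⁻¹ • Y) x y ≤ 1 := by
    intro x
    simp only [Matrix.smul_apply, smul_eq_mul, ← Finset.mul_sum, hYd]
    exact (inv_mul_cancel₀ hd.ne').le
  have h := l2_mulVec_le_of_stochastic (B := d⁻¹ • Y)
    (fun x y => mul_nonneg (by positivity) (hY0 x y)) h1
    (fun y => by
      refine le_trans (le_of_eq (Finset.sum_congr rfl fun x _ => ?_)) (h1 y)
      rw [Matrix.smul_apply, Matrix.smul_apply, hY x y]) g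
  rw [Matrix.smul_mulVec, l2_smul, abs_of_pos (inv_pos.2 hd), inv_mul_le_iff₀ hd] at h
  exact h

/-- Spectral contraction for a random graph composed with a fixed regular graph. -/
lemma l2_mul_mulVec_le {X Y Z : Matrix (Fin n) (Fin n) ℝ} {D d k p γ : ℝ} (hd : 0 < d)
    (hp0 : 0 ≤ p) (hY0 : ∀ x y, 0 ≤ Y x y) (hY : ∀ x y, Y x y = Y y x) (hYd : ∀ x, ∑ y, Y x y = d)
    (hD : p * k = D) (hγD : 0 ≤ γ * D)
    (hM : ∀ g, l2 ((X - p • Z).mulVec g) ≤ γ * D * l2 g)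
    (hgap : ∀ g : Fin n → ℝ, ∑ x, g x = 0 → l2 ((Z * Y).mulVec g) ≤ (1 - 2 * γ) * (d * k) * l2 g)
    (g : Fin n → ℝ) (hg : ∑ x, g x = 0) :
    l2 ((X * Y).mulVec g) ≤ (1 - γ) * (D * d) * l2 g := by
  have e : (X * Y).mulVec g = (X - p • Z).mulVec (Y.mulVec g) + p • (Z * Y).mulVec g := by
    rw [← Matrix.mulVec_mulVec, ← Matrix.mulVec_mulVec, Matrix.sub_mulVec, Matrix.smul_mulVec]
    simp
  rw [e]
  have h1 := hM (Y.mulVec g)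
  have h2 := mul_le_mul_of_nonneg_left (l2_mulVec_le_of_row_sum hd hY0 hY hYd g) hγD
  have h3 := mul_le_mul_of_nonneg_left (hgap g hg) hp0
  refine (l2_add_le _ _).trans ?_
  rw [l2_smul, abs_of_nonneg hp0]
  have : p * ((1 - 2 * γ) * (d * k) * l2 g) = (1 - 2 * γ) * (D * d) * l2 g := by rw [← hD]; ring
  nlinarith

lemma binPr_false (p : ℝ) {α : Type*} (R : Finset α) : binPr p R (fun _ => False) = 0 := by
  simp [binPr]

lemma binPr_split_filter_le {α : Type*} {p : ℝ} (hp0 : 0 ≤ p) (hp1 : p ≤ 1) {R : Finset α}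
    (P : α → Prop) {A : Finset α → Finset α → Prop} {c : ℝ}
    (h : ∀ E₁ ⊆ R.filter P, binPr p (R.filter fun e => ¬ P e) (A E₁) ≤ c) :
    binPr p R (fun E => A (E.filter P) (E.filter fun e => ¬ P e)) ≤ c := by
  have key := binPr_split_le hp0 hp1 (Finset.disjoint_filter_filter_not R R P) h
  rw [Finset.filter_union_filter_not_eq] at key
  refine (binPr_mono hp0 hp1 R fun E hE hA => ?_).trans key
  have h1 : E ∩ R.filter P = E.filter P := by
    ext e; simp only [Finset.mem_inter, Finset.mem_filter]
    exact ⟨fun h => ⟨h.1, h.2.2⟩, fun h => ⟨h.1, hE h.1, h.2⟩⟩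
  have h2 : E ∩ R.filter (fun e => ¬ P e) = E.filter fun e => ¬ P e := by
    ext e; simp only [Finset.mem_inter, Finset.mem_filter]
    exact ⟨fun h => ⟨h.1, h.2.2⟩, fun h => ⟨h.1, hE h.1, h.2⟩⟩
  rwa [h1, h2]

lemma binPr_codegree_tail {p : ℝ} (hp0 : 0 ≤ p) (hp1 : p ≤ 1) (R T : Finset (Sym2 (Fin n)))
    {d : ℝ} (hT : ∀ x, ∑ y, edgeMat T x y = d) (x y : Fin n) {l t : ℝ} (hl : 0 ≤ l) :
    binPr p R (fun E => t ≤ (edgeMat E * edgeMat T) x y) ≤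
      Real.exp (-(l * t) + p * (d * Real.exp l)) := by
  set Z := Finset.univ.filter fun z => s(z, y) ∈ T
  set W := Z.image fun z => s(x, z)
  have hinj : Function.Injective fun z : Fin n => s(x, z) := fun a b h => by
    exact Sym2.congr_right.1 h
  have hZ : (Z.card : ℝ) = d := by
    rw [← hT y, Finset.card_filter, Nat.cast_sum]
    refine Finset.sum_congr rfl fun z _ => ?_
    rw [edgeMat_symm, edgeMat_apply]; split_ifs <;> simp
  have hW : (W.card : ℝ) = d := by rw [Finset.card_image_of_injective _ hinj, hZ]
  refine (binPr_mono hp0 hp1 R fun E _ hE => ?_).trans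
    ((binPr_count_tail hp0 hp1 R W (l := l) (t := t) hl).trans (by rw [hW]))
  refine hE.trans (le_of_eq ?_)
  refine Eq.trans ?_ (congrArg (fun s : Finset (Sym2 (Fin n)) => (s.card : ℝ))
    (show W.filter (· ∈ E) = _ by ext; simp [and_comm]))
  rw [Finset.filter_image, Finset.card_image_of_injective _ hinj, Finset.filter_filter, Finset.card_filter, Nat.cast_sum,
    Matrix.mul_apply]
  refine Finset.sum_congr rfl fun z _ => ?_
  rw [edgeMat_apply, edgeMat_apply]
  by_cases h1 : s(x, z) ∈ E <;> by_cases h2 : s(z, y) ∈ T <;> simp [h1, h2]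

lemma binPr_harmonic {p : ℝ} (hp0 : 0 ≤ p) (hp1 : p ≤ 1) {R T : Finset (Sym2 (Fin n))}
    (hR : ∀ e ∈ R, ¬ e.IsDiag) {k D d b κ : ℝ} (hk : ∀ x, ∑ y, edgeMat R x y = k)
    (hD : p * k = D) (hT : ∀ x, ∑ y, edgeMat T x y = d) (hd : 0 ≤ d) (hD0 : 0 ≤ D) (hb : 0 < b)
    (hκ0 : 0 ≤ κ) (hκ1 : κ ≤ 1)
    (hbκ : 4 * b + p * d ≤ 3 * κ / 4 * (D * d)) (v : Fin n) :
    binPr p R (fun E => (∀ x, (edgeMat E * edgeMat T) v x ≤ b) ∧ D / 2 ≤ ∑ y, edgeMat E v y ∧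
      κ * (D * d) * ∑ y, edgeMat E v y <
        |∑ x, ∑ y, (edgeMat E * edgeMat T) v x * edgeMat E x y - D * d * ∑ y, edgeMat E v y|) ≤
      2 * Real.exp (-(κ ^ 2 * D ^ 2 * d / (256 * b))) := by
  obtain ⟨P, hP⟩ : ∃ P : Sym2 (Fin n) → Prop, ∀ e, P e ↔ v ∈ e := ⟨_, fun _ => Iff.rfl⟩
  set R₁ := R.filter P
  set R₂ := R.filter fun e => ¬ P e
  have hdis : Disjoint R₁ R₂ := Finset.disjoint_filter_filter_not _ _ _
  have hun : R₁ ∪ R₂ = R := Finset.filter_union_filter_not_eq _ _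
  have hpos : ∀ (S : Finset (Sym2 (Fin n))) x y, 0 ≤ edgeMat S x y := edgeMat_nonneg
  have hmul : ∀ S : Finset (Sym2 (Fin n)), ∀ x, 0 ≤ (edgeMat S * edgeMat T) v x := fun S x => by
    rw [Matrix.mul_apply]
    exact Finset.sum_nonneg fun z _ => mul_nonneg (hpos _ _ _) (hpos _ _ _)
  have hsum : ∀ S : Finset (Sym2 (Fin n)), ∑ x, (edgeMat S * edgeMat T) v x =
      d * ∑ y, edgeMat S v y := fun S => by
    simp only [Matrix.mul_apply]
    rw [Finset.sum_comm, Finset.mul_sum]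
    refine Finset.sum_congr rfl fun z _ => ?_
    rw [← Finset.mul_sum, hT, mul_comm]
  -- pairs through `v` only contribute to the row and the column of `v`
  have hstar : ∀ S ⊆ R₁, ∀ x y, edgeMat S x y ≤
      (if x = v then edgeMat S v y else 0) + (if y = v then edgeMat S v x else 0) := by
    intro S hS x y
    by_cases h : s(x, y) ∈ S
    · have hv : v ∈ s(x, y) := (hP _).1 (Finset.mem_filter.1 (hS h)).2
      rcases Sym2.mem_iff.1 hv with rfl | rfl
      · rw [if_pos rfl]
        have : (0 : ℝ) ≤ if y = v then edgeMat S v v else 0 := by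
          split_ifs <;> first | exact hpos _ _ _ | exact le_rfl
        linarith
      · rw [if_pos rfl, edgeMat_symm S x]
        have : (0 : ℝ) ≤ if x = v then edgeMat S v v else 0 := by
          split_ifs <;> first | exact hpos _ _ _ | exact le_rfl
        linarith
    · rw [edgeMat_apply, if_neg h]
      have h1 : (0 : ℝ) ≤ if x = v then edgeMat S v y else 0 := by
        split_ifs <;> first | exact hpos _ _ _ | exact le_rfl
      have h2 : (0 : ℝ) ≤ if y = v then edgeMat S v x else 0 := by
        split_ifs <;> first | exact hpos _ _ _ | exact le_rfl
      linarith
  have hle1 : ∀ (S : Finset (Sym2 (Fin n))) x y, edgeMat S x y ≤ 1 := fun S x y => by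
    rw [edgeMat_apply]; split_ifs <;> norm_num
  have key := binPr_split_filter_le hp0 hp1 (R := R) P (c := 2 * Real.exp (-(κ ^ 2 * D ^ 2 * d / (256 * b))))
    (A := fun E₁ E₂ => (∀ x, (edgeMat E₁ * edgeMat T) v x ≤ b) ∧ D / 2 ≤ ∑ y, edgeMat E₁ v y ∧
      κ * (D * d) * ∑ y, edgeMat E₁ v y <
        |∑ x, ∑ y, (edgeMat E₁ * edgeMat T) v x * (edgeMat E₁ x y + edgeMat E₂ x y) -
          D * d * ∑ y, edgeMat E₁ v y|) ?_
  · refine (binPr_mono hp0 hp1 R fun E hE hA => ?_).trans key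
    have hE' : E = (E.filter P) ∪ E.filter fun e => ¬ P e :=
      (Finset.filter_union_filter_not_eq _ _).symm
    have hadd : ∀ x y, edgeMat E x y = edgeMat (E.filter P) x y + edgeMat (E.filter fun e => ¬ P e) x y := fun x y => by
      conv_lhs => rw [hE', edgeMat_union (Finset.disjoint_filter_filter_not _ _ _)]
      rfl
    have hrow : ∀ y, edgeMat (E.filter P) v y = edgeMat E v y := fun y => by
      rw [hadd, left_eq_add, edgeMat_apply, if_neg]
      intro h
      exact (Finset.mem_filter.1 h).2 ((hP _).2 (Sym2.mem_mk_left _ _))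
    have hw : ∀ x, (edgeMat (E.filter P) * edgeMat T) v x = (edgeMat E * edgeMat T) v x := fun x => by
      rw [Matrix.mul_apply, Matrix.mul_apply]; simp only [hrow]
    simp only [hrow, hw, ← hadd]
    exact hA
  · intro E₁ hE₁
    set w := fun x => (edgeMat E₁ * edgeMat T) v x with hw
    set U := ∑ y, edgeMat E₁ v y with hU
    have hw0 : ∀ x, 0 ≤ w x := hmul E₁
    have hws : ∑ x, w x = d * U := hsum E₁
    by_cases hc : (∀ x, w x ≤ b) ∧ D / 2 ≤ U
    swap
    · refine (binPr_mono hp0 hp1 R₂ (A' := fun _ => False) fun E _ (h : _ ∧ _ ∧ _) => hc ⟨h.1, h.2.1⟩).trans ?_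
      rw [binPr_false]; positivity
    obtain ⟨hwb, hUD⟩ := hc
    have hU0 : 0 ≤ U := Finset.sum_nonneg fun _ _ => hpos _ _ _
    -- contribution of the star
    have hfirst : ∑ x, ∑ y, w x * edgeMat E₁ x y ≤ 2 * b * U := by
      calc ∑ x, ∑ y, w x * edgeMat E₁ x y
          ≤ ∑ x, ∑ y, b * ((if x = v then edgeMat E₁ v y else 0) +
              (if y = v then edgeMat E₁ v x else 0)) :=
            Finset.sum_le_sum fun x _ => Finset.sum_le_sum fun y _ =>
              mul_le_mul (hwb x) (hstar E₁ hE₁ x y) (hpos _ _ _) hb.le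
        _ = 2 * b * U := by
            simp only [← Finset.mul_sum, Finset.sum_add_distrib]
            rw [Finset.sum_comm]
            simp only [Finset.sum_ite_eq', Finset.mem_univ, if_true]
            rw [← hU]; ring
    have hfirst0 : 0 ≤ ∑ x, ∑ y, w x * edgeMat E₁ x y :=
      Finset.sum_nonneg fun x _ => Finset.sum_nonneg fun y _ => mul_nonneg (hw0 x) (hpos _ _ _)
    have hR12 : ∀ x y, edgeMat R x y = edgeMat R₁ x y + edgeMat R₂ x y := fun x y => by
      conv_lhs => rw [← hun, edgeMat_union hdis]
      rfl
    have hthird : ∑ x, ∑ y, w x * (p * edgeMat R₂ x y) =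
        D * d * U - p * ∑ x, ∑ y, w x * edgeMat R₁ x y := by
      have : D * d * U = ∑ x, ∑ y, w x * (p * edgeMat R x y) := by
        simp only [← Finset.mul_sum, hk, hD]
        rw [← Finset.sum_mul, hws]; ring
      rw [this, Finset.mul_sum, ← Finset.sum_sub_distrib]
      refine Finset.sum_congr rfl fun x _ => ?_
      rw [Finset.mul_sum, ← Finset.sum_sub_distrib]
      refine Finset.sum_congr rfl fun y _ => ?_
      rw [hR12]; ring
    have hloss : p * ∑ x, ∑ y, w x * edgeMat R₁ x y ≤ 2 * b * U + p * d * U := by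
      have h1 : ∑ x, ∑ y, w x * edgeMat R₁ x y ≤ w v * k + d * U := by
        calc ∑ x, ∑ y, w x * edgeMat R₁ x y
            ≤ ∑ x, ∑ y, w x * ((if x = v then edgeMat R v y else 0) + (if y = v then 1 else 0)) := by
              refine Finset.sum_le_sum fun x _ => Finset.sum_le_sum fun y _ =>
                mul_le_mul_of_nonneg_left ((hstar R₁ subset_rfl x y).trans (add_le_add ?_ ?_)) (hw0 x)
              · split_ifs
                · rw [hR12]; linarith [hpos R₂ v y]
                · exact le_rfl
              · split_ifs
                · exact hle1 _ _ _
                · exact le_rfl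
          _ = w v * k + d * U := by
              simp only [← Finset.mul_sum, Finset.sum_add_distrib, mul_add, Finset.sum_ite_eq',
                Finset.mem_univ, if_true, mul_one]
              rw [hws]
              congr 1
              rw [Finset.sum_eq_single v]
              · simp [hk]
              · intro x _ hx; simp [hx]
              · simp
      have h2 : p * (w v * k) ≤ b * D := by
        rw [← hD]; nlinarith [mul_le_mul_of_nonneg_right (hwb v) (hD ▸ hD0)]
      have h3 := mul_le_mul_of_nonneg_left h1 hp0
      nlinarith [mul_le_mul_of_nonneg_left hUD hb.le]
    have hloss0 : 0 ≤ p * ∑ x, ∑ y, w x * edgeMat R₁ x y :=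
      mul_nonneg hp0 (Finset.sum_nonneg fun x _ => Finset.sum_nonneg fun y _ =>
        mul_nonneg (hw0 x) (hpos _ _ _))
    have hwsq : ∑ x, w x ^ 2 ≤ b * (d * U) := by
      rw [← hws, Finset.mul_sum]
      refine Finset.sum_le_sum fun x _ => ?_
      rw [sq]; exact mul_le_mul_of_nonneg_right (hwb x) (hw0 x)
    have htail := binPr_bilin_tail hp0 hp1 (R := R₂) (fun e he => hR e (Finset.mem_filter.1 he).1)
      (f := fun x _ => w x) (b := b) (l := κ / (16 * b)) (s := κ / 4 * (D * d) * U)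
      (Q := 2 * D * (b * (d * U))) (fun x _ => by rw [abs_of_nonneg (hw0 x)]; exact hwb x)
      (by positivity)
      (by rw [show κ / (16 * b) * (2 * b) = κ / 8 by field_simp; ring]; linarith) (by
        calc p * ∑ x, ∑ y, 2 * w x ^ 2 * edgeMat R₂ x y
            ≤ p * ∑ x, ∑ y, 2 * w x ^ 2 * edgeMat R x y := by
              refine mul_le_mul_of_nonneg_left (Finset.sum_le_sum fun x _ => Finset.sum_le_sum
                fun y _ => mul_le_mul_of_nonneg_left ?_ (by positivity)) hp0
              rw [hR12]; linarith [hpos R₁ x y]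
          _ = 2 * D * ∑ x, w x ^ 2 := by
              simp only [← Finset.mul_sum, hk]
              rw [← Finset.sum_mul, ← Finset.mul_sum, ← hD]; ring
          _ ≤ _ := mul_le_mul_of_nonneg_left hwsq (by positivity))
    refine (binPr_mono hp0 hp1 R₂ fun E₂ _ hA => ?_).trans (htail.trans ?_)
    · have hA := hA.2.2
      change κ * (D * d) * U < |∑ x, ∑ y, w x * (edgeMat E₁ x y + edgeMat E₂ x y) - D * d * U| at hA
      have hsplit : ∑ x, ∑ y, w x * (edgeMat E₁ x y + edgeMat E₂ x y) =
          ∑ x, ∑ y, w x * edgeMat E₁ x y + ∑ x, ∑ y, w x * (edgeMat E₂ x y - p * edgeMat R₂ x y) +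
            ∑ x, ∑ y, w x * (p * edgeMat R₂ x y) := by
        simp only [← Finset.sum_add_distrib]
        refine Finset.sum_congr rfl fun x _ => Finset.sum_congr rfl fun y _ => by ring
      rw [hsplit, hthird] at hA
      change κ / 4 * (D * d) * U ≤ |∑ x, ∑ y, w x * (edgeMat E₂ x y - p * edgeMat R₂ x y)|
      obtain ⟨a, ha⟩ : ∃ a, a = ∑ x, ∑ y, w x * edgeMat E₁ x y := ⟨_, rfl⟩
      obtain ⟨c, hc⟩ : ∃ c, c = p * ∑ x, ∑ y, w x * edgeMat R₁ x y := ⟨_, rfl⟩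
      obtain ⟨m, hm⟩ : ∃ m, m = ∑ x, ∑ y, w x * (edgeMat E₂ x y - p * edgeMat R₂ x y) := ⟨_, rfl⟩
      rw [← ha] at hfirst hfirst0 hA
      rw [← hc] at hloss hloss0 hA
      rw [← hm] at hA ⊢
      have hb' := mul_le_mul_of_nonneg_right hbκ hU0
      have e : a + m + (D * d * U - c) - D * d * U = m + (a - c) := by ring
      rw [e] at hA
      have h1 := abs_add_le m (a - c)
      have h2 : |a - c| ≤ 4 * b * U + p * d * U := by
        rw [abs_le]; constructor <;> nlinarith [mul_nonneg hb.le hU0, mul_nonneg (mul_nonneg hp0 hd) hU0]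
      nlinarith
    · refine mul_le_mul_of_nonneg_left (Real.exp_le_exp.2 ?_) (by norm_num)
      have e : -(κ / (16 * b) * (κ / 4 * (D * d) * U)) +
          (κ / (16 * b)) ^ 2 * (2 * D * (b * (d * U))) = -(κ ^ 2 * D * d / (128 * b) * U) := by
        field_simp; ring
      rw [e]
      have : κ ^ 2 * D ^ 2 * d / (256 * b) = κ ^ 2 * D * d / (128 * b) * (D / 2) := by
        field_simp; ring
      rw [this]
      exact neg_le_neg (mul_le_mul_of_nonneg_left hUD (by positivity))

/-- A random set of pairs forms a mixing pair with a fixed regular graph having a spectral gap. -/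
lemma binPr_not_mixingPair {p : ℝ} (hp0 : 0 ≤ p) (hp1 : p ≤ 1) {R T : Finset (Sym2 (Fin n))}
    (hR : ∀ e ∈ R, ¬ e.IsDiag) (hn : 0 < n) {k D d γ σ κ θ c ρ l : ℝ} {r : ℕ}
    (hk : ∀ x, ∑ y, edgeMat R x y = k) (hpk : p * k = D) (hT : ∀ x, ∑ y, edgeMat T x y = d)
    (hD : 0 < D) (hd : 0 < d) (hσ0 : 0 < σ) (hσ1 : σ ≤ 1 / 2) (hκ0 : 0 < κ) (hκ1 : κ ≤ 1)
    (hθ : 0 < θ) (hγ : 0 ≤ γ)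
    (hgap : ∀ g : Fin n → ℝ, ∑ x, g x = 0 →
      l2 ((edgeMat R * edgeMat T).mulVec g) ≤ (1 - 2 * γ) * (d * k) * l2 g)
    (hσD : 128 * Real.log n ≤ σ ^ 2 * D)
    (hθD : 128 ≤ θ * (D * d))
    (hpd : p * (d * Real.exp (Real.log n / 4)) ≤ Real.log n * (θ * (D * d)) / 8)
    (hbκ : 4 * (θ * (D * d)) + p * d ≤ 3 * κ / 4 * (D * d))
    (hκD : 4096 * Real.log n * θ ≤ κ ^ 2 * D)
    (hρ : 0 < ρ) (hc : 0 ≤ c) (hpc : p * n ≤ c * D) (hl : 0 ≤ l) (hl1 : l * 2 ≤ 1)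
    (hlc : l * (4 * c) ≤ ρ) (hbig : 256 * Real.log n ≤ l * ρ ^ 2 * D)
    (hr : 4 * ((2 * r + 1) * ρ + 4 / 2 ^ r) ≤ γ) :
    binPr p R (fun E => ¬ MixingPair (D⁻¹ • edgeMat E) (d⁻¹ • edgeMat T) γ σ κ θ) ≤
      23 / (n : ℝ) ^ 14 := by
  have hn1 : (1 : ℝ) ≤ n := by exact_mod_cast hn
  have hn0 : (0 : ℝ) < n := by linarith
  have hL : 0 ≤ Real.log n := Real.log_nonneg hn1
  have hexp : Real.exp (-(16 * Real.log n)) = 1 / (n : ℝ) ^ 16 := by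
    rw [Real.exp_neg, show (16 : ℝ) * Real.log n = ((16 : ℕ) : ℝ) * Real.log n by norm_num,
      Real.exp_nat_mul, Real.exp_log hn0, one_div]
  have b1 : binPr p R (fun E => ∃ v ∈ (Finset.univ : Finset (Fin n)),
      σ * D ≤ |∑ y, edgeMat E v y - D|) ≤ n * (2 * (1 / (n : ℝ) ^ 16)) := by
    refine (binPr_exists_le hp0 hp1 R _ _).trans ((Finset.sum_le_card_nsmul _ _
      (2 * (1 / (n : ℝ) ^ 16)) fun v _ => ?_).trans (by simp))
    refine (binPr_degree_tail hp0 hp1 hR hk hpk v (l := σ / 4) (by positivity)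
      (by linarith)).trans ?_
    rw [← hexp]
    refine mul_le_mul_of_nonneg_left (Real.exp_le_exp.2 ?_) (by norm_num)
    nlinarith
  have b2 : binPr p R (fun E => ∃ w ∈ (Finset.univ : Finset (Fin n × Fin n)),
      θ * (D * d) ≤ (edgeMat E * edgeMat T) w.1 w.2) ≤ n * n * (1 / (n : ℝ) ^ 16) := by
    refine (binPr_exists_le hp0 hp1 R _ _).trans ((Finset.sum_le_card_nsmul _ _
      (1 / (n : ℝ) ^ 16) fun v _ => ?_).trans (by simp))
    refine (binPr_codegree_tail hp0 hp1 R T hT v.1 v.2 (l := Real.log n / 4)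
      (by positivity)).trans ?_
    rw [← hexp]
    refine Real.exp_le_exp.2 ?_
    nlinarith [mul_le_mul_of_nonneg_left hθD hL]
  have b3 : binPr p R (fun E => ∃ v ∈ (Finset.univ : Finset (Fin n)),
      ((∀ x, (edgeMat E * edgeMat T) v x ≤ θ * (D * d)) ∧ D / 2 ≤ ∑ y, edgeMat E v y ∧
        κ * (D * d) * ∑ y, edgeMat E v y <
        |∑ x, ∑ y, (edgeMat E * edgeMat T) v x * edgeMat E x y - D * d * ∑ y, edgeMat E v y|)) ≤
      n * (2 * (1 / (n : ℝ) ^ 16)) := by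
    refine (binPr_exists_le hp0 hp1 R _ _).trans ((Finset.sum_le_card_nsmul _ _
      (2 * (1 / (n : ℝ) ^ 16)) fun v _ => ?_).trans (by simp))
    refine (binPr_harmonic hp0 hp1 hR hk hpk hT hd.le hD.le (b := θ * (D * d)) (by positivity)
      hκ0.le hκ1 hbκ v).trans ?_
    rw [← hexp]
    refine mul_le_mul_of_nonneg_left (Real.exp_le_exp.2 (neg_le_neg ?_)) (by norm_num)
    rw [show κ ^ 2 * D ^ 2 * d / (256 * (θ * (D * d))) = κ ^ 2 * D / (256 * θ) by field_simp,
      le_div_iff₀ (by positivity)]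
    linarith
  have b4 := binPr_discrepancy hp0 hp1 hR hn hD.le hρ hc hpc hl hl1 hlc hbig
  refine (binPr_mono hp0 hp1 R fun E _ hE => ?_).trans
    ((binPr_or_le hp0 hp1 R _ _).trans (add_le_add b1
      ((binPr_or_le hp0 hp1 R _ _).trans (add_le_add b2
        ((binPr_or_le hp0 hp1 R _ _).trans (add_le_add b3 b4)))))) |>.trans ?_
  · by_contra hcon
    push Not at hcon
    obtain ⟨c1, c2, c3, c4⟩ := hcon
    have c1' : ∀ v, |∑ y, edgeMat E v y - D| ≤ σ * D := fun v => (c1 v (Finset.mem_univ _)).le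
    have c2' : ∀ x y, (edgeMat E * edgeMat T) x y ≤ θ * (D * d) := fun x y =>
      (c2 (x, y) (Finset.mem_univ _)).le
    have hdeg : ∀ v, D / 2 ≤ ∑ y, edgeMat E v y := fun v => by
      have := (abs_le.1 (c1' v)).1
      nlinarith
    have hrow : ∀ x, ∑ y, |edgeMat E x y - p * edgeMat R x y| ≤ 4 * D := fun x => by
      have h1 := (abs_le.1 (c1' x)).2
      calc ∑ y, |edgeMat E x y - p * edgeMat R x y|
          ≤ ∑ y, (edgeMat E x y + p * edgeMat R x y) := by
            refine Finset.sum_le_sum fun y _ => (abs_sub _ _).trans ?_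
            rw [abs_of_nonneg (edgeMat_nonneg _ _ _),
              abs_of_nonneg (mul_nonneg hp0 (edgeMat_nonneg _ _ _))]
        _ = ∑ y, edgeMat E x y + D := by rw [Finset.sum_add_distrib, ← Finset.mul_sum, hk, hpk]
        _ ≤ 4 * D := by nlinarith
    have hM : ∀ g, l2 ((edgeMat E - p • edgeMat R).mulVec g) ≤ γ * D * l2 g := fun g => by
      have h := l2_mulVec_le_of_discrepancy (M := edgeMat E - p • edgeMat R) (ρ := ρ * D)
        (c := 4 * D) (fun x y => by simp [edgeMat_symm _ x y]) (by positivity)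
        (fun S T => by simpa using c4 hrow S T) (fun x => by simpa using hrow x) r g
      refine h.trans (mul_le_mul_of_nonneg_right ?_ (l2_nonneg _))
      calc 4 * ((2 * r + 1) * (ρ * D) + 4 * D / 2 ^ r) = 4 * ((2 * r + 1) * ρ + 4 / 2 ^ r) * D := by
            ring
        _ ≤ γ * D := mul_le_mul_of_nonneg_right hr hD.le
    exact hE (mixingPair_smul hD hd (edgeMat_nonneg E) (edgeMat_nonneg T) (edgeMat_symm E)
      (edgeMat_symm T) hT c1' c2'
      (fun v => c3 v (Finset.mem_univ _) (fun x => c2' v x) (hdeg v))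
      (fun g hg => l2_mul_mulVec_le hd hp0 (edgeMat_nonneg T) (edgeMat_symm T) hT hpk
        (by positivity) hM hgap g hg))
  · have : (n : ℝ) * (2 * (1 / n ^ 16)) + (n * n * (1 / n ^ 16) + (n * (2 * (1 / n ^ 16)) + 18 / n ^ 15)) =
        (22 / n + 1) / (n : ℝ) ^ 14 := by field_simp; ring
    rw [this]
    gcongr
    have : 22 / (n : ℝ) ≤ 22 := div_le_self (by norm_num) hn1
    linarith

end TypicalPair

section SpectralGap

/-- The edges of a graph as a finite set of pairs. -/
def pairsOf (K : SimpleGraph (Fin n)) : Finset (Sym2 (Fin n)) :=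
  Finset.univ.filter fun e => e ∈ K.edgeSet

lemma mem_pairsOf {K : SimpleGraph (Fin n)} {e : Sym2 (Fin n)} :
    e ∈ pairsOf K ↔ e ∈ K.edgeSet := by simp [pairsOf]

lemma edgeMat_pairsOf (K : SimpleGraph (Fin n)) (x y : Fin n) :
    edgeMat (pairsOf K) x y = if K.Adj x y then 1 else 0 := by
  rw [edgeMat_apply]
  simp only [mem_pairsOf, SimpleGraph.mem_edgeSet]

lemma sum_edgeMat_pairsOf {K : SimpleGraph (Fin n)} {d : ℕ} (hK : IsRegularGraph K d) (x : Fin n) :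
    ∑ y, edgeMat (pairsOf K) x y = d := by
  simp only [edgeMat_pairsOf]
  rw [← hK x, deg_eq_card, Finset.card_filter, Nat.cast_sum]
  refine Finset.sum_congr rfl fun z _ => ?_
  split_ifs <;> simp

lemma edgeMat_pairsOf_compl (K : SimpleGraph (Fin n)) (x y : Fin n) :
    edgeMat (pairsOf Kᶜ) x y = 1 - (if x = y then 1 else 0) - edgeMat (pairsOf K) x y := by
  rw [edgeMat_pairsOf, edgeMat_pairsOf, SimpleGraph.compl_adj]
  by_cases h : x = y
  · subst h; simp
  · by_cases h2 : K.Adj x y <;> simp [h, h2]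

lemma sum_edgeMat_pairsOf_compl {K : SimpleGraph (Fin n)} {d : ℕ} (hK : IsRegularGraph K d)
    (x : Fin n) : ∑ y, edgeMat (pairsOf Kᶜ) x y = n - 1 - d := by
  simp only [edgeMat_pairsOf_compl, Finset.sum_sub_distrib, sum_edgeMat_pairsOf hK]
  simp

lemma pairsOf_compl_mulVec (K : SimpleGraph (Fin n)) {g : Fin n → ℝ} (hg : ∑ x, g x = 0) :
    (edgeMat (pairsOf Kᶜ)).mulVec g = (-1 : ℝ) • (g + (edgeMat (pairsOf K)).mulVec g) := by
  ext x
  simp only [Matrix.mulVec, dotProduct, edgeMat_pairsOf_compl, sub_mul, Finset.sum_sub_distrib,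
    one_mul, hg, Pi.smul_apply, Pi.add_apply, smul_eq_mul]
  simp only [ite_mul, one_mul, zero_mul, Finset.sum_ite_eq, Finset.mem_univ, if_true]
  ring

lemma sum_pairsOf_mulVec {K : SimpleGraph (Fin n)} {d : ℕ} (hK : IsRegularGraph K d)
    {g : Fin n → ℝ} (hg : ∑ x, g x = 0) : ∑ x, (edgeMat (pairsOf K)).mulVec g x = 0 := by
  simp only [Matrix.mulVec, dotProduct]
  rw [Finset.sum_comm]
  have : ∀ y, ∑ x, edgeMat (pairsOf K) x y * g y = d * g y := fun y => by
    rw [← Finset.sum_mul, ← sum_edgeMat_pairsOf hK y]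
    simp only [edgeMat_symm _ y]
  rw [Finset.sum_congr rfl fun y _ => this y, ← Finset.mul_sum, hg, mul_zero]

/-- The nontrivial spectrum of `K` is bounded by `β`. -/
def SpectralGap (K : SimpleGraph (Fin n)) (β : ℝ) : Prop :=
  ∀ g : Fin n → ℝ, ∑ x, g x = 0 → l2 ((edgeMat (pairsOf K)).mulVec g) ≤ β * l2 g

lemma l2_pairsOf_mulVec_le {K : SimpleGraph (Fin n)} {d : ℕ} (hK : IsRegularGraph K d)
    (hd : 0 < d) (g : Fin n → ℝ) : l2 ((edgeMat (pairsOf K)).mulVec g) ≤ d * l2 g :=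
  l2_mulVec_le_of_row_sum (by exact_mod_cast hd) (edgeMat_nonneg _) (edgeMat_symm _)
    (sum_edgeMat_pairsOf hK) g

lemma SpectralGap.of_dense {K : SimpleGraph (Fin n)} {d : ℕ} (hK : IsRegularGraph K d)
    {β : ℝ} (hdn : (d : ℝ) < n - 1) (h : (n : ℝ) - d ≤ β) : SpectralGap K β := by
  intro g hg
  have h1 := l2_mulVec_le_of_row_sum (d := n - 1 - d) (by linarith) (edgeMat_nonneg (pairsOf Kᶜ))
    (edgeMat_symm _) (sum_edgeMat_pairsOf_compl hK) g
  have h2 : (edgeMat (pairsOf K)).mulVec g = (-1 : ℝ) • (g + (edgeMat (pairsOf Kᶜ)).mulVec g) := by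
    rw [pairsOf_compl_mulVec K hg]; ext x; simp
  rw [h2, l2_smul]
  have h3 := l2_add_le g ((edgeMat (pairsOf Kᶜ)).mulVec g)
  have h4 := mul_le_mul_of_nonneg_right h (l2_nonneg g)
  rw [abs_neg, abs_one, one_mul]
  linarith

/-- Contraction of a graph followed by its complement. -/
lemma l2_compl_mul_mulVec_le {K : SimpleGraph (Fin n)} {d : ℕ} (hK : IsRegularGraph K d) {γ : ℝ}
    (hd : 0 < d) (hdn : (d : ℝ) < n - 1)
    (h : SpectralGap K ((1 - 2 * γ) * d) ∨ (d : ℝ) + 1 ≤ (1 - 2 * γ) * (n - 1 - d))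
    (g : Fin n → ℝ) (hg : ∑ x, g x = 0) :
    l2 ((edgeMat (pairsOf Kᶜ) * edgeMat (pairsOf K)).mulVec g) ≤
      (1 - 2 * γ) * (d * (n - 1 - d)) * l2 g := by
  rw [← Matrix.mulVec_mulVec]
  have hd0 : (0 : ℝ) < d := by exact_mod_cast hd
  rcases h with h | h
  · have h1 := l2_mulVec_le_of_row_sum (d := n - 1 - d) (by linarith) (edgeMat_nonneg (pairsOf Kᶜ))
      (edgeMat_symm _) (sum_edgeMat_pairsOf_compl hK) ((edgeMat (pairsOf K)).mulVec g)
    have h2 := mul_le_mul_of_nonneg_left (h g hg) (by linarith : (0 : ℝ) ≤ n - 1 - d)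
    linarith
  · rw [pairsOf_compl_mulVec K (sum_pairsOf_mulVec hK hg), l2_smul, abs_neg, abs_one, one_mul]
    set u := (edgeMat (pairsOf K)).mulVec g with hu
    have h1 := l2_add_le u ((edgeMat (pairsOf K)).mulVec u)
    have h2 := l2_pairsOf_mulVec_le hK hd u
    have h3 := l2_pairsOf_mulVec_le hK hd g
    rw [← hu] at h3
    have h4 := mul_le_mul_of_nonneg_left h3 (by linarith : (0 : ℝ) ≤ d + 1)
    have h5 := mul_le_mul_of_nonneg_right h (mul_nonneg hd0.le (l2_nonneg g))
    linarith

/-- The pairs on which the adjacency relation of `K` differs from the pattern of `P` and `Q`. -/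
def cutDefect (K : SimpleGraph (Fin n)) (P Q : Finset (Fin n)) : Finset (Fin n × Fin n) :=
  Finset.univ.filter fun w => ¬ (K.Adj w.1 w.2 ↔ (w.1 ∈ P ↔ w.2 ∈ Q))

lemma exists_cutDefect_le {K : SimpleGraph (Fin n)} {β : ℝ} (hβ : 0 ≤ β)
    (h : ¬ SpectralGap K β) :
    ∃ P Q : Finset (Fin n), ((cutDefect K P Q).card : ℝ) ≤ 2 * (n : ℝ) ^ 2 - 4 * n * β := by
  unfold SpectralGap at h
  push Not at h
  obtain ⟨g, hg, hlt⟩ := h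
  obtain ⟨A, hA⟩ : ∃ A, A = edgeMat (pairsOf K) := ⟨_, rfl⟩
  rw [← hA] at hlt
  obtain ⟨u, hu⟩ : ∃ u, u = A.mulVec g := ⟨_, rfl⟩
  rw [← hu] at hlt
  obtain ⟨a, ha⟩ : ∃ a, a = l2 g := ⟨_, rfl⟩
  obtain ⟨b, hb⟩ : ∃ b, b = l2 u := ⟨_, rfl⟩
  have ha0 : 0 ≤ a := ha ▸ l2_nonneg g
  rw [← ha, ← hb] at hlt
  have hb0 : 0 < b := (mul_nonneg hβ ha0).trans_lt hlt
  have ha1 : 0 < a := by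
    refine lt_of_le_of_ne ha0 fun h0 => ?_
    have hsq : ∑ i, g i ^ 2 = 0 := by rw [← l2_sq, ← ha, ← h0]; norm_num
    have hg0 : g = 0 := by
      ext i
      have := (Finset.sum_eq_zero_iff_of_nonneg (fun i _ => sq_nonneg (g i))).1 hsq i
        (Finset.mem_univ _)
      simpa using this
    rw [hb, hu, hg0, Matrix.mulVec_zero] at hb0
    simp [l2] at hb0
  have hgsq : ∑ y, g y ^ 2 = a ^ 2 := by rw [ha, l2_sq]
  have husq : ∑ x, u x ^ 2 = b ^ 2 := by rw [hb, l2_sq]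
  obtain ⟨t, ht⟩ : ∃ t, t = (n : ℝ) / (2 * (a * b)) := ⟨_, rfl⟩
  have ht0 : 0 ≤ t := by rw [ht]; positivity
  refine ⟨Finset.univ.filter fun x => 0 < u x, Finset.univ.filter fun y => 0 < g y, ?_⟩
  have htot : ∑ x, ∑ y, (A x y - 1 / 2 - t * (u x * g y)) ^ 2 = (n : ℝ) ^ 2 / 2 - n * (b / a) := by
    have e : ∀ x y, (A x y - 1 / 2 - t * (u x * g y)) ^ 2 =
        1 / 4 - 2 * t * (u x * (A x y * g y)) + t * (u x * g y) + t ^ 2 * (u x ^ 2 * g y ^ 2) := by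
      intro x y
      have : A x y ^ 2 = A x y := by
        rw [hA, edgeMat_apply]; split_ifs <;> norm_num
      linear_combination this
    have e2 : ∀ x, ∑ y, A x y * g y = u x := fun x => by rw [hu]; rfl
    simp only [e, Finset.sum_add_distrib, Finset.sum_sub_distrib, ← Finset.mul_sum, e2, hg, hgsq,
      ← Finset.sum_mul, husq, mul_zero]
    simp only [← sq, husq, Finset.sum_const, Finset.card_univ, Fintype.card_fin, nsmul_eq_mul]
    rw [ht]
    field_simp
    ring
  have hcount : ((cutDefect K (Finset.univ.filter fun x => 0 < u x)
      (Finset.univ.filter fun y => 0 < g y)).card : ℝ) * (1 / 4) ≤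
      ∑ x, ∑ y, (A x y - 1 / 2 - t * (u x * g y)) ^ 2 := by
    rw [← Fintype.sum_prod_type' (fun x y => (A x y - 1 / 2 - t * (u x * g y)) ^ 2), cutDefect,
      Finset.card_filter, Nat.cast_sum, Finset.sum_mul]
    refine Finset.sum_le_sum fun w _ => ?_
    simp only [Finset.mem_filter, Finset.mem_univ, true_and]
    split_ifs with hw
    · push_cast; rw [zero_mul]; exact sq_nonneg _
    · rw [hA, edgeMat_pairsOf]
      split_ifs with hadj
      · have : u w.1 * g w.2 ≤ 0 := by
          by_contra hcon
          push Not at hcon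
          rcases pos_and_pos_or_neg_and_neg_of_mul_pos hcon with h | h
          · exact hw (by simp [hadj, h.1, h.2])
          · exact hw (by simp [hadj, h.1.not_gt, h.2.not_gt])
        have := mul_nonpos_of_nonneg_of_nonpos ht0 this
        push_cast
        nlinarith
      · have : 0 ≤ u w.1 * g w.2 := by
          by_contra hcon
          push Not at hcon
          rcases mul_neg_iff.1 hcon with h | h
          · exact hw (by simp [hadj, h.1, h.2.not_gt])
          · exact hw (by simp [hadj, h.1.not_gt, h.2])
        have := mul_nonneg ht0 this
        push_cast
        nlinarith
  rw [htot] at hcount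
  have hba : β ≤ b / a := by rw [le_div_iff₀ ha1]; exact hlt.le
  have := mul_le_mul_of_nonneg_left hba (Nat.cast_nonneg n : (0 : ℝ) ≤ n)
  linarith

lemma cutDefect_injective (P Q : Finset (Fin n)) :
    Function.Injective fun K : SimpleGraph (Fin n) => cutDefect K P Q := by
  intro K K' h
  ext x y
  have := Finset.ext_iff.1 h (x, y)
  simp only [cutDefect, Finset.mem_filter, Finset.mem_univ, true_and] at this
  tauto

lemma card_finset_card_le {α : Type*} [Fintype α] (k : ℝ) :
    (((Finset.univ : Finset (Finset α)).filter fun S => (S.card : ℝ) ≤ k).card : ℝ) ≤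
      Real.exp (9 * k + Fintype.card α / 5000) := by
  have h9 : Real.exp (-9) ≤ 1 / 5000 := by
    rw [Real.exp_neg, inv_eq_one_div]
    refine one_div_le_one_div_of_le (by norm_num) ?_
    have h1 := Real.exp_one_gt_d9
    have h2 : Real.exp 9 = Real.exp 1 ^ 9 := by rw [← Real.exp_nat_mul]; norm_num
    rw [h2]
    have h3 : (2.7 : ℝ) ^ 9 ≤ Real.exp 1 ^ 9 := pow_le_pow_left₀ (by norm_num) (by linarith) 9
    refine le_trans (by norm_num) h3
  calc (((Finset.univ : Finset (Finset α)).filter fun S => (S.card : ℝ) ≤ k).card : ℝ)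
      = ∑ S ∈ (Finset.univ : Finset (Finset α)).filter fun S => (S.card : ℝ) ≤ k, 1 := by simp
    _ ≤ ∑ S ∈ (Finset.univ : Finset (Finset α)).filter fun S => (S.card : ℝ) ≤ k,
        Real.exp (9 * k) * Real.exp (-9) ^ S.card := by
        refine Finset.sum_le_sum fun S hS => ?_
        rw [← Real.exp_nat_mul, ← Real.exp_add]
        refine Real.one_le_exp ?_
        have := (Finset.mem_filter.1 hS).2
        linarith
    _ ≤ ∑ S : Finset α, Real.exp (9 * k) * Real.exp (-9) ^ S.card :=
        Finset.sum_le_sum_of_subset_of_nonneg (Finset.filter_subset _ _) fun _ _ _ => by positivity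
    _ = Real.exp (9 * k) * (Real.exp (-9) + 1) ^ Fintype.card α := by
        rw [← Finset.mul_sum, ← Finset.powerset_univ, ← Finset.card_univ,
          ← Finset.sum_pow_mul_eq_add_pow]
        simp
    _ ≤ Real.exp (9 * k) * Real.exp (1 / 5000) ^ Fintype.card α := by
        refine mul_le_mul_of_nonneg_left (pow_le_pow_left₀ (by positivity) ?_ _) (Real.exp_pos _).le
        have := Real.add_one_le_exp (1 / 5000 : ℝ)
        linarith
    _ = _ := by rw [← Real.exp_nat_mul, ← Real.exp_add]; congr 1; ring

/-- Few graphs have a large nontrivial eigenvalue. -/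
lemma card_not_spectralGap_le {β : ℝ} (hβ : 0 ≤ β) :
    (((Finset.univ : Finset (SimpleGraph (Fin n))).filter fun K => ¬ SpectralGap K β).card : ℝ) ≤
      4 ^ n * Real.exp (9 * (2 * (n : ℝ) ^ 2 - 4 * n * β) + (n : ℝ) ^ 2 / 5000) := by
  set k : ℝ := 2 * (n : ℝ) ^ 2 - 4 * n * β
  have h1 : (Finset.univ : Finset (SimpleGraph (Fin n))).filter (fun K => ¬ SpectralGap K β) ⊆
      (Finset.univ : Finset (Finset (Fin n) × Finset (Fin n))).biUnion fun w =>
        Finset.univ.filter fun K => ((cutDefect K w.1 w.2).card : ℝ) ≤ k := by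
    intro K hK
    obtain ⟨P, Q, hPQ⟩ := exists_cutDefect_le hβ (Finset.mem_filter.1 hK).2
    exact Finset.mem_biUnion.2 ⟨(P, Q), Finset.mem_univ _, by simpa using hPQ⟩
  have h2 : ∀ w : Finset (Fin n) × Finset (Fin n),
      (((Finset.univ : Finset (SimpleGraph (Fin n))).filter fun K =>
        ((cutDefect K w.1 w.2).card : ℝ) ≤ k).card : ℝ) ≤ Real.exp (9 * k + (n : ℝ) ^ 2 / 5000) := by
    intro w
    refine le_trans ?_ ((card_finset_card_le (α := Fin n × Fin n) k).trans (le_of_eq ?_))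
    · refine Nat.cast_le.2 (Finset.card_le_card_of_injOn (fun K => cutDefect K w.1 w.2)
        (fun K hK => ?_) ((cutDefect_injective w.1 w.2).injOn))
      simpa using hK
    · simp [sq]
  calc _ ≤ (((Finset.univ : Finset (Finset (Fin n) × Finset (Fin n))).biUnion fun w =>
        Finset.univ.filter fun K => ((cutDefect K w.1 w.2).card : ℝ) ≤ k).card : ℝ) :=
        Nat.cast_le.2 (Finset.card_le_card h1)
    _ ≤ ∑ w : Finset (Fin n) × Finset (Fin n), ((Finset.univ.filter fun K =>
        ((cutDefect K w.1 w.2).card : ℝ) ≤ k).card : ℝ) := by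
        exact_mod_cast Finset.card_biUnion_le
    _ ≤ ∑ w : Finset (Fin n) × Finset (Fin n), Real.exp (9 * k + (n : ℝ) ^ 2 / 5000) :=
        Finset.sum_le_sum fun w _ => h2 w
    _ = _ := by
        rw [Finset.sum_const, nsmul_eq_mul]
        simp only [Finset.card_univ, Fintype.card_prod, Fintype.card_finset, Fintype.card_fin]
        congr 1
        push_cast
        rw [← mul_pow]; norm_num

end SpectralGap

section ManyRegularGraphs

/-- The four pairs of a closed walk of length four. -/
def quadPairs (w : Fin n × Fin n × Fin n × Fin n) : Finset (Sym2 (Fin n)) :=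
  {s(w.1, w.2.1), s(w.2.1, w.2.2.1), s(w.2.2.1, w.2.2.2), s(w.2.2.2, w.1)}

/-- Closed walks of length four alternating between edges and non-edges of `K`. -/
def switchQuads (K : SimpleGraph (Fin n)) : Finset (Fin n × Fin n × Fin n × Fin n) :=
  Finset.univ.filter fun w => K.Adj w.1 w.2.1 ∧ Kᶜ.Adj w.2.1 w.2.2.1 ∧ K.Adj w.2.2.1 w.2.2.2 ∧
    Kᶜ.Adj w.2.2.2 w.1

lemma card_quadPairs_mem_le (z : Sym2 (Fin n)) :
    ((Finset.univ : Finset (Fin n × Fin n × Fin n × Fin n)).filter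
      fun w => z ∈ quadPairs w).card ≤ 8 * n ^ 2 := by
  induction z with
  | _ u v =>
    set f : Fin 8 × Fin n × Fin n → Fin n × Fin n × Fin n × Fin n := fun t =>
      ![(u, v, t.2.1, t.2.2), (v, u, t.2.1, t.2.2), (t.2.1, u, v, t.2.2), (t.2.1, v, u, t.2.2),
        (t.2.1, t.2.2, u, v), (t.2.1, t.2.2, v, u), (v, t.2.1, t.2.2, u), (u, t.2.1, t.2.2, v)] t.1
      with hf
    have hsub : ((Finset.univ : Finset (Fin n × Fin n × Fin n × Fin n)).filter
        fun w => s(u, v) ∈ quadPairs w) ⊆ Finset.univ.image f := by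
      rintro ⟨a, b, c, e⟩ hw
      simp only [quadPairs, Finset.mem_filter, Finset.mem_univ, true_and, Finset.mem_insert,
        Finset.mem_singleton, Sym2.eq_iff] at hw
      simp only [Finset.mem_image, Finset.mem_univ, true_and]
      rcases hw with (⟨rfl, rfl⟩ | ⟨rfl, rfl⟩) | (⟨rfl, rfl⟩ | ⟨rfl, rfl⟩) |
        (⟨rfl, rfl⟩ | ⟨rfl, rfl⟩) | (⟨rfl, rfl⟩ | ⟨rfl, rfl⟩)
      exacts [⟨(0, c, e), rfl⟩, ⟨(1, c, e), rfl⟩, ⟨(2, a, e), rfl⟩, ⟨(3, a, e), rfl⟩,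
        ⟨(4, a, b), rfl⟩, ⟨(5, a, b), rfl⟩, ⟨(6, b, c), rfl⟩, ⟨(7, b, c), rfl⟩]
    refine (Finset.card_le_card hsub).trans (Finset.card_image_le.trans ?_)
    simp [sq]

lemma card_quadPairs_le (w : Fin n × Fin n × Fin n × Fin n) : (quadPairs w).card ≤ 4 :=
  Finset.card_le_four

lemma isBalanced_quadPairs {K : SimpleGraph (Fin n)} {w : Fin n × Fin n × Fin n × Fin n}
    (hw : w ∈ switchQuads K) : IsBalanced K (quadPairs w : Set (Sym2 (Fin n))) := by
  obtain ⟨a, b, c, e⟩ := w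
  simp only [switchQuads, Finset.mem_filter, Finset.mem_univ, true_and,
    SimpleGraph.compl_adj] at hw
  obtain ⟨h1, ⟨h2, h2'⟩, h3, h4, h4'⟩ := hw
  have hab := h1.ne
  have hce := h3.ne
  have hac : a ≠ c := fun h => h2' (h ▸ h1.symm)
  have hbe : b ≠ e := fun h => h2' (h ▸ h3.symm)
  have key := isBalanced_partnerPairs (K := K) (q := ![a, b, c, e]) (α := ![1, 0, 3, 2])
    (β := ![3, 2, 1, 0]) ?_ ?_ ?_ ?_ ?_ ?_
  · convert key using 1
    ext z
    simp only [quadPairs, partnerPairs, Finset.coe_insert, Finset.coe_singleton,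
      Set.mem_insert_iff, Set.mem_singleton_iff]
    constructor
    · rintro (rfl | rfl | rfl | rfl)
      exacts [⟨0, Or.inl rfl⟩, ⟨1, Or.inr rfl⟩, ⟨2, Or.inl rfl⟩, ⟨3, Or.inr rfl⟩]
    · rintro ⟨i, h⟩
      fin_cases i <;> rcases h with rfl | rfl <;> simp [Sym2.eq_swap]
  · intro i j hij
    fin_cases i <;> fin_cases j <;> simp_all
  · decide
  · decide
  · decide
  · intro i; fin_cases i
    exacts [h1, h1.symm, h3, h3.symm]
  · intro i; fin_cases i
    exacts [fun h => h4' h.symm, h2', fun h => h2' h.symm, h4']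

lemma not_isDiag_of_mem_quadPairs {K : SimpleGraph (Fin n)} {w : Fin n × Fin n × Fin n × Fin n}
    (hw : w ∈ switchQuads K) {z : Sym2 (Fin n)} (hz : z ∈ quadPairs w) : ¬ z.IsDiag := by
  obtain ⟨a, b, c, e⟩ := w
  simp only [switchQuads, Finset.mem_filter, Finset.mem_univ, true_and] at hw
  obtain ⟨h1, h2, h3, h4⟩ := hw
  simp only [quadPairs, Finset.mem_insert, Finset.mem_singleton] at hz
  rcases hz with rfl | rfl | rfl | rfl <;> rw [Sym2.mk_isDiag_iff]
  exacts [h1.ne, h2.ne, h3.ne, h4.ne]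

lemma IsBalanced.biUnion {ι : Type*} {K : SimpleGraph (Fin n)} {Z : ι → Finset (Sym2 (Fin n))}
    (S : Finset ι) (hS : ∀ i ∈ S, IsBalanced K (Z i : Set (Sym2 (Fin n))))
    (hd : (S : Set ι).PairwiseDisjoint Z) :
    IsBalanced K (S.biUnion Z : Set (Sym2 (Fin n))) := by
  obtain ⟨W, hW⟩ : ∃ W : ι → Set (Sym2 (Fin n)), ∀ i, W i = Z i := ⟨_, fun _ => rfl⟩
  obtain ⟨U, hU⟩ : ∃ U : Set (Sym2 (Fin n)), U = (S.biUnion Z : Set (Sym2 (Fin n))) := ⟨_, rfl⟩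
  have hmem : ∀ e, e ∈ U ↔ ∃ i ∈ S, e ∈ W i := fun e => by simp [hU, hW]
  have hdis : ∀ i ∈ S, ∀ j ∈ S, i ≠ j → ∀ e, e ∈ W i → e ∉ W j := by
    intro i hi j hj hij e he he'
    rw [hW, Finset.mem_coe] at he he'
    exact Finset.disjoint_left.1 (hd hi hj hij) he he'
  simp only [← hW] at hS
  rw [← hU]
  intro v
  have h1 : (Finset.univ.filter fun u => s(v, u) ∈ U ∧ K.Adj v u) =
      S.biUnion fun i => Finset.univ.filter fun u => s(v, u) ∈ W i ∧ K.Adj v u := by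
    ext u
    simp only [Finset.mem_filter, Finset.mem_univ, true_and, Finset.mem_biUnion, hmem]
    exact ⟨fun ⟨⟨i, hi, h⟩, h'⟩ => ⟨i, hi, h, h'⟩, fun ⟨i, hi, h, h'⟩ => ⟨⟨i, hi, h⟩, h'⟩⟩
  have h2 : (Finset.univ.filter fun u => s(v, u) ∈ U ∧ u ≠ v ∧ ¬ K.Adj v u) =
      S.biUnion fun i => Finset.univ.filter fun u => s(v, u) ∈ W i ∧ u ≠ v ∧ ¬ K.Adj v u := by
    ext u
    simp only [Finset.mem_filter, Finset.mem_univ, true_and, Finset.mem_biUnion, hmem]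
    exact ⟨fun ⟨⟨i, hi, h⟩, h'⟩ => ⟨i, hi, h, h'⟩, fun ⟨i, hi, h, h'⟩ => ⟨⟨i, hi, h⟩, h'⟩⟩
  rw [h1, h2, Finset.card_biUnion, Finset.card_biUnion]
  · exact Finset.sum_congr rfl fun i hi => hS i hi v
  · intro i hi j hj hij
    refine Finset.disjoint_left.2 fun u hu hu' => ?_
    exact hdis i hi j hj hij _ (Finset.mem_filter.1 hu).2.1 (Finset.mem_filter.1 hu').2.1
  · intro i hi j hj hij
    refine Finset.disjoint_left.2 fun u hu hu' => ?_
    exact hdis i hi j hj hij _ (Finset.mem_filter.1 hu).2.1 (Finset.mem_filter.1 hu').2.1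

lemma exists_disjoint_switchQuads (K : SimpleGraph (Fin n)) :
    ∃ S ⊆ switchQuads K, (S : Set (Fin n × Fin n × Fin n × Fin n)).PairwiseDisjoint quadPairs ∧
      (switchQuads K).card ≤ 32 * n ^ 2 * S.card := by
  obtain ⟨S, hS, hmax⟩ := Finset.exists_max_image
    ((switchQuads K).powerset.filter
      fun S : Finset (Fin n × Fin n × Fin n × Fin n) => (S : Set (Fin n × Fin n × Fin n × Fin n)).PairwiseDisjoint quadPairs) Finset.card
    ⟨∅, by simp⟩
  rw [Finset.mem_filter, Finset.mem_powerset] at hS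
  refine ⟨S, hS.1, hS.2, ?_⟩
  have hsub : switchQuads K ⊆ S.biUnion fun w => (quadPairs w).biUnion fun z =>
      Finset.univ.filter fun w' => z ∈ quadPairs w' := by
    intro w hw
    by_contra hcon
    have hdis : ∀ w' ∈ S, Disjoint (quadPairs w) (quadPairs w') := by
      intro w' hw'
      rw [Finset.disjoint_left]
      intro z hz hz'
      exact hcon (Finset.mem_biUnion.2 ⟨w', hw', Finset.mem_biUnion.2 ⟨z, hz', by simpa using hz⟩⟩)
    have hwS : w ∉ S := fun h => by
      have hz : s(w.1, w.2.1) ∈ quadPairs w := by simp [quadPairs]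
      exact Finset.disjoint_left.1 (hdis w h) hz hz
    have := hmax (insert w S) (Finset.mem_filter.2 ⟨Finset.mem_powerset.2
      (Finset.insert_subset hw hS.1), by
        rw [Finset.coe_insert]
        exact hS.2.insert fun w' hw' _ => hdis w' hw'⟩)
    rw [Finset.card_insert_of_notMem hwS] at this
    omega
  refine (Finset.card_le_card hsub).trans (Finset.card_biUnion_le.trans
    ((Finset.sum_le_card_nsmul _ _ (4 * (8 * n ^ 2)) fun w _ => ?_).trans ?_))
  · refine Finset.card_biUnion_le.trans ((Finset.sum_le_card_nsmul _ _ (8 * n ^ 2) fun z _ =>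
      card_quadPairs_mem_le z).trans ?_)
    rw [smul_eq_mul]
    exact Nat.mul_le_mul_right _ (card_quadPairs_le w)
  · rw [smul_eq_mul]; exact le_of_eq (by ring)

lemma two_pow_le_card_regular {K : SimpleGraph (Fin n)} {d : ℕ} (hK : IsRegularGraph K d)
    {S : Finset (Fin n × Fin n × Fin n × Fin n)} (hS : S ⊆ switchQuads K)
    (hd : (S : Set (Fin n × Fin n × Fin n × Fin n)).PairwiseDisjoint quadPairs) :
    2 ^ S.card ≤ ((Finset.univ : Finset (SimpleGraph (Fin n))).filter
      fun K => IsRegularGraph K d).card := by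
  rw [← Finset.card_powerset]
  refine Finset.card_le_card_of_injOn
    (fun S' => flip K (S'.biUnion quadPairs : Set (Sym2 (Fin n)))) ?_ ?_
  · intro S' hS'
    have hS' := Finset.mem_powerset.1 hS'
    simp only [Finset.coe_filter, Finset.mem_univ, true_and, Set.mem_ofPred_eq]
    exact hK.flip (IsBalanced.biUnion S' (fun w hw => isBalanced_quadPairs (hS (hS' hw)))
      (hd.subset (by exact_mod_cast hS')))
  · have key : ∀ S₁ ⊆ S, ∀ S₂ ⊆ S, flip K (S₁.biUnion quadPairs : Set (Sym2 (Fin n))) =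
        flip K (S₂.biUnion quadPairs : Set (Sym2 (Fin n))) → S₁ ⊆ S₂ := by
      intro S₁ h₁ S₂ h₂ h w hw
      have hw' := hS (h₁ hw)
      have hz : s(w.1, w.2.1) ∈ quadPairs w := by simp [quadPairs]
      have hne : w.1 ≠ w.2.1 := by
        have := not_isDiag_of_mem_quadPairs hw' hz
        rwa [Sym2.mk_isDiag_iff] at this
      have e : (flip K (S₁.biUnion quadPairs : Set (Sym2 (Fin n)))).Adj w.1 w.2.1 ↔
        (flip K (S₂.biUnion quadPairs : Set (Sym2 (Fin n)))).Adj w.1 w.2.1 := by rw [h]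
      rw [flip_adj, flip_adj] at e
      have m1 : s(w.1, w.2.1) ∈ (S₁.biUnion quadPairs : Set (Sym2 (Fin n))) :=
        Finset.mem_coe.2 (Finset.mem_biUnion.2 ⟨w, hw, hz⟩)
      have m2 : s(w.1, w.2.1) ∈ (S₂.biUnion quadPairs : Set (Sym2 (Fin n))) := by
        simp only [Xor] at e
        tauto
      obtain ⟨w₂, hw₂, hz₂⟩ := Finset.mem_biUnion.1 (Finset.mem_coe.1 m2)
      have : w = w₂ := by
        by_contra hcon
        exact Finset.disjoint_left.1 (hd (h₁ hw) (h₂ hw₂) hcon) hz hz₂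
      exact this ▸ hw₂
    intro S₁ h₁ S₂ h₂ h
    have h₁ := Finset.mem_powerset.1 h₁
    have h₂ := Finset.mem_powerset.1 h₂
    exact (key S₁ h₁ S₂ h₂ h).antisymm (key S₂ h₂ S₁ h₁ h.symm)

lemma card_switchQuads_ge {K : SimpleGraph (Fin n)} {d : ℕ} (hK : IsRegularGraph K d)
    (hn : 0 < n) :
    ((d : ℝ) * (n - 1 - d)) ^ 2 ≤ (switchQuads K).card := by
  obtain ⟨A, hA⟩ : ∃ A, A = edgeMat (pairsOf K) := ⟨_, rfl⟩
  obtain ⟨Z, hZ⟩ : ∃ Z, Z = edgeMat (pairsOf Kᶜ) := ⟨_, rfl⟩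
  have hcard : ((switchQuads K).card : ℝ) = ∑ a, ∑ b, ∑ c, ∑ e, A a b * Z b c * A c e * Z e a := by
    rw [switchQuads, Finset.card_filter, Nat.cast_sum, Fintype.sum_prod_type]
    refine Finset.sum_congr rfl fun a _ => ?_
    rw [Fintype.sum_prod_type]
    refine Finset.sum_congr rfl fun b _ => ?_
    rw [Fintype.sum_prod_type]
    refine Finset.sum_congr rfl fun c _ => Finset.sum_congr rfl fun e _ => ?_
    rw [hA, hZ]
    simp only [edgeMat_pairsOf]
    by_cases h1 : K.Adj a b <;> by_cases h2 : Kᶜ.Adj b c <;> by_cases h3 : K.Adj c e <;>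
      by_cases h4 : Kᶜ.Adj e a <;> simp only [h1, h2, h3, h4] <;> simp
  obtain ⟨x, hx⟩ : ∃ x : Fin n → Fin n → ℝ, x = fun a c => ∑ b, A a b * Z b c := ⟨_, rfl⟩
  have hAs : ∀ a b, A a b = A b a := hA ▸ edgeMat_symm _
  have hArow : ∀ a, ∑ b, A a b = d := hA ▸ sum_edgeMat_pairsOf hK
  have hZrow : ∀ a, ∑ b, Z a b = n - 1 - d := hZ ▸ sum_edgeMat_pairsOf_compl hK
  have hxe : ∀ a c, x a c = d - A a c - ∑ b, A a b * A b c := fun a c => by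
    rw [hx, hZ]
    simp only [edgeMat_pairsOf_compl]
    rw [← hA]
    simp only [mul_sub, mul_one, Finset.sum_sub_distrib, hArow, mul_ite, mul_zero]
    simp
  have hxs : ∀ a c, x a c = x c a := fun a c => by
    rw [hxe, hxe, hAs a c]
    congr 1
    refine Finset.sum_congr rfl fun b _ => ?_
    rw [hAs a b, hAs b c, mul_comm]
  have h1 : ∑ a, ∑ b, ∑ c, ∑ e, A a b * Z b c * A c e * Z e a = ∑ a, ∑ c, x a c ^ 2 := by
    refine Finset.sum_congr rfl fun a _ => ?_
    rw [Finset.sum_comm]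
    refine Finset.sum_congr rfl fun c _ => ?_
    rw [sq]
    conv_rhs => rw [hxs a c]
    conv_rhs => enter [1]; rw [hxs c a]
    rw [hx]
    simp only
    rw [Finset.sum_mul_sum]
    refine Finset.sum_congr rfl fun b _ => Finset.sum_congr rfl fun e _ => by ring
  have h2 : ∑ a, ∑ c, x a c = n * (d * (n - 1 - d)) := by
    have : ∀ a, ∑ c, x a c = d * (n - 1 - d) := fun a => by
      rw [hx]
      simp only
      rw [Finset.sum_comm]
      simp only [← Finset.mul_sum, hZrow]
      rw [← Finset.sum_mul, hArow]
    simp [this]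
  have h3 := sq_sum_le_card_mul_sum_sq (s := (Finset.univ : Finset (Fin n × Fin n)))
    (f := fun w => x w.1 w.2)
  rw [Fintype.sum_prod_type, Fintype.sum_prod_type, h2] at h3
  simp only [Finset.card_univ, Fintype.card_prod, Fintype.card_fin] at h3
  rw [hcard, h1]
  have hn' : (0 : ℝ) < (n : ℝ) ^ 2 := by positivity
  push_cast at h3
  rw [mul_pow, ← sq] at h3
  exact le_of_mul_le_mul_left h3 hn'

end ManyRegularGraphs

section SpectralGap

/-- Composing the adjacency operator of `K` with that of its complement contracts mean-zero vectors
by a definite factor. -/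
def ComplementGap (K : SimpleGraph (Fin n)) (d : ℕ) (γ : ℝ) : Prop :=
  ∀ g : Fin n → ℝ, ∑ x, g x = 0 →
    l2 ((edgeMat (pairsOf Kᶜ) * edgeMat (pairsOf K)).mulVec g) ≤
      (1 - 2 * γ) * (d * (n - 1 - d)) * l2 g

/-- Almost all regular graphs have a spectral gap when composed with their complement. -/
lemma card_not_complementGap_le (hn : 100000 ≤ n) {d : ℕ} (hd : 0 < d) (hdn : (d : ℝ) < n - 1) :
    (((Finset.univ : Finset (SimpleGraph (Fin n))).filter
      fun K => IsRegularGraph K d ∧ ¬ ComplementGap K d (1 / 1000000)).card : ℝ) * (n : ℝ) ^ 9 ≤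
    (((Finset.univ : Finset (SimpleGraph (Fin n))).filter fun K => IsRegularGraph K d).card : ℝ) := by
  by_cases hne : ∃ K : SimpleGraph (Fin n), IsRegularGraph K d ∧ ¬ ComplementGap K d (1 / 1000000)
  swap
  · rw [Finset.filter_eq_empty_iff.2 fun K _ h => hne ⟨K, h⟩]
    simp
  obtain ⟨K, hK, hgap⟩ := hne
  have hn' : (100000 : ℝ) ≤ n := by exact_mod_cast hn
  have hd0 : (0 : ℝ) < d := by exact_mod_cast hd
  have h1 : ¬ ((d : ℝ) + 1 ≤ (1 - 2 * (1 / 1000000)) * (n - 1 - d)) := fun h =>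
    hgap (l2_compl_mul_mulVec_le hK hd hdn (Or.inr h))
  have h2 : ¬ ((n : ℝ) - d ≤ (1 - 2 * (1 / 1000000)) * d) := fun h =>
    hgap (l2_compl_mul_mulVec_le hK hd hdn (Or.inl (SpectralGap.of_dense hK hdn h)))
  push Not at h1 h2
  have hdlow : (49 / 100 : ℝ) * n ≤ d := by linarith
  have hklow : (49 / 100 : ℝ) * n ≤ n - 1 - d := by linarith
  -- the number of graphs with a large eigenvalue
  have hbad : (((Finset.univ : Finset (SimpleGraph (Fin n))).filter
      fun K => IsRegularGraph K d ∧ ¬ ComplementGap K d (1 / 1000000)).card : ℝ) ≤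
      Real.exp (2 * n + (9 * (8 / 1000000 * (n : ℝ) ^ 2 + 4 * n) + (n : ℝ) ^ 2 / 5000)) := by
    have hsub : (Finset.univ : Finset (SimpleGraph (Fin n))).filter
        (fun K => IsRegularGraph K d ∧ ¬ ComplementGap K d (1 / 1000000)) ⊆
        Finset.univ.filter fun K => ¬ SpectralGap K ((1 - 2 * (1 / 1000000)) * d) := by
      intro K' hK'
      rw [Finset.mem_filter] at hK' ⊢
      exact ⟨Finset.mem_univ _, fun h =>
        hK'.2.2 (l2_compl_mul_mulVec_le hK'.2.1 hd hdn (Or.inl h))⟩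
    refine (Nat.cast_le.2 (Finset.card_le_card hsub)).trans
      ((card_not_spectralGap_le (by positivity)).trans ?_)
    rw [Real.exp_add (2 * (n : ℝ))]
    refine mul_le_mul ?_ (Real.exp_le_exp.2 ?_) (Real.exp_pos _).le (Real.exp_pos _).le
    · rw [mul_comm, Real.exp_nat_mul]
      refine pow_le_pow_left₀ (by norm_num) ?_ _
      have := Real.exp_one_gt_d9
      have h2 : Real.exp 2 = Real.exp 1 ^ 2 := by rw [← Real.exp_nat_mul]; norm_num
      rw [h2]; nlinarith
    · have : (n : ℝ) / 2 - 2 / 1000000 * n - 1 ≤ (1 - 2 * (1 / 1000000)) * d := by linarith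
      have := mul_le_mul_of_nonneg_left this (by linarith : (0 : ℝ) ≤ n)
      nlinarith
  -- the number of all regular graphs
  obtain ⟨S, hS, hSd, hcard⟩ := exists_disjoint_switchQuads K
  have hall := two_pow_le_card_regular hK hS hSd
  have hSn : (18 / 10000 : ℝ) * (n : ℝ) ^ 2 ≤ S.card := by
    have h3 := card_switchQuads_ge hK (by omega)
    have h4 : ((switchQuads K).card : ℝ) ≤ 32 * (n : ℝ) ^ 2 * S.card := by exact_mod_cast hcard
    have h5 : (24 / 100 * (n : ℝ) ^ 2) ^ 2 ≤ ((d : ℝ) * (n - 1 - d)) ^ 2 := by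
      refine pow_le_pow_left₀ (by positivity) ?_ 2
      nlinarith [mul_le_mul hdlow hklow (by positivity) hd0.le]
    have hn2 : (0 : ℝ) < 32 * (n : ℝ) ^ 2 := by positivity
    refine le_of_mul_le_mul_left ?_ hn2
    calc 32 * (n : ℝ) ^ 2 * (18 / 10000 * (n : ℝ) ^ 2) = (24 / 100 * (n : ℝ) ^ 2) ^ 2 := by ring
      _ ≤ _ := h5.trans (h3.trans h4)
  have hall' : Real.exp (12 / 10000 * (n : ℝ) ^ 2) ≤
      (((Finset.univ : Finset (SimpleGraph (Fin n))).filter fun K => IsRegularGraph K d).card : ℝ) := by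
    refine le_trans ?_ (Nat.cast_le.2 hall)
    push_cast
    have : (2 : ℝ) ^ S.card = Real.exp (S.card * Real.log 2) := by
      rw [Real.exp_nat_mul, Real.exp_log (by norm_num)]
    rw [this]
    refine Real.exp_le_exp.2 ?_
    have h6 := Real.log_two_gt_d9
    have h7 : (0 : ℝ) ≤ S.card := Nat.cast_nonneg _
    obtain ⟨q, hq⟩ : ∃ q : ℝ, q = S.card := ⟨_, rfl⟩
    rw [← hq] at hSn h7 ⊢
    nlinarith
  refine (mul_le_mul_of_nonneg_right hbad (by positivity)).trans (le_trans ?_ hall')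
  have h8 : (n : ℝ) ^ 9 ≤ Real.exp (9 * n) := by
    have := Real.add_one_le_exp (n : ℝ)
    rw [show (9 : ℝ) * n = ((9 : ℕ) : ℝ) * n by norm_num, Real.exp_nat_mul]
    exact pow_le_pow_left₀ (by positivity) (by linarith) _
  refine (mul_le_mul_of_nonneg_left h8 (Real.exp_pos _).le).trans ?_
  rw [← Real.exp_add]
  refine Real.exp_le_exp.2 ?_
  nlinarith

end SpectralGap

section Counting

lemma edgeCount_eq_card (G : SimpleGraph (Fin n)) : edgeCount G = (pairsOf G).card := by
  rw [edgeCount, ← Set.ncard_coe_finset]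
  congr 1
  ext e
  simp [mem_pairsOf]

lemma pairsOf_sdiff (F K : SimpleGraph (Fin n)) : pairsOf (F \ K) = pairsOf F \ pairsOf K := by
  ext e
  simp [mem_pairsOf]

lemma pairsOf_mono {F K : SimpleGraph (Fin n)} (h : K ≤ F) : pairsOf K ⊆ pairsOf F := fun _ he =>
  mem_pairsOf.2 (SimpleGraph.edgeSet_mono h (mem_pairsOf.1 he))

lemma scaledAdj_eq_smul_edgeMat (c : ℝ) (G : SimpleGraph (Fin n)) :
    scaledAdj c G = c⁻¹ • edgeMat (pairsOf G) := by
  ext x y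
  rw [scaledAdj_apply, Matrix.smul_apply, edgeMat_pairsOf]
  split_ifs <;> simp

/-- Adding `m` edges to `K` amounts to choosing `m` pairs in the complement of `K`. -/
lemma card_filter_add_edges (K : SimpleGraph (Fin n)) (m : ℕ) (A : Finset (Sym2 (Fin n)) → Prop) :
    (Finset.univ.filter fun F : SimpleGraph (Fin n) =>
      (K ≤ F ∧ edgeCount F = edgeCount K + m) ∧ A (pairsOf (F \ K))).card =
      (((pairsOf Kᶜ).powersetCard m).filter A).card := by
  refine Finset.card_bij (fun F _ => pairsOf (F \ K)) ?_ ?_ ?_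
  · intro F hF
    obtain ⟨⟨hKF, hm⟩, hA⟩ := (Finset.mem_filter.1 hF).2
    refine Finset.mem_filter.2 ⟨Finset.mem_powersetCard.2 ⟨pairsOf_mono ?_, ?_⟩, hA⟩
    · rw [sdiff_eq]; exact inf_le_right
    · rw [edgeCount_eq_card, edgeCount_eq_card] at hm
      rw [pairsOf_sdiff, Finset.card_sdiff_of_subset (pairsOf_mono hKF)]
      omega
  · intro F hF F' hF' h
    obtain ⟨⟨hKF, -⟩, -⟩ := (Finset.mem_filter.1 hF).2
    obtain ⟨⟨hKF', -⟩, -⟩ := (Finset.mem_filter.1 hF').2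
    have h1 : F \ K = F' \ K := SimpleGraph.edgeSet_inj.1 <| by
      ext e; rw [← mem_pairsOf, ← mem_pairsOf]; rw [h]
    rw [← sup_sdiff_cancel_right hKF, h1, sup_sdiff_cancel_right hKF']
  · intro E hE
    obtain ⟨hE1, hA⟩ := Finset.mem_filter.1 hE
    obtain ⟨hE2, hm⟩ := Finset.mem_powersetCard.1 hE1
    have hmem : ∀ e ∈ E, ¬ e.IsDiag ∧ e ∉ K.edgeSet := fun e he => by
      have := mem_pairsOf.1 (hE2 he)
      induction e using Sym2.ind with | _ x y
      rw [SimpleGraph.mem_edgeSet, SimpleGraph.compl_adj] at this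
      exact ⟨by simpa using this.1, by simpa using this.2⟩
    have hEq : pairsOf ((K ⊔ SimpleGraph.fromEdgeSet (E : Set (Sym2 (Fin n)))) \ K) = E := by
      ext e
      rw [mem_pairsOf, SimpleGraph.edgeSet_sdiff, SimpleGraph.edgeSet_sup,
        SimpleGraph.edgeSet_fromEdgeSet]
      simp only [Set.mem_sdiff, Set.mem_union, Finset.mem_coe]
      constructor
      · rintro ⟨h | h, h'⟩
        · exact absurd h h'
        · exact h.1
      · exact fun h => ⟨Or.inr ⟨h, fun h' => (hmem e h).1 (by simpa using h')⟩, (hmem e h).2⟩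
    refine ⟨K ⊔ SimpleGraph.fromEdgeSet (E : Set (Sym2 (Fin n))), ?_, hEq⟩
    refine Finset.mem_filter.2 ⟨Finset.mem_univ _, ⟨le_sup_left, ?_⟩, by rw [hEq]; exact hA⟩
    have h2 : (pairsOf ((K ⊔ SimpleGraph.fromEdgeSet (E : Set (Sym2 (Fin n)))) \ K)).card = m := by
      rw [hEq, hm]
    rw [pairsOf_sdiff, Finset.card_sdiff_of_subset (pairsOf_mono le_sup_left)] at h2
    have h3 := Finset.card_le_card (pairsOf_mono
      (le_sup_left : K ≤ K ⊔ SimpleGraph.fromEdgeSet (E : Set (Sym2 (Fin n)))))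
    rw [edgeCount_eq_card, edgeCount_eq_card]
    omega

/-- A lower bound for the probability of an event under a uniform distribution. -/
lemma le_prEvent_of_card_le {α : Type*} [Fintype α] {ν : PMF α} {S : Finset α}
    (hν : IsUniformOn ν (S : Set α)) {P : α → Prop} {x : ℝ} 
    (h : ((S.filter fun w => ¬ P w).card : ℝ) ≤ x * S.card) :
    ENNReal.ofReal (1 - x) ≤ prEvent ν P := by
  have hne : S.Nonempty := by
    by_contra hS
    rw [Finset.not_nonempty_iff_eq_empty] at hS
    have h1 := ν.tsum_coe
    have h2 : ∀ a, ν a = 0 := fun a => by rw [hν a, if_neg (by simp [hS])]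
    simp [h2] at h1
  have hpos : (0 : ℝ) < S.card := by exact_mod_cast hne.card_pos
  have hsplit : ((S.filter P).card : ℝ) + (S.filter fun w => ¬ P w).card = S.card := by
    exact_mod_cast Finset.card_filter_add_card_filter_not (s := S) P
  have hpr : prEvent ν P = ((S.filter P).card : ℝ≥0∞) * (S.card : ℝ≥0∞)⁻¹ := by
    rw [prEvent, tsum_fintype]
    have : ∀ a, (if P a then ν a else 0) = if a ∈ S.filter P then (S.card : ℝ≥0∞)⁻¹ else 0 := by
      intro a
      rw [hν a, Set.ncard_coe_finset]
      by_cases h1 : P a <;> by_cases h2 : a ∈ S <;> simp [h1, h2]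
    simp_rw [this]
    rw [Finset.sum_ite_mem, Finset.univ_inter, Finset.sum_const, nsmul_eq_mul]
  rw [hpr]
  have : ((S.filter P).card : ℝ≥0∞) * (S.card : ℝ≥0∞)⁻¹ =
      ENNReal.ofReal ((S.filter P).card / S.card) := by
    rw [ENNReal.ofReal_div_of_pos hpos, ENNReal.ofReal_natCast, ENNReal.ofReal_natCast,
      ENNReal.div_eq_inv_mul, mul_comm]
  rw [this]
  refine ENNReal.ofReal_le_ofReal ?_
  rw [le_div_iff₀ hpos]
  nlinarith

/-- If every fibre over a point with `Q` has a large proportion of elements with `Bad`, then `Q`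
is rare as soon as `Bad` is. -/
lemma mul_card_filter_snd_le {α β : Type*} [Fintype β] (S : Finset (α × β)) (Bad : α × β → Prop)
    (Q : β → Prop) {δ : ℝ}
    (h : ∀ y, Q y → δ * ((S.filter fun w => w.2 = y).card : ℝ) ≤
      ((S.filter fun w => Bad w ∧ w.2 = y).card : ℝ)) :
    δ * ((S.filter fun w => Q w.2).card : ℝ) ≤ (S.filter Bad).card := by
  have h1 : (S.filter fun w => Q w.2).card =
      ∑ y ∈ Finset.univ.filter Q, (S.filter fun w => w.2 = y).card := by
    rw [Finset.card_eq_sum_card_fiberwise (f := Prod.snd) (t := Finset.univ.filter Q)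
      (by intro w hw; simpa using (Finset.mem_filter.1 hw).2)]
    refine Finset.sum_congr rfl fun y hy => ?_
    rw [Finset.filter_filter]
    congr 1
    refine Finset.filter_congr fun w _ => ⟨fun h => h.2, fun h => ⟨?_, h⟩⟩
    rw [h]; exact (Finset.mem_filter.1 hy).2
  have h2 : (S.filter Bad).card = ∑ y, (S.filter fun w => Bad w ∧ w.2 = y).card := by
    rw [Finset.card_eq_sum_card_fiberwise (f := Prod.snd) (t := Finset.univ) (by simp)]
    refine Finset.sum_congr rfl fun y _ => ?_
    rw [Finset.filter_filter]
  rw [h1, h2]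
  push_cast
  rw [Finset.mul_sum]
  refine (Finset.sum_le_sum fun y hy => h y (Finset.mem_filter.1 hy).2).trans ?_
  exact Finset.sum_le_sum_of_subset_of_nonneg (Finset.filter_subset _ _) fun _ _ _ => by positivity

/-- If a property fails for few first coordinates and, conditionally on any other first
coordinate, for few second coordinates, then it fails for few pairs. -/
lemma card_filter_bad_le {α β : Type*} [Fintype α] [Fintype β] (P : α → Prop) (R : α → β → Prop)
    (Bad : α × β → Prop) (Ex : α → Prop) {M : ℕ} {x : ℝ} 
    (hM : ∀ a, P a → (Finset.univ.filter fun b => R a b).card = M)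
    (hEx : ((Finset.univ.filter fun a => P a ∧ Ex a).card : ℝ) ≤
      x * (Finset.univ.filter P).card)
    (hx : 0 ≤ x)
    (hBad : ∀ a, P a → ¬ Ex a →
      ((Finset.univ.filter fun b => R a b ∧ Bad (a, b)).card : ℝ) ≤ x * M) :
    (((Finset.univ.filter fun w : α × β => P w.1 ∧ R w.1 w.2).filter Bad).card : ℝ) ≤
      2 * x * (Finset.univ.filter fun w : α × β => P w.1 ∧ R w.1 w.2).card := by
  have key : ∀ Q : α × β → Prop, (Finset.univ.filter fun w : α × β => (P w.1 ∧ R w.1 w.2) ∧ Q w).card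
      = ∑ a ∈ Finset.univ.filter P, (Finset.univ.filter fun b => R a b ∧ Q (a, b)).card := by
    intro Q
    simp only [Finset.card_filter]
    rw [Fintype.sum_prod_type, Finset.sum_filter]
    refine Finset.sum_congr rfl fun a _ => ?_
    by_cases h : P a <;> simp [h]
  have h1 := key fun _ => True
  have h2 := key Bad
  simp only [and_true] at h1
  rw [Finset.filter_filter, h2, h1, Finset.sum_congr rfl fun a ha => hM a (Finset.mem_filter.1 ha).2,
    Finset.sum_const, smul_eq_mul]
  push_cast
  have h3 : ∀ a ∈ Finset.univ.filter P,
      ((Finset.univ.filter fun b => R a b ∧ Bad (a, b)).card : ℝ) ≤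
      (if Ex a then (M : ℝ) else 0) + x * M := by
    intro a ha
    have hPa := (Finset.mem_filter.1 ha).2
    have hM0 : 0 ≤ x * M := by positivity
    split_ifs with h
    · have : (Finset.univ.filter fun b => R a b ∧ Bad (a, b)).card ≤ M := by
        rw [← hM a hPa]
        exact Finset.card_le_card (Finset.monotone_filter_right _ fun b _ h => h.1)
      have : ((Finset.univ.filter fun b => R a b ∧ Bad (a, b)).card : ℝ) ≤ M := by
        exact_mod_cast this
      linarith
    · rw [zero_add]; exact hBad a hPa h
  refine (Finset.sum_le_sum h3).trans ?_
  rw [Finset.sum_add_distrib, ← Finset.sum_filter, Finset.filter_filter, Finset.sum_const,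
    Finset.sum_const, nsmul_eq_mul, nsmul_eq_mul]
  have := mul_le_mul_of_nonneg_right hEx (Nat.cast_nonneg (α := ℝ) M)
  linarith

end Counting

section Mixing

lemma sum_sum_edgeMat_pairsOf (G : SimpleGraph (Fin n)) :
    ∑ x, ∑ y, edgeMat (pairsOf G) x y = 2 * (pairsOf G).card := by
  have h := G.sum_degrees_eq_twice_card_edges
  have h1 : G.edgeFinset = pairsOf G := by ext e; simp [mem_pairsOf]
  have h2 : ∀ x, ∑ y, edgeMat (pairsOf G) x y = G.degree x := fun x => by
    simp only [edgeMat_pairsOf]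
    rw [← Finset.sum_filter, Finset.sum_const, nsmul_eq_mul, mul_one,
      ← SimpleGraph.card_neighborFinset_eq_degree]
    congr 2
    ext y
    simp
  simp only [h2]
  rw [← h1]
  exact_mod_cast h

lemma two_mul_card_pairsOf_compl {K : SimpleGraph (Fin n)} {d : ℕ} (hK : IsRegularGraph K d) :
    2 * ((pairsOf Kᶜ).card : ℝ) = (n - 1 - d) * n := by
  rw [← sum_sum_edgeMat_pairsOf]
  simp only [sum_edgeMat_pairsOf_compl hK]
  rw [Finset.sum_const, Finset.card_univ, Fintype.card_fin, nsmul_eq_mul, mul_comm]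

set_option maxHeartbeats 1000000 in
/-- Adding random edges to a regular graph with a good spectral gap typically gives a mixing
pair. -/
lemma card_not_mixingPair_le {K : SimpleGraph (Fin n)} {d m : ℕ} {τ ε μ L : ℝ}
    (hK : IsRegularGraph K d) (hgap : ComplementGap K d (1 / 1000000)) (hn : 0 < n) (hd : 0 < d)
    (hL : L = Real.log n) (hL1 : 64 ≤ L) (hτ0 : 0 < τ) (hτ : τ ≤ 1 / 10 ^ 20) (hε : 0 < ε)
    (hε1 : ε ≤ 1) (hτε : τ ≤ ε) (hμ : 0 < μ) (hμτ : μ ≤ τ * L) 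
    (hD : 2 * L ≤ τ ^ 8 * (2 * m / n)) (hdL : 64 * L ≤ d) (hk : ε * n ≤ 3 * (n - 1 - d))
    (hnL : Real.exp (L / 4) * (24 * L ^ 3) ≤ ε * μ ^ 2 * n)
    (hm : (m : ℝ) ≤ (n - 1 - d) * n / 2) :
    ((Finset.univ.filter fun F : SimpleGraph (Fin n) =>
      (K ≤ F ∧ edgeCount F = edgeCount K + m) ∧
        ¬ MixingPair (scaledAdj (2 * m / n) (F \ K)) (scaledAdj (d : ℝ) K)
          (1 / 1000000) (τ ^ 2) (τ ^ 2 / L) (τ ^ 2 / L ^ 2)).card : ℝ) ≤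
      23 / (n : ℝ) ^ 12 * ((pairsOf Kᶜ).card.choose m : ℝ) := by
  have hn0 : (0 : ℝ) < n := by exact_mod_cast hn
  have hd0 : (0 : ℝ) < d := by exact_mod_cast hd
  have hL0 : 0 < L := by linarith
  have hkpos : (0 : ℝ) < n - 1 - d := by nlinarith [mul_pos hε hn0]
  obtain ⟨N, hN⟩ : ∃ N, N = (pairsOf Kᶜ).card := ⟨_, rfl⟩
  have hNk : 2 * (N : ℝ) = (n - 1 - d) * n := by rw [hN]; exact two_mul_card_pairsOf_compl hK
  have hN0 : (0 : ℝ) < N := by nlinarith [mul_pos hkpos hn0]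
  have hmN' : (m : ℝ) ≤ N := by linarith
  have hmN : m ≤ N := by exact_mod_cast hmN'
  have hm0 : (0 : ℝ) < m := by
    rcases Nat.eq_zero_or_pos m with h | h
    · subst h; simp at hD; linarith
    · exact_mod_cast h
  obtain ⟨D, hDdef⟩ : ∃ D : ℝ, D = 2 * m / n := ⟨_, rfl⟩
  obtain ⟨p, hp⟩ : ∃ p : ℝ, p = m / N := ⟨_, rfl⟩
  have hD0 : 0 < D := by rw [hDdef]; positivity
  have hp0 : 0 ≤ p := by rw [hp]; positivity
  have hp1 : p ≤ 1 := by rw [hp]; exact (div_le_one hN0).2 hmN'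
  have hpk : p * (n - 1 - d) = D := by
    rw [hp, hDdef]; field_simp; linear_combination (-1 : ℝ) * hNk
  have hpn : p * n ≤ 3 / ε * D := by
    rw [← hpk, div_mul_eq_mul_div, le_div_iff₀ hε]
    nlinarith [mul_le_mul_of_nonneg_left hk hp0]
  rw [← hDdef] at hD ⊢
  have hτ1 : τ ≤ 1 := hτ.trans (by norm_num)
  have hcount := card_filter_add_edges K m fun E =>
    ¬ MixingPair (D⁻¹ • edgeMat E) ((d : ℝ)⁻¹ • edgeMat (pairsOf K))
          (1 / 1000000) (τ ^ 2) (τ ^ 2 / L) (τ ^ 2 / L ^ 2)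
  simp only [scaledAdj_eq_smul_edgeMat]
  refine (Nat.cast_le.2 (le_of_eq (Eq.trans (by congr) hcount))).trans ?_
  refine (card_powersetCard_filter_le _ (by rw [← hN]; exact hmN) _).trans ?_
  rw [← hN, ← hp]
  -- consequences of the hypotheses for the parameters
  have hτ8 : ∀ a : ℝ, 0 ≤ a → a * τ ^ 8 ≤ 2 * ε → a * L ≤ ε * D := by
    intro a ha h
    have h1 : a * (2 * L) ≤ a * (τ ^ 8 * D) := mul_le_mul_of_nonneg_left hD ha
    have h2 : a * τ ^ 8 * D ≤ 2 * ε * D := mul_le_mul_of_nonneg_right h hD0.le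
    linarith
  have hτsq : τ ^ 2 ≤ 1 / 10 ^ 40 := by
    calc τ ^ 2 ≤ (1 / 10 ^ 20) ^ 2 := pow_le_pow_left₀ hτ0.le hτ 2
      _ = 1 / 10 ^ 40 := by norm_num
  have hτsq0 : 0 < τ ^ 2 := by positivity
  have hDτ4 : 10 ^ 80 * L ≤ τ ^ 4 * D := by
    have h4 : τ ^ 4 ≤ 1 / 10 ^ 80 := by
      calc τ ^ 4 ≤ (1 / 10 ^ 20) ^ 4 := pow_le_pow_left₀ hτ0.le hτ 4
        _ = 1 / 10 ^ 80 := by norm_num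
    have := mul_le_mul_of_nonneg_right h4 (by positivity : 0 ≤ τ ^ 4 * D)
    nlinarith
  have hDτ2 : 10 ^ 80 * L ≤ τ ^ 2 * D := by
    have : τ ^ 4 * D ≤ τ ^ 2 * D := by
      refine mul_le_mul_of_nonneg_right ?_ hD0.le
      exact pow_le_pow_of_le_one hτ0.le hτ1 (by norm_num)
    linarith
  have hμτ2 : μ ^ 2 ≤ τ ^ 2 * L ^ 2 := by
    rw [← mul_pow]; exact pow_le_pow_left₀ hμ.le hμτ 2
  have hpsmall : p * Real.exp (L / 4) ≤ τ ^ 2 / L * D / 8 := by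
    have h1 : Real.exp (L / 4) * (24 * L ^ 3) ≤ ε * (τ ^ 2 * L ^ 2) * n :=
      hnL.trans (by gcongr)
    have h2 : Real.exp (L / 4) * (24 * L) ≤ ε * τ ^ 2 * n := by
      refine le_of_mul_le_mul_right ?_ (by positivity : 0 < L ^ 2)
      linarith
    have h3 : p * n * (Real.exp (L / 4) * (24 * L)) ≤ 3 / ε * D * (ε * τ ^ 2 * n) :=
      mul_le_mul hpn h2 (by positivity) (by positivity)
    have h4 : 3 / ε * D * (ε * τ ^ 2 * n) = 3 * D * τ ^ 2 * n := by field_simp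
    rw [h4] at h3
    rw [div_mul_eq_mul_div, div_div, le_div_iff₀ (by positivity)]
    refine le_of_mul_le_mul_right ?_ (by positivity : 0 < 3 * (n : ℝ))
    linarith
  have hpsmall' : p ≤ τ ^ 2 / L * D / 8 := by
    refine le_trans ?_ hpsmall
    exact le_mul_of_one_le_right hp0 (Real.one_le_exp (by positivity))
  have key := binPr_not_mixingPair (T := pairsOf K) (R := pairsOf Kᶜ) hp0 hp1
    (fun e he => (SimpleGraph.not_isDiag_of_mem_edgeSet _ (mem_pairsOf.1 he))) hn
    (sum_edgeMat_pairsOf_compl hK) hpk (sum_edgeMat_pairsOf hK) hD0 hd0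
    (σ := τ ^ 2) (κ := τ ^ 2 / L) (θ := τ ^ 2 / L ^ 2) (γ := 1 / 1000000)
    (c := 3 / ε) (ρ := 1 / 408000000) (l := ε / 4896000000) (r := 25)
    hτsq0 (hτsq.trans (by norm_num)) (by positivity)
    (by rw [div_le_one hL0]; exact hτsq.trans (by norm_num; linarith)) (by positivity) (by norm_num)
    hgap
    (by rw [← hL, ← pow_mul]; norm_num only; linarith)
    (by
      have h1 : 10 ^ 80 * L * (64 * L) ≤ τ ^ 2 * D * d :=
        mul_le_mul hDτ2 hdL (by positivity) (by positivity)
      have : τ ^ 2 / L ^ 2 * (D * d) = τ ^ 2 * D * d / L ^ 2 := by ring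
      rw [this, le_div_iff₀ (by positivity)]
      nlinarith [sq_nonneg L])
    (by
      rw [← hL]
      calc p * (d * Real.exp (L / 4)) = p * Real.exp (L / 4) * d := by ring
        _ ≤ τ ^ 2 / L * D / 8 * d := mul_le_mul_of_nonneg_right hpsmall hd0.le
        _ = L * (τ ^ 2 / L ^ 2 * (D * d)) / 8 := by field_simp)
    (by
      have h1 : p * d ≤ τ ^ 2 / L * D / 8 * d := mul_le_mul_of_nonneg_right hpsmall' hd0.le
      obtain ⟨κ, hκ⟩ : ∃ κ, κ = τ ^ 2 / L := ⟨_, rfl⟩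
      have hκ0 : 0 ≤ κ := by rw [hκ]; positivity
      have h2 : τ ^ 2 / L ^ 2 = κ / L := by rw [hκ]; field_simp
      rw [← hκ] at h1
      rw [h2, ← hκ]
      have h3 : κ / L ≤ κ / 64 := div_le_div_of_nonneg_left hκ0 (by norm_num) hL1
      have h4 : κ / L * (D * d) ≤ κ / 64 * (D * d) :=
        mul_le_mul_of_nonneg_right h3 (by positivity)
      have h5 : 0 ≤ κ * (D * d) := by positivity
      linarith)
    (by
      rw [← hL]
      have h1 : 4096 * L * (τ ^ 2 / L ^ 2) = 4096 * L * τ ^ 2 / L ^ 2 := by ring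
      have h2 : (τ ^ 2 / L) ^ 2 * D = τ ^ 2 * (τ ^ 2 * D) / L ^ 2 := by field_simp
      rw [h1, h2]
      refine div_le_div_of_nonneg_right ?_ (by positivity)
      have := mul_le_mul_of_nonneg_left hDτ2 hτsq0.le
      nlinarith [mul_pos hL0 hτsq0])
    (by norm_num) (by positivity) hpn (by positivity) (by linarith)
    (by
      have : ε / 4896000000 * (4 * (3 / ε)) = 12 / 4896000000 := by field_simp; norm_num
      rw [this]; norm_num)
    (by
      rw [← hL]
      have h1 := hτ8 (256 * (408000000 ^ 2 * 4896000000)) (by norm_num) (by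
        have h7 : τ ^ 8 ≤ τ * (1 / 10 ^ 20) ^ 7 := by
          calc τ ^ 8 = τ * τ ^ 7 := by ring
            _ ≤ τ * (1 / 10 ^ 20) ^ 7 := by gcongr
        have : τ * (1 / 10 ^ 20) ^ 7 ≤ ε * (1 / 10 ^ 20) ^ 7 := by gcongr
        nlinarith)
      have h2 : ε / 4896000000 * (1 / 408000000) ^ 2 * D =
          ε * D / (408000000 ^ 2 * 4896000000) := by ring
      rw [h2, le_div_iff₀ (by norm_num)]
      linarith)
    (by norm_num)
  have hNn : ((N : ℝ) + 1) ≤ n ^ 2 := by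
    have : (1 : ℝ) ≤ n := by exact_mod_cast hn
    nlinarith
  calc ((N : ℝ) + 1) * (N.choose m : ℝ) * _
      ≤ ((N : ℝ) + 1) * (N.choose m : ℝ) * (23 / (n : ℝ) ^ 14) :=
        mul_le_mul_of_nonneg_left key (by positivity)
    _ ≤ n ^ 2 * (N.choose m : ℝ) * (23 / (n : ℝ) ^ 14) := by gcongr
    _ = _ := by field_simp

end Mixing

section Parameters

set_option maxHeartbeats 1000000 in
/-- If most `d`-regular subgraphs of `F` form a mixing pair with their complement, then all edges
of `F` are contained in about the same number of them. -/
lemma edge_ratio_of_mixing {F : SimpleGraph (Fin n)} {d : ℕ} {τ L D : ℝ}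
    {B : Finset (SimpleGraph (Fin n))}
    (hn : 0 < n) (hL : L = Real.log n) (hL1 : 64 ≤ L) (hτ0 : 0 < τ) (hτ : τ ≤ 1 / 10 ^ 20)
    (hD : 2 * L ≤ τ ^ 8 * D) (hDn : D ≤ n) (hd : 1280 ≤ τ * d) (hτn : 10000 ≤ τ * √n)
    (hmix : ∀ K ∈ regSub F d, K ∉ B →
      MixingPair (scaledAdj D (F \ K)) (scaledAdj (d : ℝ) K)
        (1 / 1000000) (τ ^ 2) (τ ^ 2 / L) (τ ^ 2 / L ^ 2))
    (hB : (B.card : ℝ) ≤ 1 / (n : ℝ) ^ 5 * (regSub F d).card)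
    {e f : Sym2 (Fin n)} (he : e ∈ F.edgeSet) (hf : f ∈ F.edgeSet) :
    (((regSub F d).filter fun K => e ∈ K.edgeSet).card : ℝ) ≤
      (1 + τ) * ((regSub F d).filter fun K => f ∈ K.edgeSet).card := by
  have hn0 : (0 : ℝ) < n := by exact_mod_cast hn
  have hn1 : (1 : ℝ) ≤ n := by exact_mod_cast hn
  have hL0 : 0 < L := by linarith
  have hd0 : (0 : ℝ) < d := by
    by_contra h
    nlinarith
  have hd' : 0 < d := by exact_mod_cast hd0
  have hτ1 : τ ≤ 1 := hτ.trans (by norm_num)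
  have hD0 : 0 < D := by
    by_contra h
    have := pow_pos hτ0 8
    nlinarith
  have hs0 : 0 < √(n : ℝ) := Real.sqrt_pos.2 hn0
  have hs1 : 1 ≤ √(n : ℝ) := Real.one_le_sqrt.2 hn1
  have hss : √(n : ℝ) * √n = n := Real.mul_self_sqrt hn0.le
  obtain ⟨b, hb⟩ : ∃ b : ℕ, b = ⌈2000000 * L⌉₊ := ⟨_, rfl⟩
  obtain ⟨l, hl⟩ : ∃ l : ℕ, l = 3 * (2 * b + 1) := ⟨_, rfl⟩
  have hb1 : 2000000 * L ≤ b := by rw [hb]; exact Nat.le_ceil _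
  have hb2 : (b : ℝ) ≤ 2000000 * L + 1 := by
    rw [hb]; exact (Nat.ceil_lt_add_one (by positivity)).le
  have hl1 : (l : ℝ) ≤ 13000000 * L := by rw [hl]; push_cast; linarith
  have hl0 : (0 : ℝ) ≤ l := Nat.cast_nonneg _
  have hσ : τ ^ 2 ≤ τ * (1 / 10 ^ 20) := by rw [sq]; gcongr
  obtain ⟨x, hx⟩ : ∃ x, x = 26000000 * τ ^ 2 := ⟨_, rfl⟩
  have hx0 : 0 ≤ x := by rw [hx]; positivity
  have hxτ : x ≤ τ / 10 ^ 12 := by rw [hx]; linarith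
  have hκl : τ ^ 2 / L * ((2 * l : ℕ) : ℝ) ≤ x := by
    push_cast
    rw [hx, div_mul_eq_mul_div, div_le_iff₀ hL0]
    have := mul_le_mul_of_nonneg_left hl1 (sq_nonneg τ)
    linarith
  have hκ1 : τ ^ 2 / L ≤ 1 := by rw [div_le_one hL0]; linarith
  have hκ0 : 0 ≤ τ ^ 2 / L := by positivity
  have hσ0 : 0 ≤ τ ^ 2 := sq_nonneg τ
  have hup : (1 + τ ^ 2 / L) ^ (2 * l) ≤ 1 + 2 * x := by
    calc (1 + τ ^ 2 / L) ^ (2 * l) ≤ Real.exp (τ ^ 2 / L) ^ (2 * l) := by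
          refine pow_le_pow_left₀ (by positivity) ?_ _
          rw [add_comm]; exact Real.add_one_le_exp _
      _ = Real.exp (τ ^ 2 / L * ((2 * l : ℕ) : ℝ)) := by rw [← Real.exp_nat_mul, mul_comm]
      _ ≤ Real.exp x := Real.exp_le_exp.2 hκl
      _ ≤ 1 / (1 - x) := by
          rw [le_div_iff₀ (by linarith)]
          have h1 := Real.add_one_le_exp (-x)
          have h2 : Real.exp x * Real.exp (-x) = 1 := by rw [← Real.exp_add]; simp
          have := mul_le_mul_of_nonneg_left h1 (Real.exp_pos x).le
          linarith
      _ ≤ 1 + 2 * x := by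
          rw [div_le_iff₀ (by linarith)]
          nlinarith
  have hdown : 1 - x ≤ (1 - τ ^ 2 / L) ^ (2 * l) := by
    have := one_add_mul_le_pow (a := -(τ ^ 2 / L)) (by linarith) (2 * l)
    rw [← sub_eq_add_neg] at this
    refine le_trans ?_ this
    linarith
  obtain ⟨σ, hσdef⟩ : ∃ σ, σ = τ ^ 2 := ⟨_, rfl⟩
  simp only [← hσdef] at hσ hx hκl hκ1 hκ0 hσ0 hup hdown hmix
  have h40 : (1 : ℝ) + τ = 1 + 40 * (τ / 40) := by ring
  rw [h40]
  refine edge_ratio (D := D) (γ := 1 / 1000000) (σ := σ) (κ := σ / L) (θ := σ / L ^ 2)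
    (η := τ / 40) (α := τ / 1280) (δ := 1 / (n : ℝ) ^ 5) (b := b) (l := l) hD0 hDn hd' hmix hB
    ?_ (by positivity) hκ0 hκ1 hσ0 (by norm_num) (by norm_num) (by linarith) (by linarith)
    (by linarith) ?_ ?_ ?_ hl ?_ ?_ ?_ ?_ he hf
  · have h1 : (6 : ℝ) * n ^ 3 * (1 / n ^ 5) = 6 / n ^ 2 := by field_simp
    rw [h1, div_le_iff₀ (by positivity)]
    have h2 : √(n : ℝ) ≤ n ^ 2 := by nlinarith
    have := mul_le_mul_of_nonneg_left h2 hτ0.le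
    linarith
  · have h1 : (1 + σ) / (1 - σ) ≤ 1 + 4 * σ := by
      rw [div_le_iff₀ (by linarith)]
      nlinarith
    calc _ ≤ (1 + 2 * x) * (1 + 4 * σ) :=
          mul_le_mul hup h1 (div_nonneg (by linarith) (by linarith)) (by linarith)
      _ ≤ 1 + τ / 40 := by nlinarith
  · have h1 : 1 - 2 * σ ≤ (1 - σ) / (1 + σ) := by
      rw [le_div_iff₀ (by linarith)]
      nlinarith
    calc 1 - τ / 40 ≤ (1 - x) * (1 - 2 * σ) := by nlinarith
      _ ≤ _ := mul_le_mul hdown h1 (by linarith) (le_trans (by linarith) hdown)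
  · have h1 : (1 - 1 / 1000000 / 2 : ℝ) ^ b ≤ Real.exp (-L) := by
      calc (1 - 1 / 1000000 / 2 : ℝ) ^ b ≤ Real.exp (-(1 / 2000000)) ^ b := by
            refine pow_le_pow_left₀ (by norm_num) ?_ _
            have := Real.add_one_le_exp (-(1 / 2000000) : ℝ)
            linarith
        _ = Real.exp (b * -(1 / 2000000)) := by rw [← Real.exp_nat_mul]
        _ ≤ Real.exp (-L) := Real.exp_le_exp.2 (by linarith)
    have h2 : Real.exp (-L) = (n : ℝ)⁻¹ := by rw [Real.exp_neg, hL, Real.exp_log hn0]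
    rw [h2] at h1
    have h3 : (n : ℝ)⁻¹ * √n ≤ τ / 10000 := by
      rw [inv_mul_le_iff₀ hn0]
      nlinarith
    have h4 := mul_le_mul_of_nonneg_right h1 hs0.le
    have h5 : 4 * σ / (1 / 1000000) = 4000000 * σ := by ring
    rw [h5]
    linarith
  · rw [inv_le_iff_one_le_mul₀ hD0]
    have : τ ^ 8 ≤ τ * (1 / 1280) := by
      calc τ ^ 8 = τ * τ ^ 7 := by ring
        _ ≤ τ * (1 / 10 ^ 20) ^ 7 := by gcongr
        _ ≤ τ * (1 / 1280) := by gcongr; norm_num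
    have := mul_le_mul_of_nonneg_right this hD0.le
    linarith
  · rw [inv_le_iff_one_le_mul₀ hd0]
    linarith
  · have h1 : (2 * (l : ℝ) + 1) ^ 2 ≤ (27000000 * L) ^ 2 :=
      pow_le_pow_left₀ (by positivity) (by linarith) 2
    have h2 : (2 * (l : ℝ) + 1) ^ 2 * (σ / L ^ 2) ≤ 27000000 ^ 2 * σ := by
      calc _ ≤ (27000000 * L) ^ 2 * (σ / L ^ 2) := by gcongr
        _ = _ := by field_simp
    linarith
  · calc (1 + σ) ^ l ≤ Real.exp σ ^ l := by
          refine pow_le_pow_left₀ (by positivity) ?_ _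
          rw [add_comm]; exact Real.add_one_le_exp _
      _ = Real.exp (l * σ) := by rw [← Real.exp_nat_mul]
      _ ≤ Real.exp L := by
          refine Real.exp_le_exp.2 ?_
          have h1 : l * σ ≤ 13000000 * L * (1 / 10 ^ 20) :=
            mul_le_mul hl1 (by linarith) hσ0 (by positivity)
          linarith
      _ = n := by rw [hL, Real.exp_log hn0]

end Parameters

section Assembly

lemma two_mul_edgeCount {K : SimpleGraph (Fin n)} {d : ℕ} (hK : IsRegularGraph K d) :
    2 * edgeCount K = n * d := by
  have h := sum_sum_edgeMat_pairsOf K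
  simp only [sum_edgeMat_pairsOf hK] at h
  rw [Finset.sum_const, Finset.card_univ, Fintype.card_fin, nsmul_eq_mul,
    ← edgeCount_eq_card] at h
  exact_mod_cast h.symm

lemma ncard_regSub_mem (F : SimpleGraph (Fin n)) (d : ℕ) (e : Sym2 (Fin n)) :
    {K : SimpleGraph (Fin n) | IsRegularGraph K d ∧ K ≤ F ∧ e ∈ K.edgeSet}.ncard =
      ((regSub F d).filter fun K => e ∈ K.edgeSet).card := by
  rw [← Set.ncard_coe_finset]
  congr 1
  ext K
  simp [mem_regSub, and_assoc]

/-- The statement of the main theorem for a fixed number of vertices. -/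
lemma ratio_prEvent {d m : ℕ} {τ ε μ L c : ℝ} (hn : 100000 ≤ n) (hcn : 46 ≤ c * (n : ℝ) ^ 2)
    (hd : 0 < d) (hL : L = Real.log n) (hL1 : 64 ≤ L) (hτ0 : 0 < τ) (hτ : τ ≤ 1 / 10 ^ 20)
    (hε : 0 < ε) (hε1 : ε ≤ 1) (hτε : τ ≤ ε) (hμ : 0 < μ) (hμτ : μ ≤ τ * L)
    (hD : 2 * L ≤ τ ^ 8 * (2 * m / n)) (hdL : 64 * L ≤ d) (hk : ε * n ≤ 3 * (n - 1 - d))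
    (hnL : Real.exp (L / 4) * (24 * L ^ 3) ≤ ε * μ ^ 2 * n)
    (hm : (m : ℝ) ≤ (n - 1 - d) * n / 2) (hτd : 1280 ≤ τ * d) (hτn : 10000 ≤ τ * √n)
    {ν : PMF (SimpleGraph (Fin n) × SimpleGraph (Fin n))}
    (hν : IsUniformOn ν {w | IsRegularGraph w.1 d ∧ w.1 ≤ w.2 ∧
      edgeCount w.2 = edgeCount w.1 + m}) :
    ENNReal.ofReal (1 - c / (n : ℝ) ^ 2) ≤
      prEvent ν (fun w => ∀ e ∈ w.2.edgeSet, ∀ f ∈ w.2.edgeSet,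
        ({K : SimpleGraph (Fin n) | IsRegularGraph K d ∧ K ≤ w.2 ∧ e ∈ K.edgeSet}.ncard : ℝ) ≤
          (1 + τ) *
            ({K : SimpleGraph (Fin n) | IsRegularGraph K d ∧ K ≤ w.2 ∧
              f ∈ K.edgeSet}.ncard : ℝ)) := by
  simp only [ncard_regSub_mem]
  have hn' : (100000 : ℝ) ≤ n := by exact_mod_cast hn
  have hn0 : (0 : ℝ) < n := by linarith
  have hn0' : 0 < n := by omega
  have hkpos : (0 : ℝ) < n - 1 - d := by nlinarith [mul_pos hε hn0]
  obtain ⟨D, hDdef⟩ : ∃ D : ℝ, D = 2 * m / n := ⟨_, rfl⟩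
  have hDn : D ≤ n := by
    rw [hDdef, div_le_iff₀ hn0]
    have h1 : ((n : ℝ) - 1 - d) * n ≤ n * n :=
      mul_le_mul_of_nonneg_right (by linarith [Nat.cast_nonneg (α := ℝ) d]) hn0.le
    linarith
  obtain ⟨Bad, hBad⟩ : ∃ Bad : SimpleGraph (Fin n) → SimpleGraph (Fin n) → Prop,
      ∀ K F, Bad K F ↔ ¬ MixingPair (scaledAdj D (F \ K)) (scaledAdj (d : ℝ) K)
        (1 / 1000000) (τ ^ 2) (τ ^ 2 / L) (τ ^ 2 / L ^ 2) := ⟨_, fun _ _ => Iff.rfl⟩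
  obtain ⟨S, hS⟩ : ∃ S : Finset (SimpleGraph (Fin n) × SimpleGraph (Fin n)),
      S = Finset.univ.filter fun w => IsRegularGraph w.1 d ∧ (w.1 ≤ w.2 ∧
        edgeCount w.2 = edgeCount w.1 + m) := ⟨_, rfl⟩
  have hmemS : ∀ w, w ∈ S ↔ IsRegularGraph w.1 d ∧ w.1 ≤ w.2 ∧
      edgeCount w.2 = edgeCount w.1 + m := fun w => by rw [hS]; simp
  have hνS : IsUniformOn ν (S : Set (SimpleGraph (Fin n) × SimpleGraph (Fin n))) := by
    convert hν using 1
    ext w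
    rw [Finset.mem_coe, hmemS]
    rfl
  refine le_prEvent_of_card_le hνS ?_
  -- few pairs are not mixing
  obtain ⟨N, hN⟩ : ∃ N, N = ⌊((n : ℝ) - 1 - d) * n / 2⌋₊ := ⟨_, rfl⟩
  have hNK : ∀ K : SimpleGraph (Fin n), IsRegularGraph K d → (pairsOf Kᶜ).card = N := by
    intro K hK
    have h := two_mul_card_pairsOf_compl hK
    rw [hN, ← h, mul_div_cancel_left₀ _ (by norm_num), Nat.floor_natCast]
  have hbad : ((S.filter fun w => Bad w.1 w.2).card : ℝ) ≤ 2 * (23 / (n : ℝ) ^ 9) * S.card := by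
    rw [hS]
    refine (fun h => (le_of_eq (by congr)).trans (LE.le.trans h (le_of_eq (by congr))))
      (card_filter_bad_le (fun K => IsRegularGraph K d)
      (fun K F => K ≤ F ∧ edgeCount F = edgeCount K + m) (fun w => Bad w.1 w.2)
      (fun K => ¬ ComplementGap K d (1 / 1000000)) (M := N.choose m)
      (x := 23 / (n : ℝ) ^ 9) ?_ ?_ (by positivity) ?_)
    · intro K hK
      have h := card_filter_add_edges K m fun _ => True
      simp only [and_true, Finset.filter_true] at h
      rw [Finset.card_powersetCard, hNK K hK] at h
      convert h
    · have h := card_not_complementGap_le hn hd (by linarith)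
      rw [div_mul_eq_mul_div, le_div_iff₀ (by positivity)]
      refine (le_of_eq (by congr)).trans (h.trans ?_)
      refine le_mul_of_one_le_left (Nat.cast_nonneg _) (by norm_num)
    · intro K hK hgap
      have h := card_not_mixingPair_le hK (not_not.1 hgap) hn0' hd hL hL1 hτ0 hτ hε hε1 hτε hμ hμτ
        hD hdL hk hnL hm
      rw [hNK K hK, ← hDdef] at h
      simp only [← hBad] at h
      refine le_trans (le_of_eq ?_) (h.trans ?_)
      · congr
      · refine mul_le_mul_of_nonneg_right ?_ (Nat.cast_nonneg _)
        refine div_le_div_of_nonneg_left (by norm_num) (by positivity) ?_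
        exact pow_le_pow_right₀ (by linarith) (by norm_num)
  -- graphs violating the conclusion contain many non-mixing subgraphs
  obtain ⟨Q, hQ⟩ : ∃ Q : SimpleGraph (Fin n) → Prop, ∀ F, Q F ↔
      ∀ e ∈ F.edgeSet, ∀ f ∈ F.edgeSet,
        (((regSub F d).filter fun K => e ∈ K.edgeSet).card : ℝ) ≤
          (1 + τ) * ((regSub F d).filter fun K => f ∈ K.edgeSet).card := ⟨_, fun _ => Iff.rfl⟩
  simp only [← hQ]
  have hmark := mul_card_filter_snd_le S (fun w => Bad w.1 w.2) (fun F => ¬ Q F)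
    (δ := 1 / (n : ℝ) ^ 5) (by
      intro F hF
      by_contra! hlt
      refine hF ((hQ F).2 fun e he f hf => ?_)
      have hpos : 0 < ((S.filter fun w => w.2 = F).card : ℝ) := by
        by_contra h
        have h0 : ((S.filter fun w => w.2 = F).card : ℝ) = 0 :=
          le_antisymm (not_lt.1 h) (Nat.cast_nonneg _)
        rw [h0, mul_zero] at hlt
        exact absurd hlt (not_lt.2 (Nat.cast_nonneg _))
      obtain ⟨w₀, hw₀⟩ := Finset.card_pos.1 (by exact_mod_cast hpos :
        0 < (S.filter fun w => w.2 = F).card)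
      obtain ⟨hw₀S, hw₀F⟩ := Finset.mem_filter.1 hw₀
      obtain ⟨hreg₀, -, hcount⟩ := (hmemS w₀).1 hw₀S
      rw [hw₀F] at hcount
      have h1 : (S.filter fun w => w.2 = F).card ≤ (regSub F d).card := by
        refine Finset.card_le_card_of_injOn Prod.fst ?_ ?_
        · intro w hw
          obtain ⟨hw1, hw2⟩ := Finset.mem_filter.1 (Finset.mem_coe.1 hw)
          have := (hmemS w).1 hw1
          rw [hw2] at this
          exact Finset.mem_coe.2 (mem_regSub.2 ⟨this.1, this.2.1⟩)
        · intro w hw w' hw' h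
          have h2 := (Finset.mem_filter.1 (Finset.mem_coe.1 hw)).2
          have h2' := (Finset.mem_filter.1 (Finset.mem_coe.1 hw')).2
          exact Prod.ext h (h2.trans h2'.symm)
      have h2 : ((regSub F d).filter fun K => Bad K F).card ≤
          (S.filter fun w => Bad w.1 w.2 ∧ w.2 = F).card := by
        refine Finset.card_le_card_of_injOn (fun K => (K, F)) ?_ ?_
        · intro K hK
          obtain ⟨hK1, hK2⟩ := Finset.mem_filter.1 (Finset.mem_coe.1 hK)
          obtain ⟨hreg, hle⟩ := mem_regSub.1 hK1
          refine Finset.mem_coe.2 (Finset.mem_filter.2 ⟨(hmemS _).2 ⟨hreg, hle, ?_⟩, hK2, rfl⟩)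
          have e1 := two_mul_edgeCount hreg
          have e2 := two_mul_edgeCount hreg₀
          simp only
          omega
        · intro K _ K' _ h
          exact (Prod.ext_iff.1 h).1
      have h1' : ((S.filter fun w => w.2 = F).card : ℝ) ≤ (regSub F d).card := by exact_mod_cast h1
      have h2' : (((regSub F d).filter fun K => Bad K F).card : ℝ) ≤
          (S.filter fun w => Bad w.1 w.2 ∧ w.2 = F).card := by exact_mod_cast h2
      refine edge_ratio_of_mixing (B := (regSub F d).filter fun K => Bad K F) hn0' hL hL1 hτ0 hτ
        (D := D) (by rw [hDdef]; exact hD) hDn hτd hτn ?_ ?_ he hf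
      · intro K hK hKB
        by_contra h
        exact hKB (Finset.mem_filter.2 ⟨hK, (hBad K F).2 h⟩)
      · refine h2'.trans (hlt.le.trans ?_)
        exact mul_le_mul_of_nonneg_left h1' (by positivity))
  have h3 := hmark.trans hbad
  rw [div_mul_eq_mul_div, one_mul, div_le_iff₀ (by positivity)] at h3
  refine le_trans (le_of_eq (by congr)) (h3.trans ?_)
  have h4 : 2 * (23 / (n : ℝ) ^ 9) * S.card * n ^ 5 = 46 / (n : ℝ) ^ 4 * S.card := by
    field_simp; ring
  rw [h4]
  refine mul_le_mul_of_nonneg_right ?_ (Nat.cast_nonneg _)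
  rw [div_le_div_iff₀ (by positivity) (by positivity)]
  have := mul_le_mul_of_nonneg_right hcn (by positivity : (0 : ℝ) ≤ (n : ℝ) ^ 2)
  nlinarith

lemma eventually_cube_mul_exp_le {s : ℝ} (hs : 0 < s) :
    ∀ᶠ n : ℕ in Filter.atTop,
      Real.log n ^ 3 * Real.exp (-(Real.log n / 4)) ≤ s := by
  have h1 : Filter.Tendsto (fun n : ℕ => Real.log n / 4) Filter.atTop Filter.atTop :=
    (Real.tendsto_log_atTop.comp tendsto_natCast_atTop_atTop).atTop_div_const (by norm_num)
  have h2 := (Real.tendsto_pow_mul_exp_neg_atTop_nhds_zero 3).comp h1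
  filter_upwards [h2.eventually (gt_mem_nhds (show 0 < s / 64 by positivity))] with n hn
  have h3 : Real.log n ^ 3 * Real.exp (-(Real.log n / 4)) =
      64 * ((Real.log n / 4) ^ 3 * Real.exp (-(Real.log n / 4))) := by ring
  rw [h3]
  simp only [Function.comp] at hn
  linarith

end Assembly

/-- **Theorem 2.3.** There is `ε₀ > 0` such that for every `ε ∈ (0,ε₀]` there is `C₀ > 0`
such that for every sufficiently small `μ > 0` there is `C > 0` such that for every `c > 0`
and all sufficiently large `n`: for every `d` with `C·log n ≤ d ≤ n−1`, `dn` even, and every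
integer `m` with `ε·d·n ≤ m ≤ (n−1−d)n/2`, if `F ~ F(n,d,m)` (realised here as the second
coordinate of the uniform distribution `ν` on pairs `(K,F)` with `K` `d`-regular, `K ⊆ F` and
`e(F) = e(K) + m`), then with probability at least `1 − c·n⁻²` every pair of edges
`e, f ∈ E(F)` satisfies
`|𝒦_d(F)_e| ≤ (1 + C₀·max{μ/log n, (n log n/m)^{1/8}})·|𝒦_d(F)_f|`. -/
theorem main_technical_theorem :
    ∃ ε₀ : ℝ, 0 < ε₀ ∧
      ∀ ε : ℝ, 0 < ε → ε ≤ ε₀ →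
        ∃ C₀ : ℝ, 0 < C₀ ∧
          ∃ μ₀ : ℝ, 0 < μ₀ ∧
            ∀ μ : ℝ, 0 < μ → μ ≤ μ₀ →
              ∃ C : ℝ, 0 < C ∧
                ∀ c : ℝ, 0 < c →
                  ∃ n₀ : ℕ, ∀ n : ℕ, n₀ ≤ n →
                    ∀ d : ℕ, C * Real.log n ≤ (d : ℝ) → d ≤ n - 1 → Even (d * n) →
                      ∀ m : ℕ, ε * d * n ≤ (m : ℝ) →
                        (m : ℝ) ≤ ((n : ℝ) - 1 - d) * n / 2 →
                        ∀ ν : PMF (SimpleGraph (Fin n) × SimpleGraph (Fin n)),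
                          IsUniformOn ν {w | IsRegularGraph w.1 d ∧ w.1 ≤ w.2 ∧
                            edgeCount w.2 = edgeCount w.1 + m} →
                          ENNReal.ofReal (1 - c / (n : ℝ) ^ 2) ≤
                            prEvent ν (fun w =>
                              ∀ e ∈ w.2.edgeSet, ∀ f ∈ w.2.edgeSet,
                                ({K : SimpleGraph (Fin n) | IsRegularGraph K d ∧ K ≤ w.2 ∧
                                    e ∈ K.edgeSet}.ncard : ℝ) ≤
                                  (1 + C₀ * max (μ / Real.log n)
                                      (((n : ℝ) * Real.log n / m) ^ ((1 : ℝ) / 8))) *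
                                    ({K : SimpleGraph (Fin n) | IsRegularGraph K d ∧ K ≤ w.2 ∧
                                      f ∈ K.edgeSet}.ncard : ℝ)) := by
  refine ⟨1, one_pos, fun ε hε hε1 => ⟨1, one_pos, 1, one_pos, fun μ hμ _ => ?_⟩⟩
  obtain ⟨t, ht⟩ : ∃ t : ℝ, t = ε / 10 ^ 20 := ⟨_, rfl⟩
  have ht0 : 0 < t := by rw [ht]; positivity
  have htε : t ≤ ε := by rw [ht]; exact div_le_self hε.le (by norm_num)
  have ht20 : t ≤ 1 / 10 ^ 20 := by rw [ht]; gcongr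
  refine ⟨64 + 1280 / μ + 1 / (ε * t ^ 8), by positivity, fun c hc => ?_⟩
  have hlog : Filter.Tendsto (fun n : ℕ => Real.log n) Filter.atTop Filter.atTop :=
    Real.tendsto_log_atTop.comp tendsto_natCast_atTop_atTop
  have hev : ∀ᶠ n : ℕ in Filter.atTop, 100000 ≤ n ∧ 46 / c ≤ (n : ℝ) ∧ 64 ≤ Real.log n ∧
      μ / t ≤ Real.log n ∧
      Real.log n ^ 3 * Real.exp (-(Real.log n / 4)) ≤ ε * μ ^ 2 / 24 ∧
      Real.log n ^ 3 * Real.exp (-(Real.log n / 4)) ≤ μ / 10000 := by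
    filter_upwards [Filter.eventually_ge_atTop 100000,
      tendsto_natCast_atTop_atTop.eventually (Filter.eventually_ge_atTop (46 / c)),
      hlog.eventually (Filter.eventually_ge_atTop 64),
      hlog.eventually (Filter.eventually_ge_atTop (μ / t)),
      eventually_cube_mul_exp_le (show 0 < ε * μ ^ 2 / 24 by positivity),
      eventually_cube_mul_exp_le (show 0 < μ / 10000 by positivity)] with n h1 h2 h3 h4 h5 h6
    exact ⟨h1, h2, h3, h4, h5, h6⟩
  obtain ⟨n₀, hn₀⟩ := Filter.eventually_atTop.1 hev
  refine ⟨n₀, fun n hn d hdC _ _ m hm1 hm2 ν hν => ?_⟩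
  obtain ⟨hn5, hnc, hL64, hμt, hexp1, hexp2⟩ := hn₀ n hn
  obtain ⟨L, hL⟩ : ∃ L : ℝ, L = Real.log n := ⟨_, rfl⟩
  rw [← hL] at hdC hL64 hμt hexp1 hexp2
  have hn' : (100000 : ℝ) ≤ n := by exact_mod_cast hn5
  have hn0 : (0 : ℝ) < n := by linarith
  have hL0 : 0 < L := by linarith
  have hCL : 64 * L + 1280 / μ * L + 1 / (ε * t ^ 8) * L ≤ d := by linarith
  have hC1 : 0 ≤ 1280 / μ * L := by positivity
  have hC2 : 0 ≤ 1 / (ε * t ^ 8) * L := by positivity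
  have hd0 : (0 : ℝ) < d := by linarith
  have hm0 : (0 : ℝ) < m := lt_of_lt_of_le (by positivity) hm1
  obtain ⟨τ, hτ⟩ : ∃ τ : ℝ, τ = max (μ / L) (((n : ℝ) * L / m) ^ ((1 : ℝ) / 8)) := ⟨_, rfl⟩
  have hq0 : (0 : ℝ) ≤ (n : ℝ) * L / m := by positivity
  have hτ1 : μ / L ≤ τ := by rw [hτ]; exact le_max_left _ _
  have hμτ : μ ≤ τ * L := (div_le_iff₀ hL0).1 hτ1
  have hτ0 : 0 < τ := lt_of_lt_of_le (by positivity) hτ1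
  have hroot : ((((n : ℝ) * L / m) ^ ((1 : ℝ) / 8)) : ℝ) ^ 8 = (n : ℝ) * L / m := by
    rw [← Real.rpow_natCast, ← Real.rpow_mul hq0]
    norm_num
  have hτ8 : (n : ℝ) * L / m ≤ τ ^ 8 := by
    rw [← hroot]
    exact pow_le_pow_left₀ (Real.rpow_nonneg hq0 _) (by rw [hτ]; exact le_max_right _ _) 8
  have hτt : τ ≤ t := by
    rw [hτ]
    refine max_le ?_ ?_
    · rw [div_le_iff₀ hL0]
      have := (div_le_iff₀ ht0).1 hμt
      linarith
    · refine le_of_pow_le_pow_left₀ (n := 8) (by norm_num) ht0.le ?_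
      rw [hroot, div_le_iff₀ hm0]
      have h1 : 1 / (ε * t ^ 8) * L ≤ d := by linarith
      rw [one_div_mul_eq_div, div_le_iff₀ (by positivity)] at h1
      have h2 := mul_le_mul_of_nonneg_left h1 hn0.le
      have h3 := mul_le_mul_of_nonneg_left hm1 (by positivity : 0 ≤ t ^ 8)
      linarith
  have hexp0 : Real.exp (L / 4) ^ 4 = n := by
    rw [← Real.exp_nat_mul]
    have : ((4 : ℕ) : ℝ) * (L / 4) = Real.log n := by rw [← hL]; push_cast; ring
    rw [this, Real.exp_log hn0]
  rw [Real.exp_neg, ← div_eq_mul_inv, div_le_iff₀ (Real.exp_pos _)] at hexp1 hexp2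
  have he1 : 1 ≤ Real.exp (L / 4) := Real.one_le_exp (by positivity)
  obtain ⟨E, hE⟩ : ∃ E, E = Real.exp (L / 4) := ⟨_, rfl⟩
  rw [← hE] at hexp0 hexp1 hexp2 he1
  have hE2 : E ^ 2 ≤ n := by
    rw [← hexp0]; exact pow_le_pow_right₀ he1 (by norm_num)
  have hsqrt : √(n : ℝ) = E ^ 2 := by
    rw [← hexp0, show E ^ 4 = (E ^ 2) ^ 2 by ring, Real.sqrt_sq (by positivity)]
  rw [← hL, ← hτ]
  simp only [one_mul]
  refine ratio_prEvent hn5 ?_ (by exact_mod_cast hd0) hL hL64 hτ0 (hτt.trans ht20) hε hε1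
    (hτt.trans htε) hμ hμτ ?_ (by linarith) ?_ ?_ hm2 ?_ ?_ hν
  · have h1 := (div_le_iff₀ hc).1 hnc
    have h2 : (n : ℝ) ≤ n ^ 2 := by nlinarith
    have := mul_le_mul_of_nonneg_left h2 hc.le
    linarith
  · rw [div_le_iff₀ hm0] at hτ8
    rw [mul_div_assoc', le_div_iff₀ hn0]
    linarith
  · have h1 : ε * d ≤ (n - 1 - d) / 2 := by
      refine le_of_mul_le_mul_right ?_ hn0
      linarith
    have h2 : 0 ≤ ε * d := by positivity
    nlinarith
  · rw [← hE]
    have h1 := mul_le_mul_of_nonneg_left hexp1 (by positivity : 0 ≤ 24 * E)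
    have h2 := mul_le_mul_of_nonneg_left hE2 (by positivity : 0 ≤ ε * μ ^ 2)
    linarith
  · have h1 : 1280 / μ * L ≤ d := by linarith
    have h2 := mul_le_mul hτ1 h1 hC1 hτ0.le
    have h3 : μ / L * (1280 / μ * L) = 1280 := by field_simp
    linarith
  · rw [hsqrt]
    have h1 : L ≤ L ^ 3 := le_self_pow₀ (by linarith) (by norm_num)
    have h2 : E ≤ E ^ 2 := le_self_pow₀ he1 (by norm_num)
    have h3 := mul_le_mul_of_nonneg_left h2 hμ.le
    have h4 : 10000 ≤ μ / L * E ^ 2 := by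
      rw [div_mul_eq_mul_div, le_div_iff₀ hL0]
      linarith
    exact h4.trans (mul_le_mul_of_nonneg_right hτ1 (by positivity))

end Sandwich
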